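/- Let K be a global function field of characteristic different from 2, i.e. a finite extension of 𝔽_q(t) where q is odd. Then the set {(a₁, a₂, a₃) ∈ (Kˣ)³ : the quadratic form a₁x² + a₂y² + a₃z² is anisotropic over K, i.e. a₁x² + a₂y² + a₃z² = 0 has no nonzero solution in K³} is diophantine over K. -/

import Mathlib

/-- A subset `S ⊆ K^ι` is diophantine over `K` if there are `m ∈ ℕ` and a polynomial
`f` in the variables `y_i` (`i : ι`) and `x_1, …, x_m` with coefficients in `K` such that
`a ∈ S` iff `f(a, x) = 0` has a solution `x ∈ K^m`. -/
def IsDiophantine {K : Type*} [Field K] {ι : Type*} [Fintype ι] (S : Set (ι → K)) : Prop :=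
  ∃ (m : ℕ) (f : MvPolynomial (ι ⊕ Fin m) K),
    ∀ a : ι → K, a ∈ S ↔ ∃ x : Fin m → K, MvPolynomial.eval (Sum.elim a x) f = 0

set_option linter.all false

namespace TAD

/-- A normalized discrete valuation on a field, with the convention `ord 0 = 0`. -/
@[ext]
structure Place (K : Type*) [Field K] where
  ord : K → ℤ
  ord_zero : ord 0 = 0
  ord_mul : ∀ x y, x ≠ 0 → y ≠ 0 → ord (x * y) = ord x + ord y
  ord_add : ∀ x y, x ≠ 0 → y ≠ 0 → x + y ≠ 0 → min (ord x) (ord y) ≤ ord (x + y)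
  ord_surj : ∃ x, x ≠ 0 ∧ ord x = 1

/-- Axioms for a possibly non-normalized valuation. -/
structure PreOrd {K : Type*} [Field K] (f : K → ℤ) : Prop where
  map_mul : ∀ x y, x ≠ 0 → y ≠ 0 → f (x * y) = f x + f y
  map_add : ∀ x y, x ≠ 0 → y ≠ 0 → x + y ≠ 0 → min (f x) (f y) ≤ f (x + y)

section preord
variable {K : Type*} [Field K] {f : K → ℤ} (hf : PreOrd f)
include hf

lemma PreOrd.one : f 1 = 0 := by
  have := hf.map_mul 1 1 one_ne_zero one_ne_zero
  rw [mul_one] at this; omega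

lemma PreOrd.pow {x : K} (hx : x ≠ 0) (n : ℕ) : f (x ^ n) = n * f x := by
  induction n with
  | zero => simp [hf.one]
  | succ n ih => rw [pow_succ, hf.map_mul _ _ (pow_ne_zero _ hx) hx, ih]; push_cast; ring

lemma PreOrd.inv {x : K} (hx : x ≠ 0) : f x⁻¹ = - f x := by
  have := hf.map_mul x x⁻¹ hx (inv_ne_zero hx)
  rw [mul_inv_cancel₀ hx, hf.one] at this; omega

lemma PreOrd.zpow {x : K} (hx : x ≠ 0) (n : ℤ) : f (x ^ n) = n * f x := by
  cases n with
  | ofNat n => simpa using hf.pow hx n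
  | negSucc n =>
    rw [zpow_negSucc, hf.inv (pow_ne_zero _ hx), hf.pow hx]
    rw [Int.negSucc_eq]; push_cast; ring

lemma PreOrd.neg {x : K} (hx : x ≠ 0) : f (-x) = f x := by
  have h1 := hf.pow (neg_ne_zero.2 hx) 2
  have h2 := hf.pow hx 2
  rw [neg_sq] at h1
  push_cast at h1 h2; omega

/-- Normalization of a nontrivial discrete valuation. -/
lemma PreOrd.normalize (hn : ∃ x, x ≠ 0 ∧ f x ≠ 0) :
    ∃ (v : Place K) (e : ℤ), 0 < e ∧ ∀ x, x ≠ 0 → f x = e * v.ord x := by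
  obtain ⟨x0, hx0, hfx0⟩ := hn
  have hex : ∃ n : ℕ, 0 < n ∧ ∃ x, x ≠ 0 ∧ f x = n := by
    rcases lt_or_gt_of_ne hfx0 with h | h
    · refine ⟨(-f x0).toNat, by omega, x0⁻¹, inv_ne_zero hx0, ?_⟩
      rw [hf.inv hx0]; omega
    · exact ⟨(f x0).toNat, by omega, x0, hx0, by omega⟩
  classical
  let e := Nat.find hex
  obtain ⟨he0, p, hp0, hp⟩ := Nat.find_spec hex
  have hmin : ∀ n : ℕ, 0 < n → (∃ x, x ≠ 0 ∧ f x = n) → e ≤ n := fun n h1 h2 =>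
    Nat.find_min' hex ⟨h1, h2⟩
  change 0 < e at he0
  change f p = (e : ℤ) at hp
  have he : (0 : ℤ) < e := by exact_mod_cast he0
  have hdvd : ∀ x, x ≠ 0 → (e : ℤ) ∣ f x := by
    intro x hx
    by_contra hnd
    have h1 : f (x * p ^ (-(f x / e))) = f x % e := by
      rw [hf.map_mul _ _ hx (zpow_ne_zero _ hp0), hf.zpow hp0, hp, Int.emod_def]; ring
    have h2 : 0 ≤ f x % e := Int.emod_nonneg _ he.ne'
    have h3 : f x % e < e := Int.emod_lt_of_pos _ he
    have h4 : f x % e ≠ 0 := fun h => hnd (Int.dvd_of_emod_eq_zero h)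
    have := hmin (f x % e).toNat (by omega) ⟨_, mul_ne_zero hx (zpow_ne_zero _ hp0), by rw [h1]; omega⟩
    omega
  have hq : ∀ x, x ≠ 0 → f x = e * (f x / e) := fun x hx => (Int.mul_ediv_cancel' (hdvd x hx)).symm
  refine ⟨{ ord := fun x => if x = 0 then 0 else f x / e
            ord_zero := by simp
            ord_mul := ?_
            ord_add := ?_
            ord_surj := ⟨p, hp0, by simp only [hp0, if_false, hp]; exact Int.ediv_self he.ne'⟩ }, e, he, ?_⟩
  · intro x y hx hy
    have h1 := hq x hx; have h2 := hq y hy; have h3 := hq _ (mul_ne_zero hx hy)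
    have h4 := hf.map_mul x y hx hy
    simp only [hx, hy, mul_ne_zero hx hy, if_false]
    rw [h3, h1, h2, ← mul_add] at h4
    have := mul_left_cancel₀ he.ne' h4
    exact this
  · intro x y hx hy hxy
    simp only [hx, hy, hxy, if_false]
    have h4 := hf.map_add x y hx hy hxy
    rcases min_le_iff.1 h4 with h | h
    · exact min_le_iff.2 (Or.inl (Int.ediv_le_ediv he h))
    · exact min_le_iff.2 (Or.inr (Int.ediv_le_ediv he h))
  · intro x hx
    simp only [hx, if_false]
    exact hq x hx

end preord

namespace Place
variable {K : Type*} [Field K] (v : Place K)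

lemma pre : PreOrd v.ord := ⟨v.ord_mul, v.ord_add⟩

@[simp] lemma ord_one : v.ord 1 = 0 := v.pre.one
@[simp] lemma ord_neg (x : K) : v.ord (-x) = v.ord x := by
  by_cases hx : x = 0
  · simp [hx]
  · exact v.pre.neg hx
lemma ord_pow (x : K) (n : ℕ) : v.ord (x ^ n) = n * v.ord x := by
  by_cases hx : x = 0
  · subst hx; rcases Nat.eq_zero_or_pos n with rfl | h
    · simp
    · simp [h.ne', v.ord_zero]
  · exact v.pre.pow hx n
lemma ord_inv (x : K) : v.ord x⁻¹ = - v.ord x := by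
  by_cases hx : x = 0
  · simp [hx, v.ord_zero]
  · exact v.pre.inv hx
lemma ord_zpow (x : K) (n : ℤ) : v.ord (x ^ n) = n * v.ord x := by
  by_cases hx : x = 0
  · subst hx; by_cases h : n = 0
    · simp [h]
    · simp [zero_zpow n h, v.ord_zero]
  · exact v.pre.zpow hx n
lemma ord_div {x y : K} (hx : x ≠ 0) (hy : y ≠ 0) : v.ord (x / y) = v.ord x - v.ord y := by
  rw [div_eq_mul_inv, v.ord_mul _ _ hx (inv_ne_zero hy), ord_inv]; ring

/-- `x` has order at least `n`. -/
def le (n : ℤ) (x : K) : Prop := x = 0 ∨ n ≤ v.ord x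

variable {v}
@[simp] lemma le_zero (n : ℤ) : v.le n 0 := Or.inl rfl
lemma le_iff {n : ℤ} {x : K} (hx : x ≠ 0) : v.le n x ↔ n ≤ v.ord x := by simp [le, hx]
lemma le_ord (x : K) : v.le (v.ord x) x := Or.inr le_rfl
lemma le.mono {n m : ℤ} {x : K} (h : v.le n x) (hm : m ≤ n) : v.le m x :=
  h.imp_right (hm.trans ·)
lemma le.add {n : ℤ} {x y : K} (hx : v.le n x) (hy : v.le n y) : v.le n (x + y) := by
  by_cases h1 : x = 0
  · simpa [h1] using hy
  by_cases h2 : y = 0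
  · simpa [h2] using hx
  by_cases h3 : x + y = 0
  · exact Or.inl h3
  rw [le_iff h1] at hx; rw [le_iff h2] at hy
  exact Or.inr ((le_min hx hy).trans (v.ord_add x y h1 h2 h3))
lemma le.neg {n : ℤ} {x : K} (hx : v.le n x) : v.le n (-x) := by
  rcases hx with h | h
  · left; simp [h]
  · right; simpa using h
lemma le.sub {n : ℤ} {x y : K} (hx : v.le n x) (hy : v.le n y) : v.le n (x - y) := by
  rw [sub_eq_add_neg]; exact hx.add hy.neg
lemma le.mul {n m : ℤ} {x y : K} (hx : v.le n x) (hy : v.le m y) : v.le (n + m) (x * y) := by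
  by_cases h1 : x = 0
  · simp [h1]
  by_cases h2 : y = 0
  · simp [h2]
  rw [le_iff h1] at hx; rw [le_iff h2] at hy
  right; rw [v.ord_mul _ _ h1 h2]; omega
lemma le.pow {n : ℤ} {x : K} (hx : v.le n x) (k : ℕ) : v.le (k * n) (x ^ k) := by
  induction k with
  | zero => right; simp
  | succ k ih => rw [pow_succ]; exact (ih.mul hx).mono (by push_cast; linarith)
lemma le.sum {ι : Type*} {s : Finset ι} {f : ι → K} {n : ℤ} (h : ∀ i ∈ s, v.le n (f i)) :
    v.le n (∑ i ∈ s, f i) := by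
  classical
  induction s using Finset.induction_on with
  | empty => simp
  | insert a s ha ih =>
    rw [Finset.sum_insert ha]
    exact (h a (Finset.mem_insert_self _ _)).add
      (ih fun i hi => h i (Finset.mem_insert_of_mem hi))
lemma le_one_zero : v.le 0 1 := Or.inr (by simp)
lemma not_le_iff {n : ℤ} {x : K} : ¬ v.le n x ↔ x ≠ 0 ∧ v.ord x < n := by
  simp [le, not_or]
lemma le_add_right_iff {n : ℤ} {x y : K} (hy : v.le n y) : v.le n (x + y) ↔ v.le n x :=
  ⟨fun h => by simpa using h.sub hy, fun h => h.add hy⟩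

/-- dominance of the smaller order -/
lemma ord_add_eq {x y : K} (hx : x ≠ 0) (hy : v.le (v.ord x + 1) y) :
    x + y ≠ 0 ∧ v.ord (x + y) = v.ord x := by
  have h0 : ¬ v.le (v.ord x + 1) (x + y) := by
    rw [le_add_right_iff hy, le_iff hx]; omega
  have h1 : v.le (v.ord x) (x + y) := (le_ord x).add (hy.mono (by omega))
  rw [not_le_iff] at h0
  refine ⟨h0.1, ?_⟩
  rw [le_iff h0.1] at h1
  omega

/-- if `x - y` is small then `ord x = ord y` -/
lemma ord_eq_of_sub {x y : K} (hy : y ≠ 0) (h : v.le (v.ord y + 1) (x - y)) :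
    x ≠ 0 ∧ v.ord x = v.ord y := by
  have := ord_add_eq hy h
  simpa using this

lemma exists_ord (v : Place K) (n : ℤ) : ∃ x, x ≠ 0 ∧ v.ord x = n := by
  obtain ⟨p, hp, h⟩ := v.ord_surj
  exact ⟨p ^ n, zpow_ne_zero _ hp, by rw [ord_zpow, h, mul_one]⟩

/-- containment of valuation rings forces equality -/
lemma eq_of_le {v w : Place K} (h : ∀ x, v.le 0 x → w.le 0 x) : v = w := by
  have h0 : ∀ x, x ≠ 0 → v.ord x = 0 → w.ord x = 0 := by
    intro x hx h1
    have h2 := h x (Or.inr h1.ge)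
    have h3 := h x⁻¹ (Or.inr (by rw [ord_inv, h1]; simp))
    rw [le_iff hx] at h2
    rw [le_iff (inv_ne_zero hx), ord_inv] at h3
    omega
  obtain ⟨p, hp, h1⟩ := v.ord_surj
  have hw : ∀ x, x ≠ 0 → w.ord x = v.ord x * w.ord p := by
    intro x hx
    have := h0 (x / p ^ (v.ord x)) (div_ne_zero hx (zpow_ne_zero _ hp))
      (by rw [ord_div _ hx (zpow_ne_zero _ hp), ord_zpow, h1]; ring)
    rw [ord_div _ hx (zpow_ne_zero _ hp), ord_zpow] at this
    linarith
  obtain ⟨y, hy, h2⟩ := w.ord_surj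
  have h3 := hw y hy
  have h4 : 0 ≤ w.ord p := by
    have := h p (Or.inr (by omega))
    rwa [le_iff hp] at this
  rw [h2] at h3
  have h5 : w.ord p = 1 := by
    have : w.ord p ∣ 1 := ⟨v.ord y, by rw [h3]; ring⟩
    exact Int.eq_one_of_dvd_one h4 this
  ext x
  by_cases hx : x = 0
  · simp [hx, ord_zero]
  · rw [hw x hx, h5, mul_one]

lemma exists_sep {v w : Place K} (h : v ≠ w) : ∃ z, z ≠ 0 ∧ 0 < v.ord z ∧ w.ord z < 0 := by
  have h1 : ∃ x, v.le 0 x ∧ ¬ w.le 0 x := by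
    by_contra hc; push Not at hc; exact h (eq_of_le hc)
  have h2 : ∃ x, w.le 0 x ∧ ¬ v.le 0 x := by
    by_contra hc; push Not at hc; exact h (eq_of_le hc).symm
  obtain ⟨x, hx1, hx2⟩ := h1
  obtain ⟨y, hy1, hy2⟩ := h2
  rw [not_le_iff] at hx2 hy2
  rw [le_iff hx2.1] at hx1
  rw [le_iff hy2.1] at hy1
  refine ⟨x / y, div_ne_zero hx2.1 hy2.1, ?_, ?_⟩
  · rw [ord_div _ hx2.1 hy2.1]; omega
  · rw [ord_div _ hx2.1 hy2.1]; omega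

/-- an element with positive order at `v` and negative at all places of `S`. -/
lemma exists_sep_finset (v : Place K) (S : Finset (Place K)) (hv : v ∉ S) :
    ∃ z, z ≠ 0 ∧ 0 < v.ord z ∧ ∀ w ∈ S, w.ord z < 0 := by
  classical
  induction S using Finset.induction_on with
  | empty => obtain ⟨p, hp, h⟩ := v.ord_surj; exact ⟨p, hp, by omega, by simp⟩
  | insert w S hw ih =>
    simp only [Finset.mem_insert, not_or] at hv
    obtain ⟨z, hz, hz1, hz2⟩ := ih hv.2
    obtain ⟨y, hy, hy1, hy2⟩ := exists_sep hv.1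
    by_cases hwz : w.ord z < 0
    · exact ⟨z, hz, hz1, by simpa [hwz] using hz2⟩
    -- z + y^r with r large
    -- for w : ord y^r < 0 ≤ ord z. for w' ∈ S with ord y ≥ 0: z dominates; with ord y<0 : y^r dominates
    obtain ⟨r, hr0, hr⟩ : ∃ r : ℕ, 0 < r ∧ ∀ w' ∈ S, -(w'.ord z) < r := by
      refine ⟨(∑ w' ∈ S, (w'.ord z).natAbs) + 1, by omega, fun w' hw' => ?_⟩
      have := Finset.single_le_sum (f := fun w' : Place K => (w'.ord z).natAbs) (fun _ _ => Nat.zero_le _) hw'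
      rw [Nat.cast_add, Nat.cast_one]
      omega
    have hyr : y ^ r ≠ 0 := pow_ne_zero _ hy
    have key : ∀ w' : Place K, w'.ord z < 0 → (w'.ord y < 0 → -(w'.ord z) < r) → z + y ^ r ≠ 0 ∧ w'.ord (z + y ^ r) < 0 := by
      intro w' h1 h2
      rcases lt_or_ge (w'.ord y) 0 with h3 | h3
      · have h4 : w'.ord (y ^ r) < w'.ord z := by
          rw [ord_pow]; have := h2 h3; nlinarith
        have := ord_add_eq (v := w') (x := y ^ r) (y := z) hyr (Or.inr (by omega))
        rw [add_comm] at this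
        exact ⟨this.1, by omega⟩
      · have h4 : 0 ≤ w'.ord (y ^ r) := by rw [ord_pow]; positivity
        have := ord_add_eq (v := w') (x := z) (y := y ^ r) hz (Or.inr (by omega))
        exact ⟨this.1, by omega⟩
    have hwk : z + y ^ r ≠ 0 ∧ w.ord (z + y ^ r) < 0 := by
      have h4 : w.ord (y ^ r) < 0 := by
        rw [ord_pow]; have : (0:ℤ) < r := by exact_mod_cast hr0
        nlinarith
      have := ord_add_eq (v := w) (x := y ^ r) (y := z) hyr (Or.inr (by omega))
      rw [add_comm] at this
      exact ⟨this.1, by omega⟩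
    refine ⟨z + y ^ r, hwk.1, ?_, ?_⟩
    · have h5 : v.le 1 (z + y ^ r) := by
        refine le.add (Or.inr (by omega)) (Or.inr ?_)
        rw [ord_pow]; have : (0:ℤ) < r := by exact_mod_cast hr0
        nlinarith
      rw [le_iff hwk.1] at h5; omega
    · intro w' hw'
      rcases Finset.mem_insert.1 hw' with rfl | h
      · exact hwk.2
      · exact (key w' (hz2 w' h) fun _ => hr w' h).2

/-- element close to 1 at `v` and close to 0 on `S`. -/
lemma exists_near (v : Place K) (S : Finset (Place K)) (hv : v ∉ S) (N : ℤ) :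
    ∃ z, v.le N (z - 1) ∧ ∀ w ∈ S, w.le N z := by
  obtain ⟨z, hz, h1, h2⟩ := exists_sep_finset v S hv
  set m : ℕ := N.toNat + 1
  have hzm : z ^ m ≠ 0 := pow_ne_zero _ hz
  have hm : N < m := by omega
  have hm0 : (0:ℤ) < m := by omega
  have h3 : 1 + z ^ m ≠ 0 ∧ v.ord (1 + z ^ m) = v.ord 1 := by
    refine ord_add_eq one_ne_zero (Or.inr ?_)
    rw [ord_pow, ord_one]; nlinarith
  refine ⟨1 / (1 + z ^ m), ?_, ?_⟩
  · have : 1 / (1 + z ^ m) - 1 = - (z ^ m / (1 + z ^ m)) := by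
      have := h3.1; field_simp; ring
    rw [this]
    refine le.neg (Or.inr ?_)
    rw [ord_div _ hzm h3.1, h3.2, ord_pow, ord_one]; nlinarith
  · intro w hw
    have h4 : z ^ m + 1 ≠ 0 ∧ w.ord (z ^ m + 1) = w.ord (z ^ m) := by
      refine ord_add_eq hzm (Or.inr ?_)
      rw [ord_pow, ord_one]; have := h2 w hw; nlinarith
    refine Or.inr ?_
    rw [ord_div _ one_ne_zero h3.1, add_comm, h4.2, ord_pow, ord_one]
    have := h2 w hw
    nlinarith

/-- Weak approximation. -/
theorem weak_approx (S : Finset (Place K)) (a : Place K → K) (N : ℤ) :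
    ∃ x, ∀ v ∈ S, v.le N (x - a v) := by
  classical
  obtain ⟨M, hM⟩ : ∃ M : ℤ, ∀ v ∈ S, ∀ w ∈ S, N ≤ M + v.ord (a w) := by
    refine ⟨N + ∑ v ∈ S, ∑ w ∈ S, |v.ord (a w)|, fun v hv w hw => ?_⟩
    have h1 : |v.ord (a w)| ≤ ∑ w ∈ S, |v.ord (a w)| :=
      Finset.single_le_sum (f := fun w => |v.ord (a w)|) (fun _ _ => abs_nonneg _) hw
    have h2 : ∑ w ∈ S, |v.ord (a w)| ≤ ∑ v ∈ S, ∑ w ∈ S, |v.ord (a w)| :=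
      Finset.single_le_sum (f := fun v => ∑ w ∈ S, |v.ord (a w)|)
        (fun _ _ => Finset.sum_nonneg fun _ _ => abs_nonneg _) hv
    have := neg_abs_le (v.ord (a w))
    linarith
  have hz : ∀ v : Place K, ∃ z, v.le M (z - 1) ∧ ∀ w ∈ S.erase v, w.le M z := fun v =>
    exists_near v (S.erase v) (by simp) M
  choose z hz1 hz2 using hz
  refine ⟨∑ w ∈ S, a w * z w, fun v hv => ?_⟩
  rw [← Finset.add_sum_erase _ _ hv]
  have : a v * z v + ∑ w ∈ S.erase v, a w * z w - a v
    = a v * (z v - 1) + ∑ w ∈ S.erase v, a w * z w := by ring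
  rw [this]
  refine le.add ?_ (le.sum fun w hw => ?_)
  · exact ((le_ord _).mul (hz1 v)).mono (by have := hM v hv v hv; omega)
  · have hw' := Finset.mem_erase.1 hw
    refine ((le_ord _).mul (hz2 w v ?_)).mono (by have := hM v hv w hw'.2; omega)
    exact Finset.mem_erase.2 ⟨hw'.1.symm, hv⟩

/-! ### Valuation ring and residue field -/

/-- valuation ring -/
def O (v : Place K) : ValuationSubring K where
  carrier := {x | v.le 0 x}
  mul_mem' := fun h1 h2 => by simpa using le.mul h1 h2
  one_mem' := le_one_zero
  add_mem' := le.add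
  zero_mem' := le_zero 0
  neg_mem' := le.neg
  mem_or_inv_mem' := fun x => by
    by_cases hx : x = 0
    · left; simp [hx]
    · rcases le_total 0 (v.ord x) with h | h
      · left; exact Or.inr h
      · right; refine Or.inr ?_; rw [ord_inv]; omega

lemma mem_O {x : K} : x ∈ v.O ↔ v.le 0 x := Iff.rfl

/-- residue field -/
abbrev κ (v : Place K) : Type _ := IsLocalRing.ResidueField v.O

open Classical in
/-- residue map, zero off the valuation ring -/
noncomputable def res (v : Place K) (x : K) : v.κ :=
  if h : v.le 0 x then IsLocalRing.residue v.O ⟨x, h⟩ else 0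

lemma res_def {x : K} (h : v.le 0 x) : v.res x = IsLocalRing.residue v.O ⟨x, h⟩ := by
  simp [res, h]

lemma isUnit_iff {x : K} (h : v.le 0 x) : IsUnit (⟨x, h⟩ : v.O) ↔ x ≠ 0 ∧ v.ord x = 0 := by
  constructor
  · intro hu
    obtain ⟨y, hy⟩ := isUnit_iff_exists_inv.1 hu
    have hxy : x * y = 1 := congrArg Subtype.val hy
    have hx : x ≠ 0 := by rintro rfl; simp at hxy
    have hy0 : (y : K) ≠ 0 := by intro h; simp [h] at hxy
    refine ⟨hx, ?_⟩
    have h1 := v.ord_mul _ _ hx hy0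
    rw [hxy, ord_one] at h1
    have h2 := (le_iff hx).1 h
    have h3 := (le_iff hy0).1 y.2
    omega
  · rintro ⟨hx, h0⟩
    refine isUnit_iff_exists_inv.2 ⟨⟨x⁻¹, Or.inr (by rw [ord_inv]; omega)⟩, ?_⟩
    ext; simp [hx]

lemma res_eq_zero_iff {x : K} (h : v.le 0 x) : v.res x = 0 ↔ v.le 1 x := by
  rw [res_def h, IsLocalRing.residue_eq_zero_iff, IsLocalRing.mem_maximalIdeal, mem_nonunits_iff,
    isUnit_iff h]
  constructor
  · intro hx
    by_cases h0 : x = 0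
    · simp [h0]
    · rw [le_iff h0] at h ⊢
      have : v.ord x ≠ 0 := fun h1 => hx ⟨h0, h1⟩
      omega
  · rintro (rfl | h1) ⟨h2, h3⟩
    · exact h2 rfl
    · omega

lemma res_add {x y : K} (hx : v.le 0 x) (hy : v.le 0 y) : v.res (x + y) = v.res x + v.res y := by
  rw [res_def hx, res_def hy, res_def (hx.add hy), ← map_add]; rfl
lemma le.mul0 {x y : K} (hx : v.le 0 x) (hy : v.le 0 y) : v.le 0 (x * y) := by
  simpa using hx.mul hy
lemma le.pow0 {x : K} (hx : v.le 0 x) (n : ℕ) : v.le 0 (x ^ n) := by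
  simpa using hx.pow n
lemma res_mul {x y : K} (hx : v.le 0 x) (hy : v.le 0 y) : v.res (x * y) = v.res x * v.res y := by
  rw [res_def hx, res_def hy, res_def (hx.mul0 hy), ← map_mul]; rfl
lemma res_neg {x : K} (hx : v.le 0 x) : v.res (-x) = - v.res x := by
  rw [res_def hx, res_def hx.neg, ← map_neg]; rfl
lemma res_sub {x y : K} (hx : v.le 0 x) (hy : v.le 0 y) : v.res (x - y) = v.res x - v.res y := by
  rw [res_def hx, res_def hy, res_def (hx.sub hy), ← map_sub]; rfl
@[simp] lemma res_one : v.res 1 = 1 := by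
  rw [res_def le_one_zero]; exact map_one _
@[simp] lemma res_zero : v.res 0 = 0 := by
  rw [res_def (le_zero 0)]; exact map_zero _
lemma res_pow {x : K} (hx : v.le 0 x) (n : ℕ) : v.res (x ^ n) = v.res x ^ n := by
  rw [res_def hx, res_def (hx.pow0 n), ← map_pow]; rfl
lemma res_surj (v : Place K) (c : v.κ) : ∃ x, v.le 0 x ∧ v.res x = c := by
  obtain ⟨⟨x, hx⟩, h⟩ := IsLocalRing.residue_surjective c
  exact ⟨x, hx, by rw [res_def hx, h]⟩
lemma res_eq_iff {x y : K} (hx : v.le 0 x) (hy : v.le 0 y) :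
    v.res x = v.res y ↔ v.le 1 (x - y) := by
  rw [← res_eq_zero_iff (hx.sub hy), res_sub hx hy, sub_eq_zero]
lemma res_ne_zero {x : K} (hx : x ≠ 0) (h : v.ord x = 0) : v.res x ≠ 0 := by
  intro h1
  rw [res_eq_zero_iff (Or.inr h.ge), le_iff hx] at h1
  omega
lemma res_ne_zero_iff {x : K} (hx : v.le 0 x) : v.res x ≠ 0 ↔ x ≠ 0 ∧ v.ord x = 0 := by
  refine ⟨fun h => ?_, fun h => res_ne_zero h.1 h.2⟩
  rw [Ne, res_eq_zero_iff hx, not_le_iff] at h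
  refine ⟨h.1, ?_⟩
  rw [le_iff h.1] at hx; omega
lemma res_inv {x : K} (hx : x ≠ 0) (h : v.ord x = 0) : v.res x⁻¹ = (v.res x)⁻¹ := by
  have h1 : v.le 0 x := Or.inr h.ge
  have h2 : v.le 0 x⁻¹ := Or.inr (by rw [ord_inv]; omega)
  have := res_mul h1 h2
  rw [mul_inv_cancel₀ hx, res_one] at this
  exact eq_inv_of_mul_eq_one_right this.symm

section const
variable {F : Type*} [Field F] [Finite F] [Algebra F K]

lemma ord_of_pow_eq_one {x : K} {n : ℕ} (hn : 0 < n) (h : x ^ n = 1) : v.ord x = 0 := by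
  have := v.ord_pow x n
  rw [h, ord_one] at this
  have hn' : (n : ℤ) ≠ 0 := by omega
  rcases mul_eq_zero.1 this.symm with h | h
  · exact absurd h hn'
  · exact h

variable (v) in
lemma ord_const (c : F) : v.ord (algebraMap F K c) = 0 := by
  by_cases hc : c = 0
  · simp [hc, ord_zero]
  · have : Fintype F := Fintype.ofFinite F
    have h1 := FiniteField.pow_card_sub_one_eq_one c hc
    have h2 : 1 < Fintype.card F := Fintype.one_lt_card
    refine ord_of_pow_eq_one (n := Fintype.card F - 1) (by omega) ?_
    rw [← map_pow, h1, map_one]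

variable (v) in
lemma le_const (c : F) : v.le 0 (algebraMap F K c) := Or.inr (ord_const v c).ge

noncomputable instance algO (v : Place K) : Algebra F v.O :=
  RingHom.toAlgebra ((algebraMap F K).codRestrict v.O.toSubring (le_const v))

noncomputable instance algκ (v : Place K) : Algebra F v.κ :=
  RingHom.toAlgebra ((IsLocalRing.residue v.O).comp (algebraMap F v.O))

lemma algebraMap_κ (c : F) : algebraMap F v.κ c = v.res (algebraMap F K c) := by
  rw [res_def (le_const v c)]; rfl

lemma le.smul {n : ℤ} {x : K} (c : F) (h : v.le n x) : v.le n (c • x) := by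
  rw [Algebra.smul_def]
  simpa using (le_const v c).mul h

lemma res_smul {x : K} (c : F) (h : v.le 0 x) : v.res (c • x) = c • v.res x := by
  rw [Algebra.smul_def, Algebra.smul_def, res_mul (le_const v c) h, algebraMap_κ]

end const
end Place
end TAD

namespace TAD
open IntermediateField Polynomial

/-- `K` is a function field of one variable over `F` (used for finite `F`). -/
class GF (F K : Type*) [Field F] [Field K] [Algebra F K] : Prop where
  exT : ∃ t : K, Transcendental F t
  fin : ∀ x : K, Transcendental F x → FiniteDimensional F⟮x⟯ K

section
variable {F K : Type*} [Field F] [Field K] [Algebra F K]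

open scoped IntermediateField.algebraAdjoinAdjoin in
lemma GF.of_exists {t : K} (ht : Transcendental F t) (hfin : FiniteDimensional F⟮t⟯ K) :
    GF F K := by
  have halg : Algebra.IsAlgebraic (Algebra.adjoin F {t}) K :=
    (IsFractionRing.comap_isAlgebraic_iff (K := F⟮t⟯)).2 inferInstance
  have htr : Algebra.trdeg F K ≤ 1 := by
    have := Algebra.IsAlgebraic.trdeg_le_cardinalMk F ({t} : Set K)
    simpa using this
  have : Algebra.EssFiniteType F F⟮t⟯ := by
    rw [IntermediateField.essFiniteType_iff]
    exact ⟨{t}, by simp⟩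
  have hess : Algebra.EssFiniteType F K := Algebra.EssFiniteType.comp F F⟮t⟯ K
  refine ⟨⟨t, ht⟩, fun x hx => ?_⟩
  have hind : AlgebraicIndependent F (fun _ : Unit => x) :=
    algebraicIndependent_unique_type_iff.2 hx
  have hb := hind.isTranscendenceBasis_of_lift_trdeg_le_of_finite (by simpa using htr)
  have h1 := hb.isAlgebraic_field
  rw [Set.range_const] at h1
  have : Algebra.EssFiniteType F⟮x⟯ K := Algebra.EssFiniteType.of_comp F F⟮x⟯ K
  obtain ⟨S, hS⟩ := IntermediateField.fg_top F⟮x⟯ K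
  have h2 : FiniteDimensional F⟮x⟯ (adjoin F⟮x⟯ (S : Set K)) :=
    finiteDimensional_adjoin fun y _ => (Algebra.IsAlgebraic.isAlgebraic y).isIntegral
  rw [hS] at h2
  exact Module.Finite.equiv (IntermediateField.topEquiv (F := F⟮x⟯) (E := K)).toLinearEquiv

/-- independence over the polynomials in `x` -/
def PInd (F : Type*) [Field F] [Algebra F K] {ι : Type*} [Fintype ι] (x : K) (y : ι → K) : Prop :=
  ∀ p : ι → F[X], ∑ i, aeval x (p i) * y i = 0 → ∀ i, p i = 0

open scoped IntermediateField.algebraAdjoinAdjoin in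
lemma pInd_iff {ι : Type*} [Fintype ι] {x : K} (hx : Transcendental F x) (y : ι → K) :
    PInd F x y ↔ LinearIndependent F⟮x⟯ y := by
  rw [← LinearIndependent.iff_fractionRing (Algebra.adjoin F {x}) F⟮x⟯, Fintype.linearIndependent_iff]
  have hmem : ∀ p : F[X], aeval x p ∈ Algebra.adjoin F {x} := fun p => by
    rw [Algebra.adjoin_singleton_eq_range_aeval]; exact ⟨p, rfl⟩
  constructor
  · intro h g hg i
    have : ∀ i, ∃ p : F[X], aeval x p = (g i : K) := fun i => by
      have h0 := (Algebra.adjoin_singleton_eq_range_aeval F x).le (g i).2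
      exact h0
    choose p hp using this
    have h1 := h p (by
      rw [← hg]; refine Finset.sum_congr rfl fun i _ => ?_
      rw [hp, Subalgebra.smul_def, smul_eq_mul]) i
    ext; rw [← hp, h1]; simp
  · intro h p hp i
    have h1 := h (fun i => ⟨aeval x (p i), hmem _⟩) (by
      rw [← hp]; exact Finset.sum_congr rfl fun i _ => by rw [Subalgebra.smul_def, smul_eq_mul]) i
    have h2 : aeval x (p i) = 0 := congrArg Subtype.val h1
    exact (transcendental_iff.1 hx) _ h2

lemma PInd.card_le [GF F K] {ι : Type*} [Fintype ι] {x : K} (hx : Transcendental F x) {y : ι → K}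
    (h : PInd F x y) : Fintype.card ι ≤ Module.finrank F⟮x⟯ K := by
  have := GF.fin x hx
  exact ((pInd_iff hx y).1 h).fintype_card_le_finrank

lemma exists_pInd [GF F K] {x : K} (hx : Transcendental F x) :
    ∃ y : Fin (Module.finrank F⟮x⟯ K) → K, PInd F x y := by
  have := GF.fin x hx
  exact ⟨Module.finBasis F⟮x⟯ K, (pInd_iff hx _).2 (Module.finBasis F⟮x⟯ K).linearIndependent⟩

lemma GF.ext (L : Type*) [Field L] [Algebra F L] [Algebra K L] [IsScalarTower F K L] [GF F K]
    [FiniteDimensional K L] : GF F L := by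
  obtain ⟨t, ht⟩ := GF.exT (F := F) (K := K)
  have := GF.fin t ht
  have ht' : Transcendental F (algebraMap K L t) :=
    (transcendental_algebraMap_iff (algebraMap K L).injective).2 ht
  refine GF.of_exists ht' ?_
  -- basis of K over F(t), basis of L over K
  have htower : Algebra.adjoin F {t} = Algebra.adjoin F {t} := rfl
  let f : F⟮t⟯ →ₐ[F] L := (IsScalarTower.toAlgHom F K L).comp F⟮t⟯.val
  have hr : ∀ z : F⟮t⟯, f z ∈ F⟮algebraMap K L t⟯ := by
    intro z
    have h1 : (F⟮t⟯.map (IsScalarTower.toAlgHom F K L)) = F⟮algebraMap K L t⟯ := by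
      rw [IntermediateField.adjoin_map]; simp
    rw [← h1]
    exact ⟨z, z.2, rfl⟩
  let g : F⟮t⟯ →+* F⟮algebraMap K L t⟯ := f.toRingHom.codRestrict F⟮algebraMap K L t⟯.toSubring hr
  let _ : Algebra F⟮t⟯ F⟮algebraMap K L t⟯ := g.toAlgebra
  have : IsScalarTower F⟮t⟯ F⟮algebraMap K L t⟯ L := IsScalarTower.of_algebraMap_eq fun z => rfl
  have : FiniteDimensional F⟮t⟯ L := FiniteDimensional.trans F⟮t⟯ K L
  exact FiniteDimensional.right F⟮t⟯ F⟮algebraMap K L t⟯ L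

section fin
variable [Finite F]

lemma exists_pow_eq_one_of_isAlgebraic {x : K} (hx : x ≠ 0) (h : IsAlgebraic F x) :
    ∃ n : ℕ, 0 < n ∧ x ^ n = 1 := by
  have h1 : FiniteDimensional F F⟮x⟯ := adjoin.finiteDimensional h.isIntegral
  have h2 : Finite F⟮x⟯ := Module.finite_of_finite F
  have : Fintype F⟮x⟯ := Fintype.ofFinite _
  have h3 := FiniteField.pow_card_sub_one_eq_one (AdjoinSimple.gen F x) (by
    intro h; apply hx
    have := congrArg (algebraMap F⟮x⟯ K) h
    simpa using this)
  have h4 : 1 < Fintype.card F⟮x⟯ := Fintype.one_lt_card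
  refine ⟨_, Nat.sub_pos_of_lt h4, ?_⟩
  have := congrArg (algebraMap F⟮x⟯ K) h3
  simpa using this

lemma Place.ord_of_isAlgebraic (v : Place K) {x : K} (h : IsAlgebraic F x) : v.ord x = 0 := by
  by_cases hx : x = 0
  · rw [hx, v.ord_zero]
  obtain ⟨n, hn, h1⟩ := exists_pow_eq_one_of_isAlgebraic hx h
  exact Place.ord_of_pow_eq_one hn h1

lemma Place.transcendental (v : Place K) {x : K} (h : v.ord x ≠ 0) : Transcendental F x :=
  fun h1 => h (v.ord_of_isAlgebraic h1)

omit [Finite F] [Algebra F K] in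
lemma exists_X_pow_mul {p : F[X]} (hp : p ≠ 0) :
    ∃ (n : ℕ) (q : F[X]), q.coeff 0 ≠ 0 ∧ p = X ^ n * q := by
  obtain ⟨q, h1, h2⟩ := exists_eq_pow_rootMultiplicity_mul_and_not_dvd p hp 0
  rw [map_zero, sub_zero] at h1 h2
  exact ⟨_, q, fun h => h2 (X_dvd_iff.2 h), h1⟩

/-- sums of terms with pairwise distinct valuations do not vanish -/
lemma exists_eq_of_sum_eq_zero {Γ : Type*} [LinearOrderedCommGroupWithZero Γ] (V : Valuation K Γ)
    {ι : Type*} [Fintype ι] (f : ι → K) (hs : ∑ i, f i = 0) (hne : ∃ i, f i ≠ 0) :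
    ∃ i j, i ≠ j ∧ f i ≠ 0 ∧ f j ≠ 0 ∧ V (f i) = V (f j) := by
  classical
  by_contra hc
  push Not at hc
  obtain ⟨i0, h0⟩ := hne
  obtain ⟨i, -, hi⟩ := Finset.exists_max_image Finset.univ (fun i => V (f i)) ⟨i0, Finset.mem_univ _⟩
  have hVi : V (f i) ≠ 0 := by
    intro h
    have := hi i0 (Finset.mem_univ _)
    rw [h] at this
    exact h0 ((V.zero_iff).1 (le_zero_iff.1 this))
  have hfi : f i ≠ 0 := fun h => hVi (by simp [h])
  rw [← Finset.add_sum_erase _ _ (Finset.mem_univ i)] at hs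
  have h1 : V (∑ j ∈ Finset.univ.erase i, f j) < V (f i) := by
    refine V.map_sum_lt hVi fun j hj => lt_of_le_of_ne (hi j (Finset.mem_univ _)) ?_
    by_cases hfj : f j = 0
    · rw [hfj, V.map_zero]; exact hVi.symm
    · exact hc j i (Finset.mem_erase.1 hj).1 hfj hfi
  have h2 : f i = - ∑ j ∈ Finset.univ.erase i, f j := eq_neg_of_add_eq_zero_left hs
  rw [h2, V.map_neg] at h1
  exact lt_irrefl _ h1

lemma valuation_const {Γ : Type*} [LinearOrderedCommGroupWithZero Γ] (V : Valuation K Γ)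
    {c : F} (hc : c ≠ 0) : V (algebraMap F K c) = 1 := by
  have : Fintype F := Fintype.ofFinite F
  have h1 := FiniteField.pow_card_sub_one_eq_one c hc
  have h2 : 1 < Fintype.card F := Fintype.one_lt_card
  have h3 : V (algebraMap F K c) ^ (Fintype.card F - 1) = 1 := by
    rw [← map_pow, ← map_pow, h1, map_one, map_one]
  exact (pow_eq_one_iff.1 h3).resolve_right (by omega)

lemma valuation_aeval {Γ : Type*} [LinearOrderedCommGroupWithZero Γ] (V : Valuation K Γ)
    {x : K} (hx : V x < 1) {p : F[X]} (hp : p ≠ 0) : ∃ m : ℕ, V (aeval x p) = V x ^ m := by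
  obtain ⟨n, q, hq, rfl⟩ := exists_X_pow_mul hp
  refine ⟨n, ?_⟩
  have h1 : V (aeval x q) = 1 := by
    have h2 := divX_mul_X_add q
    rw [← h2]
    simp only [map_add, map_mul, aeval_X, aeval_C]
    have h3 : V (aeval x q.divX) ≤ 1 := by
      rw [aeval_eq_sum_range]
      refine V.map_sum_le fun i _ => ?_
      rw [Algebra.smul_def, map_mul, map_pow]
      by_cases hc : q.divX.coeff i = 0
      · simp [hc]
      · rw [valuation_const V hc, one_mul]
        exact pow_le_one' hx.le _
    rw [V.map_add_eq_of_lt_right, valuation_const V hq]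
    rw [valuation_const V hq, map_mul]
    calc _ ≤ 1 * V x := by gcongr
      _ < 1 := by simpa using hx
  rw [map_mul, map_mul, h1, mul_one, map_pow, map_pow, aeval_X]

/-- every nontrivial valuation ring is the ring of a place -/
theorem exists_place_of_valuationSubring [GF F K] (B : ValuationSubring K) {x : K} (hx0 : x ≠ 0)
    (hx : x ∈ B.nonunits) : ∃ v : Place K, ∀ y, v.le 0 y ↔ y ∈ B := by
  set V := B.valuation
  have hVx : V x < 1 := (B.mem_nonunits_iff).1 hx
  have hVx0 : V x ≠ 0 := by simpa using hx0
  have hxt : Transcendental F x := by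
    intro h
    obtain ⟨n, hn, h1⟩ := exists_pow_eq_one_of_isAlgebraic hx0 h
    have h2 : V x ^ n = 1 := by rw [← map_pow, h1, map_one]
    exact hVx.ne ((pow_eq_one_iff.1 h2).resolve_right hn.ne')
  set n := Module.finrank F⟮x⟯ K
  set N := n.factorial
  have hN : N ≠ 0 := n.factorial_ne_zero
  have key : ∀ y, y ≠ 0 → ∃ m : ℤ, V y ^ N = V x ^ m := by
    intro y hy
    have hnot : ¬ PInd F x (fun i : Fin (n + 1) => y ^ (i : ℕ)) := by
      intro h
      have := h.card_le hxt
      simp only [Fintype.card_fin] at this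
      omega
    unfold PInd at hnot
    push Not at hnot
    obtain ⟨p, hp, i0, hi0⟩ := hnot
    have hane : ∀ q : F[X], q ≠ 0 → aeval x q ≠ 0 := fun q hq h =>
      hq ((transcendental_iff.1 hxt) _ h)
    obtain ⟨i, j, hij, hi, hj, hV⟩ := exists_eq_of_sum_eq_zero V _ hp
      ⟨i0, mul_ne_zero (hane _ hi0) (pow_ne_zero _ hy)⟩
    wlog hlt : i < j generalizing i j
    · exact this j i hij.symm hj hi hV.symm (lt_of_le_of_ne (not_lt.1 hlt) hij.symm)
    have hpi : p i ≠ 0 := fun h => hi (by simp [h])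
    have hpj : p j ≠ 0 := fun h => hj (by simp [h])
    obtain ⟨a, ha⟩ := valuation_aeval V hVx hpi
    obtain ⟨b, hb⟩ := valuation_aeval V hVx hpj
    rw [map_mul, map_mul, map_pow, map_pow, ha, hb] at hV
    have hVy0 : V y ≠ 0 := by simpa using hy
    have hd : V y ^ ((j : ℕ) - (i : ℕ)) = V x ^ ((a : ℤ) - b) := by
      rw [zpow_sub₀ hVx0, zpow_natCast, zpow_natCast, eq_div_iff (pow_ne_zero _ hVx0)]
      have : (j : ℕ) = (j - i : ℕ) + i := by have := Fin.lt_def.1 hlt; omega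
      rw [this, pow_add] at hV
      have h5 := pow_ne_zero (i : ℕ) hVy0
      apply mul_right_cancel₀ h5
      rw [hV, mul_assoc, mul_comm (V x ^ b), mul_comm (V x ^ b), mul_assoc]
    have hdvd : ((j : ℕ) - (i : ℕ)) ∣ N := by
      apply Nat.dvd_factorial
      · have := Fin.lt_def.1 hlt; omega
      · have := j.2; omega
    obtain ⟨c, hc⟩ := hdvd
    refine ⟨((a : ℤ) - b) * c, ?_⟩
    rw [hc, pow_mul, hd, zpow_mul, zpow_natCast]
  choose! f hf using key
  have hmono : ∀ m m' : ℤ, V x ^ m ≤ V x ^ m' ↔ m' ≤ m := fun m m' =>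
    zpow_le_zpow_iff_right_of_lt_one₀ (zero_lt_iff.2 hVx0) hVx
  have hinj : ∀ m m' : ℤ, V x ^ m = V x ^ m' → m = m' := fun m m' h =>
    le_antisymm ((hmono _ _).1 h.ge) ((hmono _ _).1 h.le)
  have hle : ∀ y z, y ≠ 0 → z ≠ 0 → (V y ≤ V z ↔ f z ≤ f y) := by
    intro y z hy hz
    rw [← hmono, ← hf y hy, ← hf z hz]
    exact (pow_le_pow_iff_left₀ (zero_le) (zero_le) hN).symm
  have hpre : PreOrd f := by
    constructor
    · intro y z hy hz
      apply hinj
      rw [← hf _ (mul_ne_zero hy hz), map_mul, mul_pow, hf y hy, hf z hz, zpow_add₀ hVx0]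
    · intro y z hy hz hyz
      rcases le_max_iff.1 (V.map_add y z) with h | h
      · exact min_le_iff.2 (Or.inl ((hle _ _ hyz hy).1 h))
      · exact min_le_iff.2 (Or.inr ((hle _ _ hyz hz).1 h))
  have hfx : f x = N := by
    apply hinj; rw [← hf x hx0, zpow_natCast]
  obtain ⟨v, e, he, hv⟩ := hpre.normalize ⟨x, hx0, by rw [hfx]; exact_mod_cast hN⟩
  refine ⟨v, fun y => ?_⟩
  by_cases hy : y = 0
  · simp [hy, B.zero_mem]
  · rw [Place.le_iff hy, ← B.valuation_le_one_iff, ← V.map_one, hle y 1 hy one_ne_zero, hpre.one, hv y hy]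
    constructor
    · intro h; positivity
    · intro h; exact nonneg_of_mul_nonneg_right h he

/-- each transcendental element has a zero -/
theorem exists_zero [GF F K] {x : K} (hx : Transcendental F x) : ∃ v : Place K, 0 < v.ord x := by
  have hx0 : x ≠ 0 := by rintro rfl; exact hx isAlgebraic_zero
  set A := Algebra.adjoin F {x}
  let x' : A.toSubring := ⟨x, Algebra.self_mem_adjoin_singleton F x⟩
  have hI : Ideal.span {x'} ≠ ⊤ := by
    rw [Ne, Ideal.span_singleton_eq_top]
    intro h
    obtain ⟨⟨y, hy⟩, hxy⟩ := isUnit_iff_exists_inv.1 h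
    have hxy' : x * y = 1 := congrArg Subtype.val hxy
    have hy' : y ∈ (aeval x : F[X] →ₐ[F] K).range := by
      rw [← Algebra.adjoin_singleton_eq_range_aeval]; exact hy
    obtain ⟨p, rfl⟩ := hy'
    have h1 : aeval x (X * p - 1) = 0 := by
      rw [map_sub, map_mul, aeval_X, map_one]
      exact sub_eq_zero.2 hxy'
    have h2 := transcendental_iff.1 hx _ h1
    have := congrArg (eval 0) h2
    simp at this
  obtain ⟨B, hB1, hB2⟩ := Ideal.image_subset_nonunits_valuationSubring _ hI
  have hxB : x ∈ B.nonunits := hB2 ⟨x', Ideal.mem_span_singleton_self _, rfl⟩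
  obtain ⟨v, hv⟩ := exists_place_of_valuationSubring (F := F) B hx0 hxB
  refine ⟨v, ?_⟩
  by_contra h
  have h1 : v.le 0 x⁻¹ := Or.inr (by rw [Place.ord_inv]; omega)
  rw [hv] at h1
  have h2 : B.valuation x < 1 := (B.mem_nonunits_iff).1 hxB
  rw [← B.valuation_le_one_iff, map_inv₀] at h1
  have h3 : B.valuation x ≠ 0 := by simpa using hx0
  have := (inv_le_one₀ (zero_lt_iff.2 h3)).1 h1
  exact absurd h2 (not_lt.2 this)

end fin
end

/-! ### extensions of places -/
section above
variable {F K L : Type*} [Field K] [Field L] [Algebra K L]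

/-- `w` lies above `v` with ramification index `e`. -/
def Above (w : Place L) (v : Place K) (e : ℤ) : Prop :=
  0 < e ∧ ∀ x, w.ord (algebraMap K L x) = e * v.ord x

lemma Above.le_iff {w : Place L} {v : Place K} {e : ℤ} (h : Above w v e) {x : K} :
    w.le 0 (algebraMap K L x) ↔ v.le 0 x := by
  by_cases hx : x = 0
  · simp [hx]
  · rw [Place.le_iff hx, Place.le_iff (by simpa using hx), h.2]
    exact mul_nonneg_iff_of_pos_left h.1

lemma Above.le_iff1 {w : Place L} {v : Place K} {e : ℤ} (h : Above w v e) {x : K} :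
    w.le 1 (algebraMap K L x) ↔ v.le 1 x := by
  by_cases hx : x = 0
  · simp [hx]
  · rw [Place.le_iff hx, Place.le_iff (by simpa using hx), h.2]
    have := h.1
    constructor
    · intro h1; by_contra h2; nlinarith
    · intro h1; nlinarith

lemma Above.unique {w : Place L} {v v' : Place K} {e e' : ℤ} (h : Above w v e) (h' : Above w v' e') :
    v = v' := Place.eq_of_le fun x hx => h'.le_iff.1 (h.le_iff.2 hx)

lemma Above.unique_e {w : Place L} {v : Place K} {e e' : ℤ} (h : Above w v e) (h' : Above w v e') :
    e = e' := by
  obtain ⟨p, _, hp⟩ := v.ord_surj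
  have h1 := h.2 p
  rw [h'.2, hp] at h1
  omega

variable [Field F] [Finite F] [Algebra F K] [Algebra F L] [IsScalarTower F K L]

theorem exists_restrict [FiniteDimensional K L] (w : Place L) :
    ∃ (v : Place K) (e : ℤ), Above w v e := by
  have hpre : PreOrd (fun x => w.ord (algebraMap K L x)) := by
    constructor
    · intro x y hx hy
      simp only [map_mul]
      exact w.ord_mul _ _ (by simpa using hx) (by simpa using hy)
    · intro x y hx hy hxy
      simp only [map_add]
      exact w.ord_add _ _ (by simpa using hx) (by simpa using hy)
        (by rw [← map_add]; exact (_root_.map_ne_zero _).2 hxy)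
  have hn : ∃ x : K, x ≠ 0 ∧ w.ord (algebraMap K L x) ≠ 0 := by
    by_contra hc
    push Not at hc
    -- then every element of L is integral with unit constant term, contradiction
    obtain ⟨y, hy, h1⟩ := w.exists_ord 1
    have hyi : IsAlgebraic K y := Algebra.IsAlgebraic.isAlgebraic y
    obtain ⟨p, hp, hpy⟩ := hyi
    -- remove powers of X
    obtain ⟨n, q, hq, rfl⟩ := exists_X_pow_mul hp
    have hqy : aeval y q = 0 := by
      rw [map_mul, map_pow, aeval_X] at hpy
      exact (mul_eq_zero.1 hpy).resolve_left (pow_ne_zero _ hy)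
    rw [← divX_mul_X_add q] at hqy
    simp only [map_add, map_mul, aeval_X, aeval_C] at hqy
    have h3 : w.le 0 (aeval y q.divX) := by
      rw [aeval_eq_sum_range]
      refine Place.le.sum fun i _ => ?_
      rw [Algebra.smul_def]
      refine Place.le.mul0 ?_ (Place.le.pow0 (Or.inr (by omega)) _)
      by_cases hc0 : q.divX.coeff i = 0
      · simp [hc0]
      · exact Or.inr (hc _ hc0).ge
    have h4 : w.le 1 (aeval y q.divX * y) := by simpa using h3.mul (Or.inr h1.ge : w.le 1 y)
    have h5 : w.le 1 (algebraMap K L (q.coeff 0)) := by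
      have : algebraMap K L (q.coeff 0) = - (aeval y q.divX * y) := eq_neg_of_add_eq_zero_right hqy
      rw [this]; exact h4.neg
    rw [Place.le_iff (by simpa using hq), hc _ hq] at h5
    omega
  obtain ⟨v, e, he, h⟩ := hpre.normalize hn
  refine ⟨v, e, he, fun x => ?_⟩
  by_cases hx : x = 0
  · simp [hx, Place.ord_zero]
  · exact h x hx

theorem exists_above [GF F K] [FiniteDimensional K L] (v : Place K) :
    ∃ (w : Place L) (e : ℤ), Above w v e := by
  have hL : GF F L := GF.ext (K := K) L
  set A : Subring L := v.O.toSubring.map (algebraMap K L)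
  have hA : ∀ a : A, ∃ x : K, v.le 0 x ∧ algebraMap K L x = a := fun a => a.2
  let I : Ideal A :=
    { carrier := {a | ∃ x : K, v.le 1 x ∧ algebraMap K L x = a}
      add_mem' := by
        rintro a b ⟨x, hx, hxa⟩ ⟨y, hy, hyb⟩
        exact ⟨x + y, hx.add hy, by rw [map_add, hxa, hyb]; rfl⟩
      zero_mem' := ⟨0, by simp, by simp⟩
      smul_mem' := by
        rintro c a ⟨x, hx, hxa⟩
        obtain ⟨y, hy, hyc⟩ := hA c
        exact ⟨y * x, by simpa using hy.mul hx, by rw [map_mul, hxa, hyc]; rfl⟩ }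
  have hI : I ≠ ⊤ := by
    rw [Ne, Ideal.eq_top_iff_one]
    rintro ⟨x, hx, hx1⟩
    have : x = 1 := (algebraMap K L).injective (by rw [hx1, map_one]; rfl)
    rw [this, Place.le_iff one_ne_zero, Place.ord_one] at hx
    omega
  obtain ⟨B, hB1, hB2⟩ := Ideal.image_subset_nonunits_valuationSubring _ hI
  obtain ⟨p, hp0, hp⟩ := v.ord_surj
  have hpO : v.le 0 p := Or.inr (by omega)
  have hpB : algebraMap K L p ∈ B.nonunits :=
    hB2 ⟨⟨algebraMap K L p, ⟨p, hpO, rfl⟩⟩, ⟨p, Or.inr hp.ge, rfl⟩, rfl⟩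
  obtain ⟨w, hw⟩ := exists_place_of_valuationSubring (F := F) B (by simpa using hp0) hpB
  obtain ⟨v', e, h⟩ := exists_restrict (K := K) w
  have : v = v' := Place.eq_of_le fun x hx => by
    rw [← h.le_iff, hw]
    exact hB1 ⟨x, hx, rfl⟩
  subst this
  exact ⟨w, e, h⟩

end above
end TAD

namespace TAD
open IntermediateField Polynomial

section
variable (F : Type*) {K : Type*} [Field F] [Field K] [Algebra F K] [Finite F]

/-- elements with poles bounded by `D` on the set `S` of places. -/
def LS (S : Set (Place K)) (D : Place K → ℤ) : Submodule F K where
  carrier := {x | ∀ v ∈ S, v.le (-(D v)) x}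
  add_mem' := fun h1 h2 v hv => (h1 v hv).add (h2 v hv)
  zero_mem' := fun v _ => Place.le_zero _
  smul_mem' := fun c _ h v hv => (h v hv).smul c

variable {F}
lemma mem_LS {S : Set (Place K)} {D : Place K → ℤ} {x : K} :
    x ∈ LS F S D ↔ ∀ v ∈ S, v.le (-(D v)) x := Iff.rfl

lemma LS_mono {S : Set (Place K)} {D D' : Place K → ℤ} (h : ∀ v ∈ S, D v ≤ D' v) :
    LS F S D ≤ LS F S D' := fun _ hx v hv => (hx v hv).mono (by have := h v hv; omega)

open Classical in
/-- leading coefficient map -/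
noncomputable def lead (S : Set (Place K)) (D : Place K → ℤ) (v : Place K) (hv : v ∈ S) :
    LS F S (D + Pi.single v 1) →ₗ[F] v.κ where
  toFun x := v.res ((x : K) * v.ord_surj.choose ^ (D v + 1))
  map_add' x y := by
    have h := fun (x : LS F S (D + Pi.single v 1)) => show v.le 0 ((x : K) * v.ord_surj.choose ^ (D v + 1)) by
      have h1 := x.2 v hv
      have h2 := (h1.mul (Place.le_ord (v := v) (v.ord_surj.choose ^ (D v + 1))))
      refine h2.mono ?_
      rw [Place.ord_zpow, v.ord_surj.choose_spec.2]; simp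
    rw [← Place.res_add (h x) (h y), Submodule.coe_add, add_mul]
  map_smul' c x := by
    have h1 := x.2 v hv
    have h2 := (h1.mul (Place.le_ord (v := v) (v.ord_surj.choose ^ (D v + 1))))
    have h3 : v.le 0 ((x : K) * v.ord_surj.choose ^ (D v + 1)) := by
      refine h2.mono ?_
      rw [Place.ord_zpow, v.ord_surj.choose_spec.2]; simp
    rw [Submodule.coe_smul, smul_mul_assoc, Place.res_smul c h3]; rfl

open Classical in
lemma lead_ker (S : Set (Place K)) (D : Place K → ℤ) (v : Place K) (hv : v ∈ S)
    (x : LS F S (D + Pi.single v 1)) : lead S D v hv x = 0 ↔ (x : K) ∈ LS F S D := by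
  obtain ⟨hp0, hp⟩ := v.ord_surj.choose_spec
  have h1 := x.2 v hv
  have h2 := (h1.mul (Place.le_ord (v := v) (v.ord_surj.choose ^ (D v + 1))))
  have h3 : v.le 0 ((x : K) * v.ord_surj.choose ^ (D v + 1)) := by
    refine h2.mono ?_
    rw [Place.ord_zpow, v.ord_surj.choose_spec.2]; simp
  have h4 : lead S D v hv x = v.res ((x : K) * v.ord_surj.choose ^ (D v + 1)) := rfl
  have h5 : v.le 1 ((x : K) * v.ord_surj.choose ^ (D v + 1)) ↔ v.le (-(D v)) (x : K) := by
    by_cases hx : (x : K) = 0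
    · simp [hx]
    · rw [Place.le_iff hx, Place.le_iff (mul_ne_zero hx (zpow_ne_zero _ hp0)),
        v.ord_mul _ _ hx (zpow_ne_zero _ hp0), Place.ord_zpow, hp]
      omega
  rw [h4, Place.res_eq_zero_iff h3, h5]
  constructor
  · intro h w hw
    by_cases hwv : w = v
    · subst hwv; exact h
    · have := x.2 w hw
      simpa [hwv] using this
  · intro h; exact h v hv

open Classical in
lemma lead_surj (S : Set (Place K)) (hS : S.Finite) (D : Place K → ℤ) (v : Place K) (hv : v ∈ S) :
    Function.Surjective (lead (F := F) S D v hv) := by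
  intro c
  obtain ⟨hp0, hp⟩ := v.ord_surj.choose_spec
  obtain ⟨y, hy, rfl⟩ := v.res_surj c
  set p := v.ord_surj.choose with hpdef
  obtain ⟨N, hN⟩ : ∃ N : ℤ, ∀ w ∈ hS.toFinset, -(D w) ≤ N := by
    refine ⟨∑ w ∈ hS.toFinset, |D w|, fun w hw => ?_⟩
    have := Finset.single_le_sum (f := fun w : Place K => |D w|) (fun _ _ => abs_nonneg _) hw
    have h2 := neg_abs_le (D w)
    linarith
  obtain ⟨x, hx⟩ := Place.weak_approx hS.toFinset
    (fun w => if w = v then y * p ^ (-(D v + 1)) else 0) N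
  have hxv : v.le (-(D v)) (x - y * p ^ (-(D v + 1))) := by
    have := hx v (by simpa using hv)
    rw [if_pos rfl] at this
    exact this.mono (hN v (by simpa using hv))
  have hyp : v.le (-(D v + 1)) (y * p ^ (-(D v + 1))) := by
    refine (hy.mul (Place.le_ord _)).mono ?_
    rw [Place.ord_zpow, hp]; omega
  have hxm : x ∈ LS F S (D + Pi.single v 1) := by
    intro w hw
    by_cases hwv : w = v
    · subst hwv
      have := (hxv.mono (by omega : -(D w + 1) ≤ -(D w))).add hyp
      simpa using this
    · have := hx w (by simpa using hw)
      rw [if_neg hwv, sub_zero] at this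
      have h2 := this.mono (hN w (by simpa using hw))
      simpa [hwv] using h2
  refine ⟨⟨x, hxm⟩, ?_⟩
  change v.res (x * p ^ (D v + 1)) = v.res y
  have e1 : x * p ^ (D v + 1) - y = (x - y * p ^ (-(D v + 1))) * p ^ (D v + 1) := by
    rw [sub_mul, mul_assoc, ← zpow_add₀ hp0]; simp
  have h6 : v.le 1 (x * p ^ (D v + 1) - y) := by
    rw [e1]
    refine (hxv.mul (Place.le_ord _)).mono ?_
    rw [Place.ord_zpow, hp]; omega
  have h7 : v.le 0 (x * p ^ (D v + 1)) := by
    have := (h6.mono (by omega : (0:ℤ) ≤ 1)).add hy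
    simpa using this
  rw [Place.res_eq_iff h7 hy]
  exact h6

open Classical in
lemma relIndex_step (S : Set (Place K)) (hS : S.Finite) (D : Place K → ℤ) (v : Place K) (hv : v ∈ S) :
    (LS F S D).toAddSubgroup.relIndex (LS F S (D + Pi.single v 1)).toAddSubgroup = Nat.card v.κ := by
  have h1 : (LS F S D).toAddSubgroup.addSubgroupOf (LS F S (D + Pi.single v 1)).toAddSubgroup
      = (lead (F := F) S D v hv).toAddMonoidHom.ker := by
    ext x
    rw [AddSubgroup.mem_addSubgroupOf, AddMonoidHom.mem_ker]
    exact (lead_ker S D v hv x).symm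
  rw [AddSubgroup.relIndex, h1, AddSubgroup.index_ker]
  have : (lead (F := F) S D v hv).toAddMonoidHom.range = ⊤ :=
    AddMonoidHom.range_eq_top.2 (lead_surj S hS D v hv)
  rw [this]
  exact Nat.card_congr (Equiv.Set.univ _)

/-- cast of an effective divisor to a function -/
def fz (E : Place K →₀ ℕ) : Place K → ℤ := fun v => (E v : ℤ)

open Classical in
lemma relIndex_eff (S : Set (Place K)) (hS : S.Finite) (E : Place K →₀ ℕ) :
    (∀ v ∈ E.support, v ∈ S) → ∀ D : Place K → ℤ,
    (LS F S D).toAddSubgroup.relIndex (LS F S (D + fz E)).toAddSubgroup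
      = E.prod fun v n => (Nat.card v.κ) ^ n := by
  have hz : ∀ E E' : Place K →₀ ℕ, fz (E + E') = fz E + fz E' := fun E E' => by
    ext v; simp [fz]
  have hle : ∀ (D : Place K → ℤ) (E : Place K →₀ ℕ),
      (LS F S D).toAddSubgroup ≤ (LS F S (D + fz E)).toAddSubgroup := fun D E =>
    show LS F S D ≤ LS F S (D + fz E) from LS_mono (fun v _ => by simp [fz])
  refine Finsupp.induction E ?_ ?_
  · intro _ D
    have : D + fz (0 : Place K →₀ ℕ) = D := by ext v; simp [fz]
    rw [this]; simp
  · intro v n E hvE hn ih hS' D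
    have hv : v ∈ S := hS' v (by simp [hn])
    have hE : ∀ w ∈ E.support, w ∈ S := fun w hw => hS' w (by
      have : E w ≠ 0 := by simpa using hw
      simp [this])
    have hsingle : ∀ (n : ℕ) (D : Place K → ℤ), (LS F S D).toAddSubgroup.relIndex
        (LS F S (D + fz (Finsupp.single v n))).toAddSubgroup = (Nat.card v.κ) ^ n := by
      intro n
      induction n with
      | zero =>
        intro D
        have : D + fz (Finsupp.single v 0) = D := by ext v; simp [fz]
        rw [this]; simp
      | succ n ihn =>
        intro D
        have e1 : D + fz (Finsupp.single v (n + 1)) = D + fz (Finsupp.single v n) + Pi.single v 1 := by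
          ext w
          by_cases h : w = v
          · subst h; simp [fz]; ring
          · simp [fz, h]
        rw [e1, ← AddSubgroup.relIndex_mul_relIndex _ _ _ (hle D (Finsupp.single v n))
          (show LS F S (D + fz (Finsupp.single v n)) ≤ LS F S (D + fz (Finsupp.single v n) + Pi.single v 1)
            from LS_mono fun w _ => by
            by_cases h : w = v
            · subst h; simp
            · simp [h]), ihn, relIndex_step S hS _ v hv, pow_succ]
    rw [hz, ← add_assoc, Finsupp.prod_add_index' (by simp) (by intros; rw [pow_add]),
      Finsupp.prod_single_index (by simp), ← hsingle n D, ← ih hE (D + fz (Finsupp.single v n)),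
      AddSubgroup.relIndex_mul_relIndex]
    · exact hle _ _
    · exact hle _ _

/-- bound of the colength of `x` in the semilocal ring -/
lemma card_quot_le [GF F K] {x : K} (hx : Transcendental F x) (S : Set (Place K)) (D : Place K → ℤ)
    (hD : ∀ v ∈ S, 0 ≤ v.ord x ∧ D v = - v.ord x) :
    (LS F S D).toAddSubgroup.relIndex (LS F S 0).toAddSubgroup ≠ 0 ∧
    (LS F S D).toAddSubgroup.relIndex (LS F S 0).toAddSubgroup
      ≤ Nat.card F ^ (Module.finrank F⟮x⟯ K) := by
  classical
  have hx0 : x ≠ 0 := by rintro rfl; exact hx isAlgebraic_zero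
  set A := LS F S 0
  set n := Module.finrank F⟮x⟯ K
  let B : Submodule F A := (LS F S D).comap A.subtype
  have hmem : ∀ a ∈ A, x * a ∈ LS F S D := by
    intro a ha v hv
    have := (Place.le_ord (v := v) x).mul (ha v hv)
    refine this.mono ?_
    rw [(hD v hv).2]; simp
  have hmemA : ∀ (p : F[X]) (a : K), a ∈ A → aeval x p * a ∈ A := by
    intro p a ha v hv
    have h1 : v.le 0 (aeval x p) := by
      rw [aeval_eq_sum_range]
      exact Place.le.sum fun i _ => Place.le.smul _ (Place.le.pow0 (Or.inr (hD v hv).1) _)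
    have h2 := ha v hv
    simp only [Pi.zero_apply, neg_zero] at h2 ⊢
    exact h1.mul0 h2
  have hrank : Module.rank F (A ⧸ B) ≤ n := by
    apply rank_le
    intro s hs
    choose y hy using fun i : s => Submodule.mkQ_surjective B (i : A ⧸ B)
    have key : ∀ (k : ℕ) (p : s → F[X]), ∑ i, aeval x (p i) * (y i : K) = 0 →
        ∀ i, (p i).coeff k = 0 := by
      have base : ∀ (p : s → F[X]), ∑ i, aeval x (p i) * (y i : K) = 0 →
          ∀ i, (p i).coeff 0 = 0 := by
        intro p hp
        have h1 : ∑ i, ((p i).coeff 0) • y i ∈ B := by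
          change A.subtype (∑ i, ((p i).coeff 0) • y i) ∈ LS F S D
          have e1 : A.subtype (∑ i, ((p i).coeff 0) • y i)
              = - (x * ∑ i, aeval x (p i).divX * (y i : K)) := by
            have e2 : ∀ i : s, aeval x (p i) * (y i : K) =
                x * (aeval x (p i).divX * (y i : K)) + ((p i).coeff 0) • (y i : K) := by
              intro i
              conv_lhs => rw [← divX_mul_X_add (p i)]
              simp only [map_add, map_mul, aeval_X, aeval_C, Algebra.smul_def]
              ring
            simp only [e2, Finset.sum_add_distrib] at hp
            rw [← Finset.mul_sum] at hp
            rw [map_sum]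
            simp only [map_smul, Submodule.subtype_apply]
            exact eq_neg_of_add_eq_zero_right hp
          rw [e1]
          exact Submodule.neg_mem _ (hmem _ (Submodule.sum_mem _ fun i _ => hmemA _ _ (y i).2))
        have h2 : ∑ i, ((p i).coeff 0) • (i : A ⧸ B) = 0 := by
          have := (Submodule.Quotient.mk_eq_zero B).2 h1
          rw [← Submodule.mkQ_apply, map_sum] at this
          simp only [map_smul, hy] at this
          exact this
        exact Fintype.linearIndependent_iff.1 hs _ h2
      intro k
      induction k with
      | zero => exact base
      | succ k ih =>
        intro p hp i
        rw [← coeff_divX]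
        refine ih (fun i => (p i).divX) ?_ i
        have h0 := base p hp
        have : x * ∑ i, aeval x (p i).divX * (y i : K) = 0 := by
          rw [← hp, Finset.mul_sum]
          refine Finset.sum_congr rfl fun i _ => ?_
          conv_rhs => rw [← divX_mul_X_add (p i), h0 i]
          simp only [map_add, map_mul, aeval_X, map_zero, add_zero]
          ring
        exact (mul_eq_zero.1 this).resolve_left hx0
    have hP : PInd F x (fun i => (y i : K)) := fun p hp i => by
      ext k; simpa using key k p hp i
    simpa using hP.card_le hx
  have hfin : Module.Finite F (A ⧸ B) := by
    rw [← Module.rank_lt_aleph0_iff]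
    exact lt_of_le_of_lt hrank (Cardinal.natCast_lt_aleph0)
  have hfr : Module.finrank F (A ⧸ B) ≤ n := Module.finrank_le_of_rank_le hrank
  have hcard : (LS F S D).toAddSubgroup.relIndex A.toAddSubgroup = Nat.card (A ⧸ B) := rfl
  have hq : 0 < Nat.card F := Nat.card_pos
  rw [hcard, Module.natCard_eq_pow_finrank (K := F)]
  exact ⟨(pow_pos hq _).ne', Nat.pow_le_pow_right hq hfr⟩

open Classical in
lemma prod_card_le [GF F K] {x : K} (hx : Transcendental F x) (E : Place K →₀ ℕ)
    (hE : ∀ v ∈ E.support, (E v : ℤ) = v.ord x) :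
    (E.prod fun v n => (Nat.card v.κ) ^ n) ≠ 0 ∧
    (E.prod fun v n => (Nat.card v.κ) ^ n) ≤ Nat.card F ^ (Module.finrank F⟮x⟯ K) := by
  set S : Set (Place K) := (E.support : Set (Place K))
  have h1 := relIndex_eff (F := F) S (Finset.finite_toSet _) E (fun v hv => hv) (- fz E)
  rw [neg_add_cancel] at h1
  rw [← h1]
  exact card_quot_le hx S _ fun v hv => ⟨by rw [← hE v hv]; positivity, by rw [← hE v hv]; rfl⟩

lemma finite_κ [GF F K] (v : Place K) : Finite v.κ := by
  classical
  obtain ⟨p, _, hp⟩ := v.ord_surj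
  have ht : Transcendental F p := v.transcendental (by omega)
  have := (prod_card_le ht (Finsupp.single v 1) (by
    intro w hw
    have : w = v := by
      have := Finsupp.support_single_subset hw
      simpa using this
    subst this; simp [hp])).1
  rw [Finsupp.prod_single_index (by simp), pow_one] at this
  exact Nat.finite_of_card_ne_zero this

variable (F) in
/-- degree of a place -/
noncomputable def Place.deg (v : Place K) : ℕ := Module.finrank F v.κ

lemma Place.card_κ [GF F K] (v : Place K) : Nat.card v.κ = Nat.card F ^ (v.deg F) := by
  have := finite_κ (F := F) v
  have : Module.Finite F v.κ := Module.Finite.of_finite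
  exact Module.natCard_eq_pow_finrank

lemma Place.deg_pos [GF F K] (v : Place K) : 0 < v.deg F := by
  have := finite_κ (F := F) v
  have : Module.Finite F v.κ := Module.Finite.of_finite
  exact Module.finrank_pos

lemma sum_deg_le [GF F K] {x : K} (hx : Transcendental F x) (E : Place K →₀ ℕ)
    (hE : ∀ v ∈ E.support, (E v : ℤ) = v.ord x) :
    (E.sum fun v n => n * v.deg F) ≤ Module.finrank F⟮x⟯ K := by
  have h1 := (prod_card_le hx E hE).2
  have h2 : (E.prod fun v n => (Nat.card v.κ) ^ n) = Nat.card F ^ (E.sum fun v n => n * v.deg F) := by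
    rw [Finsupp.prod, Finsupp.sum, ← Finset.prod_pow_eq_pow_sum]
    refine Finset.prod_congr rfl fun v _ => ?_
    rw [Place.card_κ (F := F) v, ← pow_mul, mul_comm]
  rw [h2] at h1
  exact (Nat.pow_le_pow_iff_right (Finite.one_lt_card)).1 h1

lemma finite_zeros [GF F K] (x : K) : {v : Place K | 0 < v.ord x}.Finite := by
  classical
  by_cases hx : Transcendental F x
  swap
  · have : {v : Place K | 0 < v.ord x} = ∅ := by
      ext v
      simp only [Set.mem_ofPred_eq, Set.mem_empty_iff_false, iff_false]
      rw [Transcendental, not_not] at hx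
      rw [v.ord_of_isAlgebraic hx]; omega
    rw [this]; exact Set.finite_empty
  by_contra hc
  obtain ⟨T, hT, hcard⟩ := Set.Infinite.exists_subset_card_eq hc (Module.finrank F⟮x⟯ K + 1)
  let E : Place K →₀ ℕ := Finsupp.onFinset T (fun v => if v ∈ T then (v.ord x).toNat else 0)
    (by intro v hv; by_contra h; simp [h] at hv)
  have hEv : ∀ v ∈ T, E v = (v.ord x).toNat := fun v hv => by
    simp [E, hv]
  have hsup : E.support = T := by
    ext v
    rw [Finsupp.mem_support_iff]
    constructor
    · intro h; by_contra h'; exact h (by simp [E, h'])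
    · intro h; rw [hEv v h]; have : 0 < v.ord x := hT h
      omega
  have h1 := sum_deg_le hx E (by
    intro v hv; rw [hsup] at hv
    have : 0 < v.ord x := hT hv
    rw [hEv v hv]; omega)
  have h2 : T.card ≤ E.sum fun v n => n * v.deg F := by
    rw [Finsupp.sum, hsup, Finset.card_eq_sum_ones]
    refine Finset.sum_le_sum fun v hv => ?_
    have h3 : 0 < v.ord x := hT hv
    have h4 := v.deg_pos (F := F)
    rw [hEv v hv]
    have : 0 < (v.ord x).toNat := by omega
    exact Nat.mul_pos this h4
  omega

lemma finite_support_ord [GF F K] (x : K) : {v : Place K | v.ord x ≠ 0}.Finite := by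
  refine ((finite_zeros (F := F) x).union (finite_zeros (F := F) x⁻¹)).subset fun v hv => ?_
  rcases lt_or_gt_of_ne (show v.ord x ≠ 0 from hv) with h | h
  · right; simp only [Set.mem_ofPred_eq, Place.ord_inv]; omega
  · left; exact h

end
end TAD

namespace TAD
open IntermediateField Polynomial

attribute [simp] Place.ord_inv Place.ord_pow Place.ord_zpow

/-- divisors -/
abbrev Dv (K : Type*) [Field K] := Place K →₀ ℤ

section
variable (F : Type*) {K : Type*} [Field F] [Field K] [Algebra F K] [Finite F] [GF F K]

/-- divisor of a function -/
noncomputable def divi (x : K) : Dv K :=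
  Finsupp.ofSupportFinite (fun v => v.ord x) (finite_support_ord (F := F) x)

@[simp] lemma divi_apply (x : K) (v : Place K) : divi F x v = v.ord x := rfl

lemma divi_mul {x y : K} (hx : x ≠ 0) (hy : y ≠ 0) : divi F (x * y) = divi F x + divi F y := by
  ext v; simp [v.ord_mul _ _ hx hy]
lemma divi_inv (x : K) : divi F x⁻¹ = - divi F x := by
  ext v; simp
lemma divi_pow (x : K) (n : ℕ) : divi F (x ^ n) = n • divi F x := by
  ext v; simp
lemma divi_zpow (x : K) (n : ℤ) : divi F (x ^ n) = n • divi F x := by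
  ext v; simp
lemma divi_one : divi F (1 : K) = 0 := by ext v; simp
lemma divi_div {x y : K} (hx : x ≠ 0) (hy : y ≠ 0) : divi F (x / y) = divi F x - divi F y := by
  ext v; simp [v.ord_div hx hy]

/-- degree of divisors -/
noncomputable def degD : Dv K →+ ℤ :=
  Finsupp.liftAddHom fun v : Place K => (AddMonoidHom.mulRight ((v.deg F : ℕ) : ℤ))

omit [GF F K] in
lemma degD_apply (D : Dv K) : degD F D = D.sum fun v n => n * (v.deg F : ℤ) := rfl

omit [GF F K] in
@[simp] lemma degD_single (v : Place K) (n : ℤ) : degD F (Finsupp.single v n) = n * v.deg F := by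
  rw [degD_apply, Finsupp.sum_single_index (by simp)]

omit [GF F K] in
lemma degD_nonneg {D : Dv K} (h : 0 ≤ D) : 0 ≤ degD F D := by
  rw [degD_apply]
  exact Finset.sum_nonneg fun v _ => mul_nonneg (h v) (by positivity)

omit [GF F K] in
lemma degD_mono {D D' : Dv K} (h : D ≤ D') : degD F D ≤ degD F D' := by
  have := degD_nonneg F (sub_nonneg.2 h)
  rw [map_sub] at this; linarith

/-- Riemann-Roch space -/
abbrev RR (D : Dv K) : Submodule F K := LS F Set.univ (D : Place K → ℤ)

/-- its dimension -/
noncomputable def ell (D : Dv K) : ℕ := Module.finrank F (RR F D)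

variable {F}
omit [GF F K] in
lemma mem_RR {D : Dv K} {x : K} : x ∈ RR F D ↔ ∀ v : Place K, v.le (-(D v)) x := by
  simp [mem_LS]

omit [GF F K] in
lemma RR_mono {D D' : Dv K} (h : D ≤ D') : RR F D ≤ RR F D' := LS_mono fun v _ => h v

lemma mem_RR_iff {D : Dv K} {x : K} (hx : x ≠ 0) : x ∈ RR F D ↔ 0 ≤ divi F x + D := by
  rw [mem_RR]
  refine forall_congr' fun v => ?_
  rw [Place.le_iff hx]
  simp only [Finsupp.coe_zero, Pi.zero_apply, Finsupp.coe_add, Pi.add_apply, divi_apply]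
  omega

lemma isAlgebraic_of_le {x : K} (h : ∀ v : Place K, v.le 0 x) : IsAlgebraic F x := by
  by_contra hx
  have hx0 : x ≠ 0 := by rintro rfl; exact hx isAlgebraic_zero
  have hx' : Transcendental F x⁻¹ := fun h => hx (by simpa using h.inv)
  obtain ⟨v, hv⟩ := exists_zero hx'
  rw [Place.ord_inv] at hv
  have := (Place.le_iff hx0).1 (h v)
  omega

variable (F) in
include F in
lemma exists_place : Nonempty (Place K) := by
  obtain ⟨t, ht⟩ := GF.exT (F := F) (K := K)
  obtain ⟨v, _⟩ := exists_zero ht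
  exact ⟨v⟩

instance RR_zero_finite : FiniteDimensional F (RR F (0 : Dv K)) := by
  obtain ⟨v⟩ := exists_place F (K := K)
  have := finite_κ (F := F) v
  let f : RR F (0 : Dv K) →ₗ[F] v.κ :=
    { toFun := fun x => v.res x.1
      map_add' := fun x y => Place.res_add (by simpa using mem_RR.1 x.2 v) (by simpa using mem_RR.1 y.2 v)
      map_smul' := fun c x => Place.res_smul c (by simpa using mem_RR.1 x.2 v) }
  have : Function.Injective f := by
    rw [injective_iff_map_eq_zero]
    intro x hx
    have h0 : v.le 0 x.1 := by simpa using mem_RR.1 x.2 v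
    have h1 : v.le 1 x.1 := (Place.res_eq_zero_iff h0).1 hx
    have h2 : IsAlgebraic F x.1 := isAlgebraic_of_le fun v => by simpa using mem_RR.1 x.2 v
    have h3 := v.ord_of_isAlgebraic h2
    rcases h1 with h1 | h1
    · exact Subtype.ext h1
    · omega
  exact FiniteDimensional.of_injective f this

omit [Finite F] [GF F K] in
lemma finrank_step {U V : Submodule F K} (W : Type*) [AddCommGroup W] [Module F W]
    [FiniteDimensional F W] [FiniteDimensional F U] (f : V →ₗ[F] W)
    (hf : ∀ x, f x = 0 → (x : K) ∈ U) :
    FiniteDimensional F V ∧ Module.finrank F V ≤ Module.finrank F U + Module.finrank F W := by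
  have hk : FiniteDimensional F (LinearMap.ker f) ∧
      Module.finrank F (LinearMap.ker f) ≤ Module.finrank F U := by
    let g : LinearMap.ker f →ₗ[F] U :=
      { toFun := fun x => ⟨x.1.1, hf x.1 x.2⟩
        map_add' := fun _ _ => rfl
        map_smul' := fun _ _ => rfl }
    have hg : Function.Injective g := fun x y h => Subtype.ext (Subtype.ext (congrArg (fun z : U => (z : K)) h))
    exact ⟨FiniteDimensional.of_injective g hg, LinearMap.finrank_le_finrank_of_injective hg⟩
  have := hk.1
  have hfd : FiniteDimensional F V := by
    have h1 : FiniteDimensional F (V ⧸ LinearMap.ker f) :=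
      FiniteDimensional.of_injective ((LinearMap.ker f).liftQ f le_rfl)
        (LinearMap.ker_eq_bot.1 (Submodule.ker_liftQ_eq_bot' _ _ rfl))
    exact Module.Finite.of_submodule_quotient (LinearMap.ker f)
  refine ⟨hfd, ?_⟩
  have h1 := LinearMap.finrank_range_add_finrank_ker f
  have h2 := Submodule.finrank_le (LinearMap.range f)
  omega

lemma RR_step (D : Dv K) (v : Place K) [FiniteDimensional F (RR F D)] :
    FiniteDimensional F (RR F (D + Finsupp.single v 1)) ∧
      ell F (D + Finsupp.single v 1) ≤ ell F D + v.deg F := by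
  classical
  have := finite_κ (F := F) v
  have e : ((D + Finsupp.single v 1 : Dv K) : Place K → ℤ) = (D : Place K → ℤ) + Pi.single v 1 := by
    rw [Finsupp.coe_add, Finsupp.single_eq_pi_single]
  rw [ell, RR, e]
  exact finrank_step v.κ (lead (F := F) Set.univ D v (Set.mem_univ _)) fun x hx =>
    (lead_ker _ _ _ _ x).1 hx

lemma RR_add (E : Place K →₀ ℕ) : ∀ (D : Dv K) [FiniteDimensional F (RR F D)],
    FiniteDimensional F (RR F (D + E.mapRange (Nat.cast : ℕ → ℤ) rfl)) ∧
      (ell F (D + E.mapRange (Nat.cast : ℕ → ℤ) rfl) : ℤ) ≤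
        ell F D + degD F (E.mapRange (Nat.cast : ℕ → ℤ) rfl) := by
  refine Finsupp.induction_linear E ?_ ?_ ?_
  · intro D _
    rw [Finsupp.mapRange_zero, add_zero, map_zero, add_zero]
    exact ⟨inferInstance, le_rfl⟩
  · intro f g hf hg D _
    have e : (f + g).mapRange (Nat.cast : ℕ → ℤ) rfl =
      f.mapRange (Nat.cast : ℕ → ℤ) rfl + g.mapRange (Nat.cast : ℕ → ℤ) rfl := by
        ext v; simp
    obtain ⟨h1, h2⟩ := hf D
    obtain ⟨h3, h4⟩ := hg (D + f.mapRange (Nat.cast : ℕ → ℤ) rfl)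
    rw [e, ← add_assoc]
    refine ⟨h3, ?_⟩
    rw [map_add]; linarith
  · intro v n
    induction n with
    | zero => 
      intro D _
      rw [Finsupp.single_zero, Finsupp.mapRange_zero, add_zero, map_zero, add_zero]
      exact ⟨inferInstance, le_rfl⟩
    | succ n ih =>
      intro D _
      obtain ⟨h1, h2⟩ := ih D
      obtain ⟨h3, h4⟩ := RR_step (F := F) (D + (Finsupp.single v n).mapRange (Nat.cast : ℕ → ℤ) rfl) v
      have e : D + (Finsupp.single v (n+1)).mapRange (Nat.cast : ℕ → ℤ) rfl =
        (D + (Finsupp.single v n).mapRange (Nat.cast : ℕ → ℤ) rfl) + Finsupp.single v 1 := by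
          rw [Finsupp.mapRange_single, Finsupp.mapRange_single, add_assoc, ← Finsupp.single_add]; simp
      rw [e]
      refine ⟨h3, ?_⟩
      have e2 : degD F ((Finsupp.single v (n+1)).mapRange (Nat.cast : ℕ → ℤ) rfl) =
        degD F ((Finsupp.single v n).mapRange (Nat.cast : ℕ → ℤ) rfl) + v.deg F := by
          rw [Finsupp.mapRange_single, Finsupp.mapRange_single, degD_single, degD_single]; push_cast; ring
      rw [e2]
      have h4' : (ell F (D + (Finsupp.single v n).mapRange (Nat.cast : ℕ → ℤ) rfl + Finsupp.single v 1) : ℤ) ≤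
         ell F (D + (Finsupp.single v n).mapRange (Nat.cast : ℕ → ℤ) rfl) + v.deg F := by exact_mod_cast h4
      linarith

omit [Algebra F K] [Finite F] [GF F K] [Field F] in
lemma exists_eff {D : Dv K} (h : 0 ≤ D) : ∃ E : Place K →₀ ℕ, D = E.mapRange (Nat.cast : ℕ → ℤ) rfl := by
  refine ⟨D.mapRange Int.toNat rfl, ?_⟩
  ext v
  have := h v
  simp at this ⊢
  omega

instance RR_finite (D : Dv K) : FiniteDimensional F (RR F D) := by
  have h0 : (0 : Dv K) ≤ D ⊔ 0 := le_sup_right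
  obtain ⟨E, hE⟩ := exists_eff h0
  have h1 := (RR_add (F := F) E 0).1
  rw [← hE, zero_add] at h1
  exact Submodule.finiteDimensional_of_le (RR_mono (F := F) (le_sup_left : D ≤ D ⊔ 0))

lemma ell_mono {D D' : Dv K} (h : D ≤ D') : ell F D ≤ ell F D' :=
  Submodule.finrank_mono (RR_mono h)

lemma ell_le {D D' : Dv K} (h : D ≤ D') : (ell F D' : ℤ) ≤ ell F D + degD F (D' - D) := by
  obtain ⟨E, hE⟩ := exists_eff (sub_nonneg.2 h)
  have := (RR_add (F := F) E D).2
  rw [← hE] at this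
  simpa using this

lemma exists_mem_RR {D : Dv K} (h : 0 < ell F D) : ∃ x, x ≠ 0 ∧ x ∈ RR F D := by
  have : Nontrivial (RR F D) := Module.finrank_pos_iff.1 h
  obtain ⟨x, hx⟩ := exists_ne (0 : RR F D)
  exact ⟨x, fun h => hx (Subtype.ext h), x.2⟩

lemma ell_add_divi (D : Dv K) {x : K} (hx : x ≠ 0) : ell F (D + divi F x) = ell F D := by
  refine LinearEquiv.finrank_eq (LinearEquiv.ofLinearMap (M := RR F (D + divi F x)) (M₂ := RR F D)
    ((LinearMap.mulLeft F x).restrict fun y hy => ?_)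
    ((LinearMap.mulLeft F x⁻¹).restrict fun y hy => ?_) ?_ ?_)
  · rw [mem_RR] at hy ⊢
    intro v
    refine ((Place.le_ord x).mul (hy v)).mono ?_
    simp
  · rw [mem_RR] at hy ⊢
    intro v
    refine ((Place.le_ord x⁻¹).mul (hy v)).mono ?_
    simp
  · ext y; simp [hx]
  · ext y; simp [hx]

end
end TAD

namespace TAD
open IntermediateField Polynomial

section
variable {F : Type*} {K : Type*} [Field F] [Field K] [Algebra F K] [Finite F] [GF F K]

lemma ell_poles {x : K} (hx : Transcendental F x) : ∃ C : Dv K, 0 ≤ C ∧ ∀ m : ℕ,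
    Module.finrank F⟮x⟯ K * (m + 1) ≤ ell F (m • ((-(divi F x)) ⊔ 0) + C) := by
  obtain ⟨b, hb⟩ := exists_pInd hx
  generalize Module.finrank F⟮x⟯ K = n at b hb ⊢
  refine ⟨∑ j, ((-(divi F (b j))) ⊔ 0), Finset.sum_nonneg fun j _ => le_sup_right, fun m => ?_⟩
  set B := (-(divi F x)) ⊔ 0 with hB
  set C := ∑ j, ((-(divi F (b j))) ⊔ 0) with hC
  have hx1 : x ∈ RR F B := by
    rw [mem_RR]; intro v
    refine (Place.le_ord x).mono ?_
    have h : (-(divi F x)) v ≤ B v := (le_sup_left : -(divi F x) ≤ B) v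
    simp at h; omega
  have hb1 : ∀ j, b j ∈ RR F C := by
    intro j
    rw [mem_RR]; intro v
    refine (Place.le_ord (b j)).mono ?_
    have h1 : (-(divi F (b j))) ⊔ 0 ≤ C :=
      Finset.single_le_sum (f := fun j => (-(divi F (b j))) ⊔ 0) (fun j _ => le_sup_right) (Finset.mem_univ j)
    have h : (-(divi F (b j))) v ≤ C v := (le_sup_left.trans h1 : -(divi F (b j)) ≤ C) v
    simp at h; omega
  have hB0 : 0 ≤ B := le_sup_right
  have hm : ∀ (i : Fin (m+1)) (j : Fin n), x ^ (i : ℕ) * b j ∈ RR F (m • B + C) := by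
    intro i j
    rw [mem_RR]
    intro v
    have h1 := ((mem_RR.1 hx1 v).pow i).mul (mem_RR.1 (hb1 j) v)
    refine h1.mono ?_
    have h2 : (0 : ℤ) ≤ B v := hB0 v
    have h3 : ((i : ℕ) : ℤ) ≤ m := by have := i.2; omega
    have h4 := mul_le_mul_of_nonneg_right h3 h2
    rw [Finsupp.add_apply, Finsupp.smul_apply, nsmul_eq_mul]
    linarith
  let f : Fin (m+1) × Fin n → RR F (m • B + C) := fun p => ⟨x ^ (p.1 : ℕ) * b p.2, hm p.1 p.2⟩
  have hf : LinearIndependent F f := by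
    rw [Fintype.linearIndependent_iff]
    intro g hg
    have h1 : ∑ p : Fin (m+1) × Fin n, g p • (x ^ (p.1 : ℕ) * b p.2) = 0 := by
      have := congrArg (Submodule.subtype _) hg
      simpa [f] using this
    have h2 := hb (fun j => ∑ i : Fin (m+1), Polynomial.C (g (i, j)) * X ^ (i : ℕ)) (by
      rw [← h1, Fintype.sum_prod_type_right]
      refine Finset.sum_congr rfl fun j _ => ?_
      rw [map_sum, Finset.sum_mul]
      refine Finset.sum_congr rfl fun i _ => ?_
      simp [Algebra.smul_def, mul_assoc])
    rintro ⟨i, j⟩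
    have h3 := congrArg (fun p => Polynomial.coeff p (i : ℕ)) (h2 j)
    simp only [Polynomial.finsetSum_coeff, Polynomial.coeff_C_mul, Polynomial.coeff_X_pow,
      Polynomial.coeff_zero] at h3
    rw [Finset.sum_eq_single i] at h3
    · simpa using h3
    · intro k _ hk
      rw [if_neg (fun h => hk (Fin.ext h.symm)), mul_zero]
    · simp
  have := hf.fintype_card_le_finrank
  rw [Fintype.card_prod, Fintype.card_fin, Fintype.card_fin] at this
  rw [ell]
  linarith

lemma degD_neg_part_le {x : K} (hx : Transcendental F x) :
    degD F ((divi F x) ⊔ 0) ≤ Module.finrank F⟮x⟯ K := by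
  obtain ⟨E, hE⟩ := exists_eff (le_sup_right : (0 : Dv K) ≤ (divi F x) ⊔ 0)
  have hv : ∀ v, (E v : ℤ) = max (v.ord x) 0 := fun v => by
    have := DFunLike.congr_fun hE v
    simpa using this.symm
  have := sum_deg_le hx E (by
    intro v hv'
    have h1 := hv v
    have : E v ≠ 0 := by simpa using hv'
    rcases max_cases (v.ord x) 0 with h | h <;> omega)
  rw [hE, degD_apply, Finsupp.sum_mapRange_index (by simp)]
  calc _ = ((E.sum fun v n => n * v.deg F : ℕ) : ℤ) := by
        rw [Finsupp.sum, Finsupp.sum]; push_cast; rfl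
    _ ≤ _ := by exact_mod_cast this

omit [Finite F] [GF F K] in
lemma adjoin_inv (x : K) : F⟮x⁻¹⟯ = F⟮x⟯ := by
  apply le_antisymm
  · rw [adjoin_simple_le_iff]; exact inv_mem (mem_adjoin_simple_self F x)
  · rw [adjoin_simple_le_iff]
    have := inv_mem (mem_adjoin_simple_self F x⁻¹)
    rwa [inv_inv] at this

omit [Finite F] [GF F K] in
lemma trans_inv {x : K} (hx : Transcendental F x) : Transcendental F x⁻¹ :=
  fun h => hx (by simpa using h.inv)

lemma degD_poles {x : K} (hx : Transcendental F x) :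
    degD F ((-(divi F x)) ⊔ 0) = Module.finrank F⟮x⟯ K := by
  apply le_antisymm
  · have := degD_neg_part_le (trans_inv hx)
    rwa [divi_inv, adjoin_inv] at this
  · obtain ⟨C, hC, h⟩ := ell_poles hx
    set B := (-(divi F x)) ⊔ 0 with hB
    set n := Module.finrank F⟮x⟯ K
    by_contra hc
    push Not at hc
    have hB0 : 0 ≤ B := le_sup_right
    have key : ∀ m : ℕ, (n : ℤ) * (m + 1) ≤ ell F (0 : Dv K) + m * degD F B + degD F C := by
      intro m
      have h1 := ell_le (F := F) (add_nonneg (nsmul_nonneg hB0 m) hC)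
      have h2 := h m
      have h3 : ((n * (m + 1) : ℕ) : ℤ) ≤ ell F (m • B + C) := by exact_mod_cast h2
      rw [sub_zero, map_add, map_nsmul, nsmul_eq_mul] at h1
      push_cast at h3
      linarith
    have h4 := key (ell F (0 : Dv K) + (degD F C).toNat)
    have h5 : 0 ≤ degD F C := degD_nonneg F hC
    have h6 : (((degD F C).toNat : ℕ) : ℤ) = degD F C := Int.toNat_of_nonneg h5
    push_cast at h4
    rw [h6] at h4
    have h7 : (0:ℤ) ≤ ell F (0 : Dv K) := by positivity
    have h8 : degD F B + 1 ≤ n := hc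
    have h9 : 0 ≤ degD F B := degD_nonneg F hB0
    have h10 := mul_le_mul_of_nonneg_right h8 (show (0:ℤ) ≤ ell F (0 : Dv K) + degD F C + 1 by linarith)
    nlinarith

theorem degD_divi (x : K) : degD F (divi F x) = 0 := by
  by_cases hx : Transcendental F x
  · have h1 := degD_poles hx
    have h2 := degD_poles (trans_inv hx)
    rw [divi_inv, neg_neg, adjoin_inv] at h2
    have h3 : divi F x = (divi F x) ⊔ 0 - (-(divi F x)) ⊔ 0 := by
      ext v
      simp only [Finsupp.coe_sub, Pi.sub_apply, Finsupp.sup_apply, Finsupp.coe_neg, Pi.neg_apply,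
        Finsupp.coe_zero, Pi.zero_apply]
      rcases le_total 0 (divi F x v) with h | h
      · rw [sup_of_le_left h, sup_of_le_right (by omega)]; omega
      · rw [sup_of_le_right h, sup_of_le_left (by omega)]; omega
    rw [h3, map_sub, h1, h2, sub_self]
  · have : divi F x = 0 := by
      ext v
      rw [Transcendental, not_not] at hx
      simp [v.ord_of_isAlgebraic hx]
    rw [this, map_zero]

lemma ell_eq_zero {D : Dv K} (h : degD F D < 0) : ell F D = 0 := by
  by_contra hc
  obtain ⟨x, hx0, hx⟩ := exists_mem_RR (Nat.pos_of_ne_zero hc)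
  rw [mem_RR_iff hx0] at hx
  have := degD_nonneg F hx
  rw [map_add, degD_divi] at this
  linarith

variable (F K) in
theorem riemann_ineq : ∃ γ : ℤ, ∀ D : Dv K, degD F D - γ ≤ ell F D := by
  obtain ⟨x, hx⟩ := GF.exT (F := F) (K := K)
  obtain ⟨C, hC, h⟩ := ell_poles hx
  have hB1 := degD_poles hx
  have hn : 0 < Module.finrank F⟮x⟯ K := by
    have := GF.fin x hx
    exact Module.finrank_pos
  set B := (-(divi F x)) ⊔ 0 with hB
  set n := Module.finrank F⟮x⟯ K
  have hB0 : 0 ≤ B := le_sup_right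
  have hm : ∀ m : ℕ, degD F (m • B) - degD F C ≤ ell F (m • B) := by
    intro m
    have h1 := ell_le (F := F) (show m • B ≤ m • B + C by simpa using hC)
    have h2 : ((n * (m + 1) : ℕ) : ℤ) ≤ ell F (m • B + C) := by exact_mod_cast h m
    rw [add_sub_cancel_left] at h1
    rw [map_nsmul, hB1, nsmul_eq_mul]
    push_cast at h2
    linarith
  have mono : ∀ D D' : Dv K, D ≤ D' → degD F D - ell F D ≤ degD F D' - ell F D' := by
    intro D D' hD
    have := ell_le (F := F) hD
    rw [map_sub] at this; linarith
  refine ⟨degD F C, fun D => ?_⟩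
  have h1 := mono D (D ⊔ 0) le_sup_left
  set D' := D ⊔ 0
  have hD' : 0 ≤ D' := le_sup_right
  have hd : 0 ≤ degD F D' := degD_nonneg F hD'
  have hc : 0 ≤ degD F C := degD_nonneg F hC
  set m : ℕ := (degD F C + degD F D' + 1).toNat with hmdef
  have hmz : (m : ℤ) = degD F C + degD F D' + 1 := Int.toNat_of_nonneg (by linarith)
  have h2 := mono (m • B - D') (m • B) (by simpa using hD')
  have h3 := hm m
  have h4 : 0 < ell F (m • B - D') := by
    have : (0:ℤ) < ell F (m • B - D') := by
      rw [map_sub] at h2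
      rw [map_nsmul, hB1, nsmul_eq_mul, hmz] at h2 h3
      nlinarith
    exact_mod_cast this
  obtain ⟨f, hf0, hf⟩ := exists_mem_RR h4
  rw [mem_RR_iff hf0] at hf
  have h5 := mono D' (m • B + divi F f) (by
    have : divi F f + (m • B - D') = (m • B + divi F f) - D' := by abel
    rw [this] at hf
    exact sub_nonneg.1 hf)
  rw [ell_add_divi _ hf0, map_add, degD_divi] at h5
  linarith

variable (F K) in
theorem riemann_roch : ∃ c n0 : ℤ, ∀ D : Dv K, n0 ≤ degD F D → (ell F D : ℤ) = degD F D + c := by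
  obtain ⟨γ, hγ⟩ := riemann_ineq F K
  have mono : ∀ D D' : Dv K, D ≤ D' → degD F D - ell F D ≤ degD F D' - ell F D' := by
    intro D D' hD
    have := ell_le (F := F) hD
    rw [map_sub] at this; linarith
  obtain ⟨M, ⟨D0, hD0⟩, hM⟩ := Int.exists_greatest_of_bdd
    (P := fun m => ∃ D : Dv K, degD F D - ell F D = m)
    ⟨γ, by rintro _ ⟨D, rfl⟩; have := hγ D; linarith⟩ ⟨_, 0, rfl⟩
  refine ⟨-M, degD F D0 + γ + 1, fun D hD => ?_⟩
  have h1 := hM _ ⟨D, rfl⟩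
  have h2 := hγ (D - D0)
  rw [map_sub] at h2
  obtain ⟨f, hf0, hf⟩ := exists_mem_RR (F := F) (D := D - D0) (by
    have : (0:ℤ) < ell F (D - D0) := by linarith
    exact_mod_cast this)
  rw [mem_RR_iff hf0] at hf
  have h5 := mono D0 (D + divi F f) (by
    have : divi F f + (D - D0) = (D + divi F f) - D0 := by abel
    rw [this] at hf
    exact sub_nonneg.1 hf)
  rw [ell_add_divi _ hf0, map_add, degD_divi] at h5
  linarith

end
end TAD

namespace TAD
open IntermediateField Polynomial

section
variable {F : Type*} {K : Type*} [Field F] [Field K] [Algebra F K] [Finite F] [GF F K]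

variable (F K) in
lemma finite_places_deg (d : ℕ) : {v : Place K | v.deg F ≤ d}.Finite := by
  obtain ⟨t, ht⟩ := GF.exT (F := F) (K := K)
  have hne : ∀ n, 0 < n → t ^ (Nat.card F ^ n) - t ≠ 0 := by
    intro n hn h
    refine ht ⟨X ^ (Nat.card F ^ n) - X, ?_, by simpa using h⟩
    intro h0
    have h1 := congrArg (fun p => Polynomial.coeff p 1) h0
    have h2 : 1 ≠ Nat.card F ^ n := by
      have := Nat.one_lt_pow hn.ne' (Finite.one_lt_card (α := F)); omega
    simp [Polynomial.coeff_X_pow, h2] at h1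
  refine ((finite_zeros (F := F) t⁻¹).union (Set.Finite.biUnion (Set.finite_Iic d)
    fun n _ => finite_zeros (F := F) (t ^ (Nat.card F ^ n) - t))).subset fun v hv => ?_
  by_cases h : 0 < v.ord t⁻¹
  · left; exact h
  · right
    simp only [Set.mem_iUnion]
    refine ⟨v.deg F, hv, ?_⟩
    have h0 : v.le 0 t := Or.inr (by rw [Place.ord_inv] at h; omega)
    have hfin := finite_κ (F := F) v
    have h1 : v.res (t ^ (Nat.card F ^ (v.deg F)) - t) = 0 := by
      rw [Place.res_sub (h0.pow0 _) h0, Place.res_pow h0, ← v.card_κ (F := F)]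
      have := Fintype.ofFinite v.κ
      rw [Nat.card_eq_fintype_card, FiniteField.pow_card, sub_self]
    have h2 := (Place.res_eq_zero_iff ((h0.pow0 _).sub h0)).1 h1
    rcases h2 with h2 | h2
    · exact absurd h2 (hne _ v.deg_pos)
    · exact (by omega : (0:ℤ) < v.ord (t ^ (Nat.card F ^ (v.deg F)) - t))

/-- effective divisors -/
abbrev Ef (K : Type*) [Field K] := Place K →₀ ℕ

/-- cast -/
noncomputable def cE : Ef K →+ Dv K := Finsupp.mapRange.addMonoidHom (Nat.castAddMonoidHom ℤ)

@[simp] lemma cE_apply (E : Ef K) (v : Place K) : cE E v = E v := rfl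
lemma cE_nonneg (E : Ef K) : 0 ≤ cE E := fun v => by simp
lemma cE_inj : Function.Injective (cE (K := K)) := fun E E' h => by
  ext v; have := DFunLike.congr_fun h v; simpa using this
lemma exists_cE {D : Dv K} (h : 0 ≤ D) : ∃ E : Ef K, cE E = D := by
  refine ⟨D.mapRange Int.toNat rfl, ?_⟩
  ext v
  have := h v
  simp at this ⊢
  omega

variable (F) in
/-- degree -/
noncomputable def dg : Ef K →+ ℕ :=
  Finsupp.liftAddHom fun v : Place K => (AddMonoidHom.mulRight (v.deg F))

omit [GF F K] in
lemma dg_apply (D : Ef K) : dg F D = D.sum fun v n => n * (v.deg F) := rfl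
omit [GF F K] in
@[simp] lemma dg_single (v : Place K) (n : ℕ) : dg F (Finsupp.single v n) = n * v.deg F := by
  rw [dg_apply, Finsupp.sum_single_index (by simp)]
omit [GF F K] in
lemma degD_cE (E : Ef K) : degD F (cE E) = dg F E := by
  have : (degD F).comp cE = (Nat.castAddMonoidHom ℤ).comp (dg F (K := K)) := by
    ext v
    simp [cE]
  exact DFunLike.congr_fun this E

omit [GF F K] in
lemma mul_deg_le (E : Ef K) (v : Place K) : E v * v.deg F ≤ dg F E := by
  by_cases h : v ∈ E.support
  · rw [dg_apply, Finsupp.sum]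
    exact Finset.single_le_sum (f := fun v => E v * v.deg F) (fun _ _ => Nat.zero_le _) h
  · rw [Finsupp.notMem_support_iff.1 h]; simp

variable (F K) in
lemma finite_eff (n : ℕ) : {E : Ef K | dg F E = n}.Finite := by
  classical
  set T := (finite_places_deg F K n).toFinset with hT
  refine (Set.finite_Iic (∑ v ∈ T, Finsupp.single v n : Ef K)).subset fun E hE v => ?_
  have h1 := mul_deg_le (F := F) E v
  rw [show dg F E = n from hE] at h1
  have h2 := v.deg_pos (F := F)
  by_cases hv : v ∈ T
  · rw [Finsupp.finsetSum_apply, Finset.sum_eq_single v (by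
      intro w _ hw; rw [Finsupp.single_eq_of_ne (Ne.symm hw)]) (by simp [hv])]
    rw [Finsupp.single_eq_same]
    nlinarith
  · have h3 : n < v.deg F := by simpa [hT] using hv
    have : E v = 0 := by
      by_contra h
      have : 1 ≤ E v := Nat.pos_of_ne_zero h
      nlinarith
    rw [this]; exact Nat.zero_le _

variable (F K) in
/-- effective divisors of degree n -/
noncomputable def eff (n : ℕ) : Finset (Ef K) := (finite_eff F K n).toFinset
@[simp] lemma mem_eff {n : ℕ} {E : Ef K} : E ∈ eff F K n ↔ dg F E = n := by simp [eff]

variable (F K) in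
/-- principal divisors -/
def princ : AddSubgroup (Dv K) where
  carrier := {D | ∃ x : K, x ≠ 0 ∧ divi F x = D}
  add_mem' := by
    rintro _ _ ⟨x, hx, rfl⟩ ⟨y, hy, rfl⟩
    exact ⟨x * y, mul_ne_zero hx hy, divi_mul F hx hy⟩
  zero_mem' := ⟨1, one_ne_zero, divi_one F⟩
  neg_mem' := by
    rintro _ ⟨x, hx, rfl⟩
    exact ⟨x⁻¹, inv_ne_zero hx, divi_inv F x⟩

lemma mem_princ {D : Dv K} : D ∈ princ F K ↔ ∃ x : K, x ≠ 0 ∧ divi F x = D := Iff.rfl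
lemma degD_princ {D : Dv K} (h : D ∈ princ F K) : degD F D = 0 := by
  obtain ⟨x, _, rfl⟩ := h; exact degD_divi x

lemma card_ne_zero_RR (D : Dv K) : Nat.card {x : K // x ∈ RR F D ∧ x ≠ 0} + 1 = Nat.card F ^ ell F D := by
  have hf : Finite (RR F D) := Module.finite_of_finite F
  rw [ell, ← Module.natCard_eq_pow_finrank (K := F) (V := RR F D)]
  have e : {x : RR F D // x ≠ 0} ≃ {x : K // x ∈ RR F D ∧ x ≠ 0} :=
    { toFun := fun x => ⟨x.1.1, x.1.2, fun h => x.2 (Subtype.ext h)⟩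
      invFun := fun x => ⟨⟨x.1, x.2.1⟩, fun h => x.2.2 (congrArg Subtype.val h)⟩
      left_inv := fun _ => rfl
      right_inv := fun _ => rfl }
  rw [← Nat.card_congr e]
  classical
  have := Fintype.ofFinite (RR F D)
  rw [Nat.card_eq_fintype_card, Nat.card_eq_fintype_card, Fintype.card_subtype_compl,
    Fintype.card_subtype_eq]
  have : 0 < Fintype.card (RR F D) := Fintype.card_pos
  omega

/-- linear system -/
def Lsys (F : Type*) {K : Type*} [Field F] [Field K] [Algebra F K] [Finite F] [GF F K] (D : Dv K) : Type _ :=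
  {E : Ef K // cE E - D ∈ princ F K}

lemma card_Lsys_mul (D : Dv K) : Nat.card (Lsys F D) * Nat.card {x : K // x ∈ RR F (0 : Dv K) ∧ x ≠ 0} + 1
    = Nat.card F ^ ell F D := by
  rw [← card_ne_zero_RR, ← Nat.card_prod]
  congr 1
  have hs : ∀ E : Lsys F D, ∃ x : K, x ≠ 0 ∧ divi F x = cE E.1 - D := fun E => E.2
  choose s hs0 hs1 using hs
  refine Nat.card_congr (Equiv.ofBijective (fun p => ⟨s p.1 * p.2.1, ?_, mul_ne_zero (hs0 _) p.2.2.2⟩) ⟨?_, ?_⟩)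
  · have h1 := p.2.2.1
    rw [mem_RR_iff (mul_ne_zero (hs0 _) p.2.2.2), divi_mul F (hs0 _) p.2.2.2, hs1]
    rw [mem_RR_iff p.2.2.2, add_zero] at h1
    have := add_nonneg h1 (cE_nonneg p.1.1)
    have e : cE p.1.1 - D + divi F (p.2.1 : K) + D = divi F (p.2.1 : K) + cE p.1.1 := by abel
    rw [e]; exact this
  · rintro ⟨E, y, hy, hy0⟩ ⟨E', y', hy', hy0'⟩ h
    have h1 : s E * y = s E' * y' := congrArg Subtype.val h
    have hd : ∀ y : K, y ≠ 0 → y ∈ RR F (0 : Dv K) → divi F y = 0 := by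
      intro y hy0 hy
      ext v
      have := isAlgebraic_of_le (F := F) (x := y) fun v => by simpa using mem_RR.1 hy v
      simp [v.ord_of_isAlgebraic this]
    have h2 := congrArg (divi F) h1
    rw [divi_mul F (hs0 _) hy0, divi_mul F (hs0 _) hy0', hs1, hs1, hd _ hy0 hy, hd _ hy0' hy',
      add_zero, add_zero] at h2
    have h3 : E = E' := Subtype.ext (cE_inj (sub_left_injective h2))
    subst h3
    have h4 := mul_left_cancel₀ (hs0 E) h1
    subst h4; rfl
  · rintro ⟨x, hx, hx0⟩
    rw [mem_RR_iff hx0] at hx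
    obtain ⟨E, hE⟩ := exists_cE hx
    have hE' : cE E - D = divi F x := by rw [hE]; abel
    let E' : Lsys F D := ⟨E, x, hx0, hE'.symm⟩
    have h1 : divi F (s E') = divi F x := by rw [hs1, ← hE']
    refine ⟨⟨E', x / s E', ?_, div_ne_zero hx0 (hs0 _)⟩, Subtype.ext ?_⟩
    · rw [mem_RR_iff (div_ne_zero hx0 (hs0 _)), divi_div F hx0 (hs0 _), h1]; simp
    · exact mul_div_cancel₀ _ (hs0 _)

lemma card_const_pos : 0 < Nat.card {x : K // x ∈ RR F (0 : Dv K) ∧ x ≠ 0} := by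
  have h1 := card_ne_zero_RR (F := F) (0 : Dv K)
  have h2 : 0 < ell F (0 : Dv K) := by
    have : Nontrivial (RR F (0 : Dv K)) := ⟨⟨1, by
      rw [mem_RR_iff one_ne_zero, divi_one]; simp⟩, 0, fun h => one_ne_zero (congrArg Subtype.val h)⟩
    exact Module.finrank_pos
  have := Nat.one_lt_pow h2.ne' (Finite.one_lt_card (α := F))
  omega

lemma card_Lsys_eq {D D' : Dv K} (h : ell F D = ell F D') : Nat.card (Lsys F D) = Nat.card (Lsys F D') := by
  have h1 := card_Lsys_mul (F := F) D
  have h2 := card_Lsys_mul (F := F) D'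
  rw [h, ← h2] at h1
  exact Nat.eq_of_mul_eq_mul_right (card_const_pos (F := F) (K := K)) (by omega)

lemma card_Lsys_pos {D : Dv K} (h : 0 < ell F D) : 0 < Nat.card (Lsys F D) := by
  have h1 := card_Lsys_mul (F := F) D
  have := Nat.one_lt_pow h.ne' (Finite.one_lt_card (α := F))
  by_contra hc
  have : Nat.card (Lsys F D) = 0 := by omega
  rw [this] at h1
  omega

lemma nonempty_Lsys {D : Dv K} (h : 0 < ell F D) : ∃ E : Ef K, cE E - D ∈ princ F K := by
  obtain ⟨x, hx0, hx⟩ := exists_mem_RR h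
  rw [mem_RR_iff hx0] at hx
  obtain ⟨E, hE⟩ := exists_cE hx
  exact ⟨E, x, hx0, by rw [hE]; abel⟩

variable (F K) in
lemma exists_big (n0 : ℤ) : ∃ A : Dv K, n0 ≤ degD F A := by
  obtain ⟨v⟩ := exists_place F (K := K)
  refine ⟨Finsupp.single v |n0|, ?_⟩
  rw [degD_single]
  have h1 : (1:ℤ) ≤ v.deg F := by exact_mod_cast v.deg_pos (F := F)
  have := le_abs_self n0
  nlinarith [abs_nonneg n0]

/-- finiteness of the class group of degree zero -/
lemma finite_pic0 : ∃ S : Set (Dv K), S.Finite ∧ ∀ D : Dv K, degD F D = 0 → ∃ E ∈ S, D - E ∈ princ F K := by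
  obtain ⟨c, n0, h⟩ := riemann_roch F K
  obtain ⟨A, hA⟩ := exists_big F K (max n0 (1 - c))
  refine ⟨(fun E => cE E - A) '' {E | dg F E = (degD F A).toNat}, (finite_eff F K _).image _, fun D hD => ?_⟩
  have h1 := h (D + A) (by rw [map_add, hD, zero_add]; exact (le_max_left _ _).trans hA)
  obtain ⟨E, hE⟩ := nonempty_Lsys (F := F) (D := D + A) (by
    have : (0 : ℤ) < ell F (D + A) := by
      rw [h1, map_add, hD]; have := (le_max_right _ _).trans hA; linarith
    exact_mod_cast this)
  have h2 := degD_princ hE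
  rw [map_sub, map_add, hD, degD_cE] at h2
  refine ⟨_, ⟨E, (show dg F E = _ by omega), rfl⟩, ?_⟩
  have := neg_mem hE
  have e : D - (cE E - A) = -(cE E - (D + A)) := by abel
  change D - (cE E - A) ∈ _
  rw [e]; exact this

end
end TAD

namespace TAD
open IntermediateField Polynomial

section
variable {F : Type*} {K : Type*} [Field F] [Field K] [Algebra F K] [Finite F] [GF F K]

/-- sign -/
def sgn (a : ZMod 2) : ℤ := if a = 0 then 1 else -1
lemma sgn_add : ∀ a b : ZMod 2, sgn (a + b) = sgn a * sgn b := by decide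
lemma sgn_one : sgn 1 = -1 := by decide
lemma sgn_zero : sgn 0 = 1 := by decide

variable (F) in
/-- sum of signs -/
noncomputable def asum (χ : Dv K →+ ZMod 2) (n : ℕ) : ℤ := ∑ E ∈ eff F K n, sgn (χ (cE E))

lemma asum_eq_zero (χ : Dv K →+ ZMod 2) (hP : ∀ D ∈ princ F K, χ D = 0) (D0 : Dv K)
    (hD0 : degD F D0 = 0) (hχ : χ D0 = 1) : ∃ n0 : ℕ, ∀ n, n0 ≤ n → asum F χ n = 0 := by
  classical
  obtain ⟨c, n1, h⟩ := riemann_roch F K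
  refine ⟨(max n1 (1 - c)).toNat, fun n hn => ?_⟩
  have hn1 : n1 ≤ n := by have := le_max_left n1 (1 - c); omega
  have hn2 : 1 - c ≤ n := by have := le_max_right n1 (1 - c); omega
  have hl : ∀ D : Dv K, degD F D = n → (ell F D : ℤ) = n + c := fun D hD => by
    rw [h D (by omega), hD]
  obtain ⟨N, hN0, hN⟩ : ∃ N : ℕ, 0 < N ∧ ∀ D : Dv K, degD F D = n → Nat.card (Lsys F D) = N := by
    by_cases hex : ∃ D : Dv K, degD F D = n
    · obtain ⟨D, hD⟩ := hex
      refine ⟨Nat.card (Lsys F D), card_Lsys_pos (by have := hl D hD; omega), fun D' hD' => card_Lsys_eq ?_⟩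
      have h1 := hl D hD
      have h2 := hl D' hD'
      omega
    · exact ⟨1, one_pos, fun D hD => absurd ⟨D, hD⟩ hex⟩
  have hcard : ∀ D : Dv K, degD F D = n → ((eff F K n).filter fun E => cE E - D ∈ princ F K).card = N := by
    intro D hD
    rw [← hN D hD]
    refine (Nat.subtype_card (p := fun E => cE E - D ∈ princ F K) _ fun E => ?_).symm
    rw [Finset.mem_filter, mem_eff]
    refine ⟨fun h => h.2, fun h => ⟨?_, h⟩⟩
    have := degD_princ h
    rw [map_sub, degD_cE, hD] at this
    omega
  have h1 : ∑ E ∈ eff F K n, ∑ E' ∈ eff F K n, (if cE E' - (cE E + D0) ∈ princ F K then sgn (χ (cE E)) else 0)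
      = N * asum F χ n := by
    rw [asum, Finset.mul_sum]
    refine Finset.sum_congr rfl fun E hE => ?_
    rw [← Finset.sum_filter, Finset.sum_const, hcard (cE E + D0) (by
      rw [map_add, hD0, degD_cE, mem_eff.1 hE, add_zero]), nsmul_eq_mul]
  have h2 : ∑ E ∈ eff F K n, ∑ E' ∈ eff F K n, (if cE E' - (cE E + D0) ∈ princ F K then sgn (χ (cE E)) else 0)
      = - (N * asum F χ n) := by
    rw [Finset.sum_comm, asum, Finset.mul_sum, ← Finset.sum_neg_distrib]
    refine Finset.sum_congr rfl fun E hE => ?_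
    have : ∀ E' ∈ eff F K n, (if cE E - (cE E' + D0) ∈ princ F K then sgn (χ (cE E')) else 0) =
        (if cE E' - (cE E - D0) ∈ princ F K then - sgn (χ (cE E)) else 0) := by
      intro E' _
      have e : cE E - (cE E' + D0) = -(cE E' - (cE E - D0)) := by abel
      rw [e, neg_mem_iff]
      split_ifs with hh
      · have := hP _ hh
        rw [map_sub, map_sub, hχ] at this
        have e2 : χ (cE E) = χ (cE E') + 1 := by linear_combination -this
        rw [e2, sgn_add, sgn_one]; ring
      · rfl
    rw [Finset.sum_congr rfl this, ← Finset.sum_filter, Finset.sum_const, hcard (cE E - D0) (by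
      rw [map_sub, hD0, degD_cE, mem_eff.1 hE, sub_zero]), nsmul_eq_mul, mul_neg]
  have h3 : (N : ℤ) * asum F χ n = 0 := by linarith
  rcases mul_eq_zero.1 h3 with h3 | h3
  · omega
  · exact h3

open Classical in
variable (F) in
/-- local count -/
noncomputable def rsum (G : Ef K) : ℤ := ∑ E ∈ Finset.Iic G, (-1) ^ (dg F E)

lemma geom_sign (d n : ℕ) : 0 ≤ ∑ k ∈ Finset.Iic n, (-1 : ℤ) ^ (k * d) ∧
    (0 < ∑ k ∈ Finset.Iic n, (-1 : ℤ) ^ (k * d) ↔ (Odd d → Even n)) := by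
  rcases Nat.even_or_odd d with hd | hd
  · have : ∀ k ∈ Finset.Iic n, (-1 : ℤ) ^ (k * d) = 1 := fun k _ => (hd.mul_left k).neg_one_pow
    rw [Finset.sum_congr rfl this]
    have h0 : ¬ Odd d := Nat.not_odd_iff_even.2 hd
    simp [h0]
    omega
  · have : ∀ k ∈ Finset.Iic n, (-1 : ℤ) ^ (k * d) = (-1) ^ k := fun k _ => by
      rw [mul_comm, pow_mul, hd.neg_one_pow]
    rw [Finset.sum_congr rfl this]
    have h : ∑ k ∈ Finset.Iic n, (-1 : ℤ) ^ k = if Even n then 1 else 0 := by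
      have e : Finset.Iic n = Finset.range (n + 1) := by ext; simp [Nat.lt_succ_iff]
      rw [e, neg_one_geom_sum]
      rcases Nat.even_or_odd n with hn | hn
      · simp [hn, Nat.even_add_one]
      · simp [hn, Nat.even_add_one, Nat.not_even_iff_odd.2 hn]
    rw [h]
    split_ifs with hn <;> simp [hn, hd]

open Classical in
lemma rsum_add (v : Place K) (n : ℕ) (f : Ef K) (hf : v ∉ f.support) :
    rsum F (Finsupp.single v n + f) = (∑ k ∈ Finset.Iic n, (-1 : ℤ) ^ (k * v.deg F)) * rsum F f := by
  have hfv : f v = 0 := by simpa using hf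
  rw [rsum, rsum, Finset.sum_mul_sum, ← Finset.sum_product']
  refine Finset.sum_bij' (fun E _ => (E v, E.erase v)) (fun p _ => Finsupp.single v p.1 + p.2) ?_ ?_ ?_ ?_ ?_
  · intro E hE
    rw [Finset.mem_Iic] at hE
    rw [Finset.mem_product, Finset.mem_Iic, Finset.mem_Iic]
    refine ⟨by simpa [hfv] using hE v, fun w => ?_⟩
    by_cases hw : w = v
    · subst hw; simp
    · simpa [hw, Finsupp.erase_ne hw] using hE w
  · intro p hp
    rw [Finset.mem_product, Finset.mem_Iic, Finset.mem_Iic] at hp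
    rw [Finset.mem_Iic]
    exact add_le_add (Finsupp.single_le_single.2 hp.1) hp.2
  · intro E _
    exact Finsupp.single_add_erase v E
  · intro p hp
    rw [Finset.mem_product, Finset.mem_Iic, Finset.mem_Iic] at hp
    have h0 : p.2 v = 0 := by have := hp.2 v; omega
    ext w
    · simp [h0]
    · by_cases hw : w = v
      · subst hw; simp [h0]
      · simp [hw, Finsupp.erase_ne hw]
  · intro E _
    conv_lhs => rw [← Finsupp.single_add_erase v E]
    rw [map_add, dg_single, pow_add]

lemma rsum_sign (G : Ef K) : 0 ≤ rsum F G ∧ (0 < rsum F G ↔ ∀ v : Place K, Odd (v.deg F) → Even (G v)) := by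
  classical
  refine Finsupp.induction G ?_ ?_
  · have : Finset.Iic (0 : Ef K) = {0} := by
      ext E; simp
    simp [rsum, this]
  · intro v n f hf hn ih
    obtain ⟨h1, h2⟩ := geom_sign (v.deg F) n
    rw [rsum_add v n f hf]
    refine ⟨mul_nonneg h1 ih.1, ?_⟩
    have hfv : f v = 0 := by simpa using hf
    constructor
    · intro h w hw
      have h3 : 0 < ∑ k ∈ Finset.Iic n, (-1 : ℤ) ^ (k * v.deg F) := by
        rcases h1.lt_or_eq with h' | h'
        · exact h'
        · rw [← h', zero_mul] at h; omega
      have h4 : 0 < rsum F f := pos_of_mul_pos_right h h1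
      by_cases hwv : w = v
      · subst hwv; simpa [hfv] using h2.1 h3 hw
      · simpa [hwv] using ih.2.1 h4 w hw
    · intro h
      refine mul_pos (h2.2 fun hv => ?_) (ih.2.2 fun w hw => ?_)
      · simpa [hfv] using h v hv
      · by_cases hwv : w = v
        · subst hwv; simp [hfv]
        · simpa [hwv] using h w hw

lemma conv_sum (χ : Dv K →+ ZMod 2) (N : ℕ) :
    ∑ G ∈ eff F K N, sgn (χ (cE G)) * rsum F G =
      ∑ j ∈ Finset.range (N + 1), (-1) ^ j * asum F χ j * asum F χ (N - j) := by
  classical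
  set U : Finset (Ef K) := (Finset.range (N+1)).biUnion (eff F K) with hU
  have hUm : ∀ E, E ∈ U ↔ dg F E ≤ N := by intro E; simp [hU, Nat.lt_succ_iff]
  set P : Finset (Ef K × Ef K) := (U ×ˢ U).filter fun p => dg F p.1 + dg F p.2 = N with hPdef
  have hPm : ∀ p : Ef K × Ef K, p ∈ P ↔ dg F p.1 + dg F p.2 = N := by
    intro p; simp only [hPdef, Finset.mem_filter, Finset.mem_product, hUm]; omega
  let φ : Ef K × Ef K → ℤ := fun p => sgn (χ (cE p.1)) * sgn (χ (cE p.2)) * (-1) ^ (dg F p.2)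
  trans ∑ p ∈ P, φ p
  · rw [← Finset.sum_fiberwise_of_maps_to (s := P) (t := eff F K N) (g := fun p => p.1 + p.2)
      (fun p hp => by rw [mem_eff, map_add]; exact (hPm p).1 hp)]
    refine Finset.sum_congr rfl fun G hG => ?_
    rw [rsum, Finset.mul_sum]
    refine Finset.sum_bij' (fun E _ => (G - E, E)) (fun p _ => p.2) ?_ ?_ ?_ ?_ ?_
    · intro E hE
      rw [Finset.mem_Iic] at hE
      rw [Finset.mem_filter, hPm]
      have e : G - E + E = G := tsub_add_cancel_of_le hE
      refine ⟨?_, e⟩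
      rw [← map_add, e]; exact mem_eff.1 hG
    · intro p hp
      rw [Finset.mem_filter] at hp
      rw [Finset.mem_Iic, ← hp.2]; exact le_add_self
    · intro E _; rfl
    · intro p hp
      rw [Finset.mem_filter] at hp
      ext1
      · simp only; rw [← hp.2, add_tsub_cancel_right]
      · rfl
    · intro E hE
      rw [Finset.mem_Iic] at hE
      have e : G - E + E = G := tsub_add_cancel_of_le hE
      conv_lhs => rw [← e]
      rw [map_add, map_add, sgn_add]
  · rw [← Finset.sum_fiberwise_of_maps_to (s := P) (t := Finset.range (N+1)) (g := fun p => dg F p.2)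
      (fun p hp => by have := (hPm p).1 hp; simp only [Finset.mem_range]; omega)]
    refine Finset.sum_congr rfl fun j hj => ?_
    rw [Finset.mem_range] at hj
    have e : P.filter (fun p => dg F p.2 = j) = eff F K (N - j) ×ˢ eff F K j := by
      ext p
      rw [Finset.mem_filter, hPm, Finset.mem_product, mem_eff, mem_eff]
      omega
    rw [e, Finset.sum_product, asum, asum, mul_comm, Finset.mul_sum, Finset.sum_mul_sum]
    refine Finset.sum_congr rfl fun E _ => Finset.sum_congr rfl fun E' hE' => ?_
    simp only [φ]
    rw [mem_eff.1 hE']; ring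

variable (F K) in
/-- divisors even at odd places -/
def evenDiv : AddSubgroup (Dv K) where
  carrier := {D | ∀ v : Place K, Odd (v.deg F) → Even (D v)}
  add_mem' := fun h1 h2 v hv => by simpa using (h1 v hv).add (h2 v hv)
  zero_mem' := fun v _ => by simp
  neg_mem' := fun h v hv => by simpa using (h v hv)

lemma exists_char (G : Type*) [AddCommGroup G] (H : AddSubgroup G) (h2 : ∀ x : G, x + x ∈ H) {d : G} (hd : d ∉ H) :
    ∃ χ : G →+ ZMod 2, (∀ x ∈ H, χ x = 0) ∧ χ d = 1 := by
  letI : Module (ZMod 2) (G ⧸ H) := AddCommGroup.zmodModule (n := 2) (by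
    intro x
    obtain ⟨y, rfl⟩ := QuotientAddGroup.mk_surjective x
    rw [two_nsmul, ← QuotientAddGroup.mk_add, QuotientAddGroup.eq_zero_iff]
    exact h2 y)
  have hne : (QuotientAddGroup.mk d : G ⧸ H) ≠ 0 := by
    rwa [Ne, QuotientAddGroup.eq_zero_iff]
  have : ∃ f : Module.Dual (ZMod 2) (G ⧸ H), f (QuotientAddGroup.mk d) ≠ 0 := by
    by_contra hc
    push Not at hc
    exact hne ((Module.forall_dual_apply_eq_zero_iff (ZMod 2) _).1 hc)
  obtain ⟨f, hf⟩ := this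
  refine ⟨f.toAddMonoidHom.comp (QuotientAddGroup.mk' H), fun x hx => ?_, ?_⟩
  · change f (QuotientAddGroup.mk x) = 0
    rw [(QuotientAddGroup.eq_zero_iff x).2 hx, map_zero]
  · have : ∀ a : ZMod 2, a ≠ 0 → a = 1 := by decide
    exact this _ hf

theorem lfunction_lemma (D0 : Dv K) (hD0 : degD F D0 = 0) :
    ∃ D ∈ evenDiv F K, ∃ x : K, x ≠ 0 ∧ D0 = D + divi F x := by
  by_contra hc
  have hnot : D0 ∉ evenDiv F K ⊔ princ F K := by
    intro h
    obtain ⟨D, hD, P, ⟨x, hx, rfl⟩, he⟩ := AddSubgroup.mem_sup.1 h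
    exact hc ⟨D, hD, x, hx, he.symm⟩
  obtain ⟨χ, hχ, hχ0⟩ := exists_char (Dv K) (evenDiv F K ⊔ princ F K) (fun D =>
    (le_sup_left : evenDiv F K ≤ _) (fun v _ => by simp)) hnot
  obtain ⟨n0, hn0⟩ := asum_eq_zero (F := F) χ (fun D hD => hχ D ((le_sup_right : princ F K ≤ _) hD)) D0 hD0 hχ0
  obtain ⟨v⟩ := exists_place F (K := K)
  set N := dg F (Finsupp.single v (2 * n0)) with hN
  have hNn : 2 * n0 ≤ N := by
    rw [hN, dg_single]
    exact Nat.le_mul_of_pos_right _ v.deg_pos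
  have h1 := conv_sum (F := F) χ N
  rw [Finset.sum_eq_zero (s := Finset.range (N+1))] at h1
  swap
  · intro j hj
    by_cases hj' : n0 ≤ j
    · rw [hn0 j hj']; ring
    · rw [hn0 (N - j) (by omega)]; ring
  have hpos : ∀ G ∈ eff F K N, 0 ≤ sgn (χ (cE G)) * rsum F G := by
    intro G _
    obtain ⟨h3, h4⟩ := rsum_sign (F := F) G
    rcases h3.lt_or_eq with h5 | h5
    · have : cE G ∈ evenDiv F K := fun v hv => by
        have := h4.1 h5 v hv
        rw [cE_apply]; exact_mod_cast this
      rw [hχ _ ((le_sup_left : evenDiv F K ≤ _) this), sgn_zero, one_mul]; exact h3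
    · rw [← h5, mul_zero]
  have h6 := (Finset.sum_eq_zero_iff_of_nonneg hpos).1 h1 (Finsupp.single v (2 * n0)) (mem_eff.2 rfl)
  have h7 : ∀ w : Place K, Odd (w.deg F) → Even (Finsupp.single v (2 * n0) w) := by
    intro w _
    classical
    rw [Finsupp.single_apply]; split_ifs <;> simp
  have h8 := (rsum_sign (F := F) (Finsupp.single v (2 * n0))).2.2 h7
  have : cE (Finsupp.single v (2 * n0)) ∈ evenDiv F K := fun w hw => by
    have := h7 w hw
    rw [cE_apply]; exact_mod_cast this
  rw [hχ _ ((le_sup_left : evenDiv F K ≤ _) this), sgn_zero, one_mul] at h6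
  omega

end
end TAD

namespace TAD
open IntermediateField Polynomial

open Classical in
/-- quadratic character on nonzero elements -/
noncomputable def chi {k : Type*} [Field k] (c : k) : ℤ := if IsSquare c then 1 else -1

section chi
variable {k : Type*} [Field k]

lemma chi_eq_one_iff {c : k} : chi c = 1 ↔ IsSquare c := by
  unfold chi; split_ifs with h <;> simp [h]
lemma chi_eq_neg_one_iff {c : k} : chi c = -1 ↔ ¬ IsSquare c := by
  unfold chi; split_ifs with h <;> simp [h]
lemma chi_cases (c : k) : chi c = 1 ∨ chi c = -1 := by
  unfold chi; split_ifs with h <;> simp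
lemma chi_one : chi (1 : k) = 1 := chi_eq_one_iff.2 ⟨1, by simp⟩
lemma chi_mul_self (c : k) : chi c * chi c = 1 := by
  rcases chi_cases c with h | h <;> rw [h] <;> norm_num

lemma chi_mul [Finite k] {a b : k} (ha : a ≠ 0) (hb : b ≠ 0) : chi (a * b) = chi a * chi b := by
  classical
  have := Fintype.ofFinite k
  have hq : ∀ {c : k}, c ≠ 0 → chi c = quadraticChar k c := by
    intro c hc
    rcases quadraticChar_dichotomy hc with h | h
    · rw [h, chi_eq_one_iff]; exact (quadraticChar_one_iff_isSquare hc).1 h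
    · rw [h, chi_eq_neg_one_iff]; exact quadraticChar_neg_one_iff_not_isSquare.1 h
  rw [hq ha, hq hb, hq (mul_ne_zero ha hb), map_mul]

lemma chi_inv (a : k) : chi a⁻¹ = chi a := by
  have : IsSquare a⁻¹ ↔ IsSquare a := isSquare_inv
  by_cases h : IsSquare a
  · rw [chi_eq_one_iff.2 h, chi_eq_one_iff.2 (this.2 h)]
  · rw [chi_eq_neg_one_iff.2 h, chi_eq_neg_one_iff.2 (mt this.1 h)]

lemma chi_zpow [Finite k] {a : k} (ha : a ≠ 0) (n : ℤ) : chi (a ^ n) = if Even n then 1 else chi a := by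
  split_ifs with h
  · obtain ⟨m, rfl⟩ := h
    exact chi_eq_one_iff.2 ⟨a ^ m, by rw [zpow_add₀ ha]⟩
  · rw [Int.not_even_iff_odd] at h
    obtain ⟨m, rfl⟩ := h
    rw [zpow_add₀ ha, zpow_one, chi_mul (zpow_ne_zero _ ha) ha,
      chi_eq_one_iff.2 ⟨a ^ m, by rw [two_mul, zpow_add₀ ha]⟩, one_mul]

end chi

namespace Place
variable {K : Type*} [Field K] (v : Place K)

/-- tame symbol -/
noncomputable def tame (a b : K) : K := (-1) ^ (v.ord a * v.ord b) * a ^ (v.ord b) * b ^ (-(v.ord a))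

/-- quadratic symbol -/
noncomputable def th (a b : K) : ℤ := chi (v.res (v.tame a b))

variable {v}
lemma tame_ne {a b : K} (ha : a ≠ 0) (hb : b ≠ 0) : v.tame a b ≠ 0 :=
  mul_ne_zero (mul_ne_zero (zpow_ne_zero _ (by simp)) (zpow_ne_zero _ ha)) (zpow_ne_zero _ hb)

lemma ord_neg_one_zpow (n : ℤ) : v.ord ((-1) ^ n) = 0 := by simp [ord_neg]

lemma ord_tame {a b : K} (ha : a ≠ 0) (hb : b ≠ 0) : v.ord (v.tame a b) = 0 := by
  have h1 : ((-1 : K) ^ (v.ord a * v.ord b)) ≠ 0 := zpow_ne_zero _ (by simp)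
  rw [tame, v.ord_mul _ _ (mul_ne_zero h1 (zpow_ne_zero _ ha)) (zpow_ne_zero _ hb),
    v.ord_mul _ _ h1 (zpow_ne_zero _ ha), ord_neg_one_zpow, ord_zpow, ord_zpow]
  ring

lemma tame_mul {a a' b : K} (ha : a ≠ 0) (ha' : a' ≠ 0) (hb : b ≠ 0) :
    v.tame (a * a') b = v.tame a b * v.tame a' b := by
  unfold tame
  rw [v.ord_mul _ _ ha ha', add_mul, zpow_add₀ (by simp), mul_zpow, neg_add, zpow_add₀ hb]
  ring

lemma tame_symm (a b : K) : v.tame b a = (v.tame a b)⁻¹ := by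
  unfold tame
  rw [mul_inv, mul_inv, zpow_neg, zpow_neg, inv_inv, mul_comm (v.ord b)]
  have : ((-1 : K) ^ (v.ord a * v.ord b))⁻¹ = (-1) ^ (v.ord a * v.ord b) := by
    rw [← inv_zpow]; simp
  rw [this]; ring

lemma th_symm {a b : K} (ha : a ≠ 0) (hb : b ≠ 0) : v.th a b = v.th b a := by
  rw [th, th, tame_symm a b, res_inv (tame_ne ha hb) (ord_tame ha hb), chi_inv]

lemma le_tame {a b : K} (ha : a ≠ 0) (hb : b ≠ 0) : v.le 0 (v.tame a b) := Or.inr (ord_tame ha hb).ge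
lemma res_tame_ne {a b : K} (ha : a ≠ 0) (hb : b ≠ 0) : v.res (v.tame a b) ≠ 0 :=
  res_ne_zero (tame_ne ha hb) (ord_tame ha hb)

lemma th_cases (a b : K) : v.th a b = 1 ∨ v.th a b = -1 := chi_cases _
lemma th_mul_self (a b : K) : v.th a b * v.th a b = 1 := chi_mul_self _

lemma th_neg_self {a : K} (ha : a ≠ 0) : v.th a (-a) = 1 := by
  have : v.tame a (-a) = 1 := by
    unfold tame
    rw [ord_neg, ← neg_one_mul a, mul_zpow, mul_mul_mul_comm, ← zpow_add₀ (by simp), ← zpow_add₀ ha,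
      add_neg_cancel, zpow_zero, mul_one]
    apply Even.neg_one_zpow
    have := Int.even_mul_pred_self (v.ord a)
    rw [mul_sub, mul_one] at this
    exact this
  rw [th, this, res_one, chi_one]

lemma res_zpow {x : K} (hx : x ≠ 0) (h : v.ord x = 0) (n : ℤ) : v.res (x ^ n) = v.res x ^ n := by
  have hl : v.le 0 x := Or.inr h.ge
  cases n with
  | ofNat n => simpa using res_pow hl n
  | negSucc n =>
    rw [zpow_negSucc, zpow_negSucc, res_inv (pow_ne_zero _ hx) (by simp [h]), res_pow hl]

section
variable [Finite v.κ]

lemma th_mul_left {a a' b : K} (ha : a ≠ 0) (ha' : a' ≠ 0) (hb : b ≠ 0) :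
    v.th (a * a') b = v.th a b * v.th a' b := by
  rw [th, tame_mul ha ha' hb, res_mul (le_tame ha hb) (le_tame ha' hb),
    chi_mul (res_tame_ne ha hb) (res_tame_ne ha' hb), th, th]

lemma th_mul_right {a b b' : K} (ha : a ≠ 0) (hb : b ≠ 0) (hb' : b' ≠ 0) :
    v.th a (b * b') = v.th a b * v.th a b' := by
  rw [th_symm ha (mul_ne_zero hb hb'), th_mul_left hb hb' ha, th_symm hb ha, th_symm hb' ha]

lemma th_sq_right {a b : K} (ha : a ≠ 0) (hb : b ≠ 0) : v.th a (b ^ 2) = 1 := by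
  rw [pow_two, th_mul_right ha hb hb, th_mul_self]

lemma th_sq_left {a b : K} (ha : a ≠ 0) (hb : b ≠ 0) : v.th (a ^ 2) b = 1 := by
  rw [pow_two, th_mul_left ha ha hb, th_mul_self]

lemma th_unit {a b : K} (ha : a ≠ 0) (h : v.ord a = 0) :
    v.th a b = if Even (v.ord b) then 1 else chi (v.res a) := by
  have : v.tame a b = a ^ (v.ord b) := by unfold tame; rw [h]; simp
  rw [th, this, res_zpow ha h, chi_zpow (res_ne_zero ha h)]

lemma th_one_left {b : K} : v.th 1 b = 1 := by
  rw [th_unit one_ne_zero (ord_one _), res_one, chi_one]; simp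

lemma res_eq_one {a : K} (h : v.le 1 (a - 1)) : a ≠ 0 ∧ v.ord a = 0 ∧ v.res a = 1 := by
  have h1 := ord_eq_of_sub (v := v) (x := a) one_ne_zero (by simpa using h)
  have h2 : a ≠ 0 ∧ v.ord a = 0 := by simpa using h1
  refine ⟨h2.1, h2.2, ?_⟩
  rw [← res_one (v := v), res_eq_iff (Or.inr h2.2.ge) le_one_zero]
  exact h

lemma th_near_one {a b : K} (h : v.le 1 (a - 1)) : v.th a b = 1 := by
  obtain ⟨h1, h2, h3⟩ := res_eq_one h
  rw [th_unit h1 h2, h3, chi_one]; simp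

lemma th_near {a x b : K} (ha : a ≠ 0) (hb : b ≠ 0) (h : v.le (v.ord a + 1) (x - a)) : v.th x b = v.th a b := by
  have h1 := ord_eq_of_sub (v := v) ha h
  have h2 : v.le 1 (x / a - 1) := by
    have := h.mul (le_ord (v := v) a⁻¹)
    rw [ord_inv] at this
    have e : x / a - 1 = (x - a) * a⁻¹ := by field_simp
    rw [e]; exact this.mono (by omega)
  have h3 := th_near_one (b := b) h2
  rw [← div_mul_cancel₀ x ha, th_mul_left (div_ne_zero h1.1 ha) ha hb, h3, one_mul]

lemma th_steinberg {a : K} (ha : a ≠ 0) (ha1 : 1 - a ≠ 0) : v.th a (1 - a) = 1 := by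
  rcases lt_trichotomy (v.ord a) 0 with h | h | h
  · have e1 : v.le 1 (a⁻¹) := Or.inr (by rw [ord_inv]; omega)
    have e2 : v.th (a⁻¹) (1 - a⁻¹) = 1 := by
      have hne : 1 - a⁻¹ ≠ 0 := by
        intro h0; apply ha1; rw [sub_eq_zero] at h0 ⊢
        rw [← inv_inv a, ← h0, inv_one]
      rw [th_symm (inv_ne_zero ha) hne]
      exact th_near_one (by simpa using e1.neg)
    have hne : 1 - a⁻¹ ≠ 0 := by
        intro h0; apply ha1; rw [sub_eq_zero] at h0 ⊢
        rw [← inv_inv a, ← h0, inv_one]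
    have e3 : 1 - a = (-a) * (1 - a⁻¹) := by field_simp; ring
    have e4 : v.th a (1 - a⁻¹) = v.th a⁻¹ (1 - a⁻¹) := by
      have e5 : a⁻¹ * a ^ 2 = a := by field_simp
      have e6 := th_mul_left (v := v) (inv_ne_zero ha) (pow_ne_zero 2 ha) hne
      rwa [th_sq_left ha hne, mul_one, e5] at e6
    rw [e3, th_mul_right ha (neg_ne_zero.2 ha) hne, th_neg_self ha, e4, e2, mul_one]
  · rw [th_unit ha h]
    split_ifs with hev
    · rfl
    · have h1 : v.ord (1 - a) ≠ 0 := by intro h0; rw [h0] at hev; simp at hev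
      have h2 : v.le 0 (1 - a) := le_one_zero.sub (Or.inr h.ge)
      have h3 : 1 ≤ v.ord (1 - a) := by
        have := (le_iff ha1).1 h2; omega
      have h4 : v.le 1 (a - 1) := by
        have : v.le 1 (1 - a) := Or.inr h3
        simpa using this.neg
      rw [(res_eq_one h4).2.2, chi_one]
  · rw [th_symm ha ha1]
    refine th_near_one ?_
    have : v.le 1 a := Or.inr h
    simpa using this.neg

lemma th_even_even {a b : K} (ha : a ≠ 0) (hb : b ≠ 0) (h1 : Even (v.ord a)) (h2 : Even (v.ord b)) :
    v.th a b = 1 := by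
  obtain ⟨m, hm⟩ := h1
  obtain ⟨n, hn⟩ := h2
  have e : v.tame a b = (a ^ n * b ^ (-m)) ^ 2 := by
    unfold tame
    rw [Even.neg_one_zpow (by rw [hm]; exact (Even.add_self m).mul_right _), one_mul, hm, hn, neg_add,
      zpow_add₀ ha, zpow_add₀ hb]; ring
  have hl : v.le 0 (a ^ n * b ^ (-m)) := Or.inr (by
    rw [v.ord_mul _ _ (zpow_ne_zero _ ha) (zpow_ne_zero _ hb), ord_zpow, ord_zpow, hm, hn]
    apply le_of_eq; ring)
  rw [th, e, res_pow hl, chi_eq_one_iff]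
  exact IsSquare.sq _

end

variable (v) in
/-- nonsquare at `v` -/
def nsq (s : K) : Prop := ∃ g, g ≠ 0 ∧ v.th s g = -1

section
variable [Finite v.κ]

lemma th_odd_of_nsq {b c : K} (hb : b ≠ 0) (hc : c ≠ 0) (hbe : Even (v.ord b)) (hn : v.nsq b)
    (hco : Odd (v.ord c)) : v.th b c = -1 := by
  obtain ⟨g, hg, hbg⟩ := hn
  have hgo : Odd (v.ord g) := by
    by_contra h
    rw [Int.not_odd_iff_even] at h
    rw [th_even_even hb hg hbe h] at hbg; omega
  have e : c = (c / g) * g := by field_simp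
  rw [e, th_mul_right hb (div_ne_zero hc hg) hg, hbg, th_even_even hb (div_ne_zero hc hg) hbe]
  · norm_num
  · rw [v.ord_div hc hg]; exact hco.sub_odd hgo

/-- the criterion (ii) -/
lemma th_of_nsq {b c : K} (hb : b ≠ 0) (hc : c ≠ 0) (h1 : v.nsq b) (h2 : v.nsq c) (h3 : v.nsq (c * b))
    (h4 : v.nsq (-(c * b))) : v.th c b = -1 := by
  rcases Int.even_or_odd (v.ord b) with hbe | hbo
  · rcases Int.even_or_odd (v.ord c) with hce | hco
    · exfalso
      obtain ⟨g, hg, hgt⟩ := h3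
      rcases Int.even_or_odd (v.ord g) with hge | hgo
      · rw [th_even_even (mul_ne_zero hc hb) hg (by rw [v.ord_mul _ _ hc hb]; exact hce.add hbe) hge] at hgt
        omega
      · rw [th_mul_left hc hb hg, th_odd_of_nsq hc hg hce h2 hgo, th_odd_of_nsq hb hg hbe h1 hgo] at hgt
        omega
    · rw [th_symm hc hb]; exact th_odd_of_nsq hb hc hbe h1 hco
  · rcases Int.even_or_odd (v.ord c) with hce | hco
    · exact th_odd_of_nsq hc hb hce h2 hbo
    · have hcb := mul_ne_zero hc hb
      have h5 := th_odd_of_nsq (neg_ne_zero.2 hcb) hc (by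
        rw [ord_neg, v.ord_mul _ _ hc hb]; exact hco.add_odd hbo) h4 hco
      rw [th_symm (neg_ne_zero.2 hcb) hc, ← neg_mul, th_mul_right hc (neg_ne_zero.2 hc) hb,
        th_neg_self hc, one_mul] at h5
      exact h5

end
end Place

/-- norm values -/
def Nm {K : Type*} [Field K] (a b : K) : Prop := ∃ x y : K, b = x ^ 2 - a * y ^ 2

lemma th_of_Nm {K : Type*} [Field K] {v : Place K} [Finite v.κ] {a b : K} (ha : a ≠ 0) (hb : b ≠ 0)
    (h : Nm a b) : v.th a b = 1 := by
  obtain ⟨x, y, rfl⟩ := h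
  by_cases hy : y = 0
  · subst hy
    have hx : x ≠ 0 := by rintro rfl; simp at hb
    rw [show x ^ 2 - a * 0 ^ 2 = x ^ 2 by ring, Place.th_sq_right ha hx]
  by_cases hx : x = 0
  · subst hx
    rw [show (0:K) ^ 2 - a * y ^ 2 = (-a) * y ^ 2 by ring,
      Place.th_mul_right ha (neg_ne_zero.2 ha) (pow_ne_zero _ hy), Place.th_sq_right ha hy,
      Place.th_neg_self ha, one_mul]
  have hyx := div_ne_zero hy hx
  have e : x ^ 2 - a * y ^ 2 = x ^ 2 * (1 - a * (y / x) ^ 2) := by field_simp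
  have h1 : 1 - a * (y / x) ^ 2 ≠ 0 := by intro h0; rw [e, h0, mul_zero] at hb; exact hb rfl
  have h2 := Place.th_steinberg (v := v) (mul_ne_zero ha (pow_ne_zero 2 hyx)) h1
  rw [Place.th_mul_left ha (pow_ne_zero 2 hyx) h1, Place.th_sq_left hyx h1, mul_one] at h2
  rw [e, Place.th_mul_right ha (pow_ne_zero 2 hx) h1, h2, Place.th_sq_right ha hx, one_mul]


section glob
variable (F : Type*) {K : Type*} [Field F] [Field K] [Algebra F K] [Finite F] [GF F K] [NeZero (2 : F)]

include F

omit [Finite F] [GF F K] in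
lemma two_ne : (2 : K) ≠ 0 := by
  have : (2 : K) = algebraMap F K 2 := (map_ofNat _ 2).symm
  rw [this, _root_.map_ne_zero]; exact NeZero.ne _

omit [GF F K] in
lemma two_ne_κ (v : Place K) : (2 : v.κ) ≠ 0 := two_ne F

lemma exists_eps (v : Place K) : ∃ e : K, e ≠ 0 ∧ v.ord e = 0 ∧ ¬ IsSquare (v.res e) := by
  have := finite_κ (F := F) v
  have hc : ringChar v.κ ≠ 2 := by
    intro h
    apply two_ne_κ F v
    have := ringChar.Nat.cast_ringChar (R := v.κ)
    rw [h] at this; exact_mod_cast this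
  obtain ⟨c, hcs⟩ := FiniteField.exists_nonsquare hc
  obtain ⟨x, hx, rfl⟩ := v.res_surj c
  have h0 : v.res x ≠ 0 := by rintro h; rw [h] at hcs; exact hcs ⟨0, by simp⟩
  have := (Place.res_ne_zero_iff hx).1 h0
  exact ⟨x, this.1, this.2, hcs⟩

variable {F} in
lemma th_eps {v : Place K} {e g : K} (he : e ≠ 0) (h : v.ord e = 0) (hs : ¬ IsSquare (v.res e)) :
    v.th e g = if Even (v.ord g) then 1 else -1 := by
  have := finite_κ (F := F) v
  rw [Place.th_unit he h, chi_eq_neg_one_iff.2 hs]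

lemma nsq_of_odd {v : Place K} {s : K} (hs : Odd (v.ord s)) : v.nsq s := by
  have := finite_κ (F := F) v
  have hs0 : s ≠ 0 := by rintro rfl; rw [v.ord_zero] at hs; simp at hs
  obtain ⟨e, h1, h2, h3⟩ := exists_eps F v
  refine ⟨e, h1, ?_⟩
  rw [Place.th_symm hs0 h1, th_eps (F := F) h1 h2 h3, if_neg (Int.not_even_iff_odd.2 hs)]

lemma nsq_of_unit {v : Place K} {e : K} (he : e ≠ 0) (h : v.ord e = 0) (hs : ¬ IsSquare (v.res e)) :
    v.nsq e := by
  obtain ⟨p, hp, hp1⟩ := v.exists_ord 1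
  exact ⟨p, hp, by rw [th_eps (F := F) he h hs, hp1]; simp⟩

omit [NeZero (2 : F)] in
lemma finite_Delta {a b : K} (ha : a ≠ 0) (hb : b ≠ 0) : {v : Place K | v.th a b = -1}.Finite := by
  refine ((finite_support_ord (F := F) a).union (finite_support_ord (F := F) b)).subset ?_
  intro v hv
  have := finite_κ (F := F) v
  by_contra h
  simp only [Set.mem_union, Set.mem_ofPred_eq, not_or, not_not] at h hv
  rw [Place.th_even_even ha hb (by rw [h.1]; simp) (by rw [h.2]; simp)] at hv
  omega

lemma card_odd : Odd (Nat.card F) := by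
  have := Fintype.ofFinite F
  rw [Nat.card_eq_fintype_card]
  by_contra h
  rw [Nat.not_odd_iff_even, Nat.even_iff, ← FiniteField.even_card_iff_char_two] at h
  apply NeZero.ne (2 : F)
  have := ringChar.Nat.cast_ringChar (R := F)
  rw [h] at this; exact_mod_cast this

lemma isSquare_ext {k : Type*} [Field k] [Finite k] [Algebra F k] {u : F} (hu : ¬ IsSquare u) :
    IsSquare (algebraMap F k u) ↔ Even (Module.finrank F k) := by
  have := Fintype.ofFinite F
  have := Fintype.ofFinite k
  have h2 : (2 : k) ≠ 0 := two_ne F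
  have hu0 : u ≠ 0 := by rintro rfl; exact hu ⟨0, by simp⟩
  have hcF : ringChar F ≠ 2 := by
    intro h'
    apply NeZero.ne (2 : F)
    have := ringChar.Nat.cast_ringChar (R := F)
    rw [h'] at this; exact_mod_cast this
  have hck : ringChar k ≠ 2 := by
    intro h'
    apply h2
    have := ringChar.Nat.cast_ringChar (R := k)
    rw [h'] at this; exact_mod_cast this
  have hk0 : algebraMap F k u ≠ 0 := by rwa [_root_.map_ne_zero]
  rw [FiniteField.isSquare_iff hck hk0]
  have hm1 : u ^ (Fintype.card F / 2) = -1 :=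
    (FiniteField.pow_dichotomy hcF hu0).resolve_left (fun h => hu ((FiniteField.isSquare_iff hcF hu0).2 h))
  have hcard : Fintype.card k = Fintype.card F ^ Module.finrank F k := Module.card_eq_pow_finrank
  set d := Module.finrank F k
  set q := Fintype.card F
  have hq : Odd q := by have := card_odd F; rwa [Nat.card_eq_fintype_card] at this
  obtain ⟨m, hm⟩ := hq
  have e : Fintype.card k / 2 = (q / 2) * (∑ i ∈ Finset.range d, q ^ i) := by
    have h1 := Nat.geomSum_eq (m := q) (by
      rcases Nat.eq_zero_or_pos m with h | h
      · exfalso; have := Fintype.one_lt_card (α := F); change 1 < q at this; omega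
      · omega) d
    have h3 : (q - 1) * (∑ i ∈ Finset.range d, q ^ i) = q ^ d - 1 := by
      have := Nat.geomSum_eq (m := q) (by
        have := Fintype.one_lt_card (α := F); change 1 < q at this; omega) d
      rw [this]; exact Nat.mul_div_cancel' (by simpa using Nat.sub_dvd_pow_sub_pow q 1 d)
    rw [hcard]
    have h4 : q / 2 = m := by omega
    have h5 : q - 1 = 2 * m := by omega
    rw [h4]
    rw [h5, mul_assoc] at h3
    have h6 : 0 < q ^ d := by positivity
    omega
  rw [e, pow_mul, ← map_pow, hm1, map_neg, map_one]
  have hpar : Even (∑ i ∈ Finset.range d, q ^ i) ↔ Even d := by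
    have hqo : Odd q := ⟨m, hm⟩
    clear_value d
    clear e hcard
    induction d with
    | zero => simp
    | succ n ih =>
      rw [Finset.sum_range_succ, Nat.even_add, Nat.even_add_one]
      have : ¬ Even (q ^ n) := by rw [Nat.not_even_iff_odd]; exact hqo.pow
      tauto
  rw [← hpar]
  constructor
  · intro h
    by_contra hne
    rw [Nat.not_even_iff_odd] at hne
    rw [hne.neg_one_pow] at h
    apply h2
    linear_combination (-1 : k) * h
  · intro h; exact h.neg_one_pow

lemma isSquare_res_const (v : Place K) {u : F} (hu : ¬ IsSquare u) :
    IsSquare (v.res (algebraMap F K u)) ↔ Even (v.deg F) := by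
  have := finite_κ (F := F) v
  rw [← Place.algebraMap_κ]
  exact isSquare_ext F hu

lemma th_const (v : Place K) {u : F} (hu : ¬ IsSquare u) (x : K) :
    v.th (algebraMap F K u) x = if Even (v.ord x) ∨ Even (v.deg F) then 1 else -1 := by
  have := finite_κ (F := F) v
  have hu0 : u ≠ 0 := by rintro rfl; exact hu ⟨0, by simp⟩
  have hk0 : algebraMap F K u ≠ 0 := by rwa [_root_.map_ne_zero]
  rw [Place.th_unit hk0 (Place.ord_const v u), chi, isSquare_res_const F v hu]
  by_cases h1 : Even (v.ord x) <;> by_cases h2 : Even (v.deg F) <;> simp only [h1, h2] <;> simp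

end glob
end TAD

namespace TAD
open IntermediateField Polynomial

/-- data of a quadratic extension -/
structure QE (K L : Type*) [Field K] [Field L] [Algebra K L] (u : K) where
  s : L
  σ : L ≃ₐ[K] L
  hs : s ^ 2 = algebraMap K L u
  σs : σ s = -s
  gen : ∀ z : L, ∃ p : K × K, z = algebraMap K L p.1 + algebraMap K L p.2 * s
  two : (2 : K) ≠ 0
  u0 : u ≠ 0

lemma QE.aux {K : Type*} [Field K] {u : K} : (⟨0, -1⟩ : QuadraticAlgebra K u 0) * ⟨0, -1⟩ =
    u • 1 + (0 : K) • (⟨0, -1⟩ : QuadraticAlgebra K u 0) := by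
  have h1 : (1 : QuadraticAlgebra K u 0) = ⟨1, 0⟩ := rfl
  rw [h1]; ext <;> simp

/-- the concrete quadratic extension -/
noncomputable def QE.mk' {K : Type*} [Field K] {u : K} (h2 : (2 : K) ≠ 0) (hu : ¬ IsSquare u)
    [Fact (∀ r, r ^ 2 ≠ u + 0 * r)] : QE K (QuadraticAlgebra K u 0) u where
  s := ⟨0, 1⟩
  σ := AlgEquiv.ofAlgHom (QuadraticAlgebra.lift ⟨⟨0, -1⟩, QE.aux⟩)
    (QuadraticAlgebra.lift ⟨⟨0, -1⟩, QE.aux⟩)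
    (by ext <;> simp [QuadraticAlgebra.lift]) (by ext <;> simp [QuadraticAlgebra.lift])
  hs := by rw [pow_two, QuadraticAlgebra.algebraMap_eq]; ext <;> simp
  σs := by simp [QuadraticAlgebra.lift]
  gen := fun z => ⟨(z.re, z.im), by
    rw [QuadraticAlgebra.algebraMap_eq, QuadraticAlgebra.algebraMap_eq]; ext <;> simp⟩
  two := h2
  u0 := by rintro rfl; exact hu ⟨0, by simp⟩

lemma fact_of_nsq {K : Type*} [Field K] {u : K} (hu : ¬ IsSquare u) : Fact (∀ r, r ^ 2 ≠ u + 0 * r) :=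
  ⟨fun r h => hu ⟨r, by rw [← pow_two, h]; ring⟩⟩

namespace QE
variable {K L : Type*} [Field K] [Field L] [Algebra K L] {u : K} (Q : QE K L u)

include Q in
lemma two' : (2 : L) ≠ 0 := by
  have : (2 : L) = algebraMap K L 2 := (map_ofNat _ 2).symm
  rw [this, _root_.map_ne_zero]; exact Q.two

lemma s0 : Q.s ≠ 0 := by
  intro h
  have := Q.hs
  rw [h, zero_pow two_ne_zero] at this
  exact Q.u0 ((map_eq_zero (algebraMap K L)).1 this.symm)

/-- first coordinate -/
noncomputable def re (z : L) : K := (Q.gen z).choose.1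
/-- second coordinate -/
noncomputable def im (z : L) : K := (Q.gen z).choose.2
lemma eq (z : L) : z = algebraMap K L (Q.re z) + algebraMap K L (Q.im z) * Q.s := (Q.gen z).choose_spec
lemma σ_eq (z : L) : Q.σ z = algebraMap K L (Q.re z) - algebraMap K L (Q.im z) * Q.s := by
  conv_lhs => rw [Q.eq z]
  rw [map_add, map_mul, Q.σs, AlgEquiv.commutes, AlgEquiv.commutes]; ring

lemma re_eq (z : L) : algebraMap K L (Q.re z) = (z + Q.σ z) / 2 := by
  have h1 := Q.σ_eq z
  have h2 := Q.eq z
  rw [eq_div_iff Q.two']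
  linear_combination -h1 - h2

lemma σσ (z : L) : Q.σ (Q.σ z) = z := by
  rw [Q.σ_eq z, map_sub, map_mul, Q.σs, AlgEquiv.commutes, AlgEquiv.commutes]
  conv_rhs => rw [Q.eq z]
  ring

lemma eq_of_fixed {z : L} (h : Q.σ z = z) : ∃ x : K, z = algebraMap K L x := by
  refine ⟨Q.re z, ?_⟩
  rw [Q.re_eq, h]
  have := Q.two'
  field_simp; ring

/-- norm -/
noncomputable def nrm (z : L) : K := Q.re z ^ 2 - u * Q.im z ^ 2

lemma alg_nrm (z : L) : algebraMap K L (Q.nrm z) = z * Q.σ z := by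
  have h1 := Q.σ_eq z
  have h2 := Q.eq z
  rw [nrm, map_sub, map_mul, map_pow, map_pow, ← Q.hs]
  linear_combination (-algebraMap K L (Q.re z) - algebraMap K L (Q.im z) * Q.s) * h1 - Q.σ z * h2

lemma Nm_nrm (z : L) : Nm u (Q.nrm z) := ⟨_, _, rfl⟩

lemma nrm_mul (z z' : L) : Q.nrm (z * z') = Q.nrm z * Q.nrm z' := by
  apply (algebraMap K L).injective
  rw [map_mul, alg_nrm, alg_nrm, alg_nrm, map_mul]; ring

lemma nrm_ne {z : L} (h : z ≠ 0) : Q.nrm z ≠ 0 := by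
  rw [← _root_.map_ne_zero (algebraMap K L), alg_nrm]
  exact mul_ne_zero h (by simpa using h)

include Q in
lemma fd : FiniteDimensional K L := by
  refine Module.Finite.of_surjective (R := K) (M := K × K) (P := L) (σ := RingHom.id K)
    { toFun := fun p => algebraMap K L p.1 + algebraMap K L p.2 * Q.s
      map_add' := ?_
      map_smul' := ?_ } ?_
  · intro p q; simp; ring
  · intro c p; simp [Algebra.smul_def]; ring
  · intro z; obtain ⟨p, hp⟩ := Q.gen z; exact ⟨p, hp.symm⟩

/-- action on places -/
noncomputable def act (w : Place L) : Place L where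
  ord z := w.ord (Q.σ z)
  ord_zero := by simp [w.ord_zero]
  ord_mul x y hx hy := by rw [map_mul, w.ord_mul _ _ (by simpa using hx) (by simpa using hy)]
  ord_add := by
    intro x y hx hy hxy
    rw [map_add]
    exact w.ord_add _ _ (by simpa using hx) (by simpa using hy) (by rw [← map_add]; exact (_root_.map_ne_zero Q.σ).2 hxy)
  ord_surj := by
    obtain ⟨p, hp, h⟩ := w.ord_surj
    exact ⟨Q.σ p, by simpa using hp, by rw [Q.σσ]; exact h⟩

@[simp] lemma act_ord (w : Place L) (z : L) : (Q.act w).ord z = w.ord (Q.σ z) := rfl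
lemma act_le {w : Place L} {n : ℤ} {z : L} : (Q.act w).le n z ↔ w.le n (Q.σ z) := by
  unfold Place.le; simp

lemma place_ext {M : Type*} [Field M] {w w' : Place M} (h : ∀ z, w.ord z = w'.ord z) : w = w' := by
  apply Place.eq_of_le
  intro x hx
  unfold Place.le at *; rwa [← h]

@[simp] lemma act_act (w : Place L) : Q.act (Q.act w) = w := place_ext fun z => by simp [Q.σσ]

lemma act_above {w : Place L} {v : Place K} {e : ℤ} (h : Above w v e) : Above (Q.act w) v e :=
  ⟨h.1, fun x => by rw [act_ord, AlgEquiv.commutes, h.2]⟩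

end QE

namespace Above
variable {K L : Type*} [Field K] [Field L] [Algebra K L] {w : Place L} {v : Place K} {e : ℤ}

/-- embedding of residue fields -/
lemma exists_map (h : Above w v e) : ∃ f : v.κ →+* w.κ, ∀ x, v.le 0 x → f (v.res x) = w.res (algebraMap K L x) := by
  let g : v.O →+* w.O := ((algebraMap K L).comp v.O.subtype).codRestrict w.O.toSubring (fun x => h.le_iff.2 x.2)
  have : IsLocalHom g := by
    refine ⟨fun a ha => ?_⟩
    obtain ⟨a, ha'⟩ := a
    have hg : g ⟨a, ha'⟩ = ⟨algebraMap K L a, h.le_iff.2 ha'⟩ := rfl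
    rw [hg, Place.isUnit_iff] at ha
    refine (Place.isUnit_iff ha').2 ?_
    refine ⟨by simpa using ha.1, ?_⟩
    have := ha.2
    rw [h.2] at this
    exact (mul_eq_zero.1 this).resolve_left h.1.ne'
  refine ⟨IsLocalRing.ResidueField.map g, fun x hx => ?_⟩
  rw [Place.res_def hx, Place.res_def (h.le_iff.2 hx), IsLocalRing.ResidueField.map_residue]
  rfl

end Above
end TAD

namespace TAD
open IntermediateField Polynomial

namespace QE
section
variable {F K L : Type*} [Field F] [Finite F] [NeZero (2 : F)] [Field K] [Field L] [Algebra K L]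
  [Algebra F K] [Algebra F L] [IsScalarTower F K L] [GF F K] [GF F L] {u : F}
  (Q : QE K L (algebraMap F K u))

lemma ord_two (F : Type*) {L : Type*} [Field F] [Finite F] [NeZero (2 : F)] [Field L] [Algebra F L]
    (w : Place L) : w.ord (2 : L) = 0 := by
  have : (2 : L) = algebraMap F L 2 := (map_ofNat _ 2).symm
  rw [this]; exact w.ord_const _

include Q

lemma ord_s (w : Place L) : w.ord Q.s = 0 := by
  have h := congrArg w.ord Q.hs
  rw [w.ord_pow, ← IsScalarTower.algebraMap_apply F K L, w.ord_const] at h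
  simpa using h

lemma le_two {w : Place L} {n : ℤ} {z : L} : w.le n (2 * z) ↔ w.le n z := by
  unfold Place.le
  by_cases hz : z = 0
  · simp [hz]
  · rw [w.ord_mul _ _ Q.two' hz, ord_two F w]; simp [Q.two']

lemma le_mul_s {w : Place L} {n : ℤ} {z : L} : w.le n (z * Q.s) ↔ w.le n z := by
  unfold Place.le
  by_cases hz : z = 0
  · simp [hz]
  · rw [w.ord_mul _ _ hz Q.s0, ord_s]; simp [Q.s0]

/-- coordinates at a fixed place -/
lemma le_coord {w : Place L} (hw : Q.act w = w) {n : ℤ} {x y : K}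
    (h : w.le n (algebraMap K L x + algebraMap K L y * Q.s)) :
    w.le n (algebraMap K L x) ∧ w.le n (algebraMap K L y) := by
  have h2 : w.le n (algebraMap K L x - algebraMap K L y * Q.s) := by
    have h3 : (Q.act w).le n (algebraMap K L x + algebraMap K L y * Q.s) := by rw [hw]; exact h
    rw [Q.act_le, map_add, map_mul, Q.σs, AlgEquiv.commutes, AlgEquiv.commutes] at h3
    rwa [mul_neg, ← sub_eq_add_neg] at h3
  constructor
  · rw [← Q.le_two]
    have := h.add h2
    ring_nf at this ⊢; exact this
  · rw [← Q.le_mul_s, ← Q.le_two]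
    have := h.sub h2
    ring_nf at this ⊢; exact this

lemma e_one {w : Place L} {v : Place K} {e : ℤ} (h : Above w v e) : e = 1 := by
  classical
  obtain ⟨p, hp, hp1⟩ := w.ord_surj
  by_cases hw : Q.act w = w
  · have h1 : w.le 1 (algebraMap K L (Q.re p) + algebraMap K L (Q.im p) * Q.s) := by
      rw [← Q.eq]; exact Or.inr hp1.ge
    obtain ⟨hx, hy⟩ := Q.le_coord hw h1
    have key : ∀ x : K, w.le 1 (algebraMap K L x) → w.le e (algebraMap K L x) := by
      intro x hx
      rw [h.le_iff1] at hx
      rcases hx with rfl | hx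
      · left; simp
      · right; rw [h.2]; nlinarith [h.1]
    have h2 := (key _ hx).add ((Q.le_mul_s).2 (key _ hy))
    rw [← Q.eq, Place.le_iff hp] at h2
    have := h.1
    omega
  · obtain ⟨z, hz⟩ := Place.weak_approx {w, Q.act w} (fun x => if x = w then p else 1) 2
    have h1 := hz w (by simp)
    have h2 := hz (Q.act w) (by simp)
    rw [if_pos rfl] at h1
    rw [if_neg hw] at h2
    obtain ⟨z0, hz1⟩ := Place.ord_eq_of_sub hp (by rw [hp1]; exact h1)
    have hz2 := (Place.ord_eq_of_sub (v := Q.act w) one_ne_zero (by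
      rw [Place.ord_one]; exact h2.mono (by norm_num))).2
    rw [Q.act_ord, Place.ord_one] at hz2
    have h3 := h.2 (Q.nrm z)
    rw [Q.alg_nrm, w.ord_mul _ _ z0 (by simpa using z0), hz1, hz2, hp1] at h3
    have := Int.eq_one_or_neg_one_of_mul_eq_one (by simpa using h3.symm)
    have := h.1
    omega

lemma fiber {w w' : Place L} {v : Place K} {e e' : ℤ} (h : Above w v e) (h' : Above w' v e') :
    w' = w ∨ w' = Q.act w := by
  classical
  by_contra hne
  push Not at hne
  have hne2 : ¬ (Q.act w' = w ∨ Q.act w' = Q.act w) := by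
    rintro (h1 | h1)
    · apply hne.2; rw [← h1, Q.act_act]
    · apply hne.1; rw [← Q.act_act w', h1, Q.act_act]
  obtain ⟨z, hz⟩ := Place.weak_approx {w, Q.act w, w', Q.act w'}
    (fun x => if x = w ∨ x = Q.act w then 0 else 1) 1
  have h1 := hz w (by simp)
  have h2 := hz (Q.act w) (by simp)
  have h3 := hz w' (by simp)
  have h4 := hz (Q.act w') (by simp)
  rw [if_pos (by simp), sub_zero] at h1 h2
  rw [if_neg (by simp [hne])] at h3
  rw [if_neg hne2] at h4
  rw [Q.act_le] at h2
  have h5 : w'.le 1 (algebraMap K L (Q.nrm z)) := by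
    rw [h'.le_iff1, ← h.le_iff1, Q.alg_nrm]
    exact (h1.mul h2).mono (by norm_num)
  have h6 := (Place.ord_eq_of_sub (v := w') one_ne_zero (by rw [Place.ord_one]; simpa using h3))
  have h7 := (Place.ord_eq_of_sub (v := Q.act w') one_ne_zero (by rw [Place.ord_one]; simpa using h4))
  rw [Q.act_ord, Place.ord_one] at h7
  rw [Place.ord_one] at h6
  rw [Q.alg_nrm, Place.le_iff (mul_ne_zero h6.1 (by simpa using h6.1)),
    w'.ord_mul _ _ h6.1 (by simpa using h6.1), h6.2, h7.2] at h5
  omega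

lemma surj_of_ne {w : Place L} (hw : Q.act w ≠ w) {v : Place K} {e : ℤ} (h : Above w v e) (c : w.κ) :
    ∃ x : K, v.le 0 x ∧ w.res (algebraMap K L x) = c := by
  classical
  obtain ⟨z, hz, rfl⟩ := w.res_surj c
  obtain ⟨y, hy⟩ := Place.weak_approx {w, Q.act w} (fun x => if x = w then z else 0) 1
  have h1 := hy w (by simp)
  have h2 := hy (Q.act w) (by simp)
  rw [if_pos rfl] at h1
  rw [if_neg hw, sub_zero, Q.act_le] at h2
  have e1 : algebraMap K L (2 * Q.re y) = y + Q.σ y := by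
    rw [map_mul, Q.re_eq, map_ofNat]; field_simp [Q.two']
  have e2 : w.le 1 (algebraMap K L (2 * Q.re y) - z) := by
    rw [e1]; have := h1.add h2; ring_nf at this ⊢; exact this
  have e3 : w.le 0 (algebraMap K L (2 * Q.re y)) := by
    have := (e2.mono (m := 0) (by norm_num)).add hz; ring_nf at this ⊢; exact this
  exact ⟨2 * Q.re y, h.le_iff.1 e3, (Place.res_eq_iff e3 hz).2 e2⟩

lemma card_of_ne {w : Place L} (hw : Q.act w ≠ w) {v : Place K} {e : ℤ} (h : Above w v e) :
    Nat.card w.κ = Nat.card v.κ := by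
  obtain ⟨f, hf⟩ := h.exists_map
  refine (Nat.card_eq_of_bijective f ⟨f.injective, fun c => ?_⟩).symm
  obtain ⟨x, hx, rfl⟩ := Q.surj_of_ne hw h c
  exact ⟨v.res x, hf x hx⟩

lemma card_of_eq {w : Place L} (hw : Q.act w = w) {v : Place K} {e : ℤ} (h : Above w v e) :
    Nat.card w.κ = Nat.card v.κ ^ 2 := by
  obtain ⟨f, hf⟩ := h.exists_map
  have ls : w.le 0 Q.s := Or.inr (Q.ord_s w).ge
  let g : v.κ × v.κ →+ w.κ :=
    { toFun := fun p => f p.1 + f p.2 * w.res Q.s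
      map_zero' := by simp
      map_add' := by intro p q; simp; ring }
  have hg : Function.Bijective g := by
    constructor
    · rw [injective_iff_map_eq_zero]
      rintro ⟨a, b⟩ hab
      obtain ⟨x, hx, rfl⟩ := v.res_surj a
      obtain ⟨y, hy, rfl⟩ := v.res_surj b
      change f _ + f _ * _ = 0 at hab
      have lx := h.le_iff.2 hx
      have ly := h.le_iff.2 hy
      rw [hf _ hx, hf _ hy, ← Place.res_mul ly ls, ← Place.res_add lx (ly.mul0 ls),
        Place.res_eq_zero_iff (lx.add (ly.mul0 ls))] at hab
      have := Q.le_coord hw hab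
      rw [h.le_iff1, h.le_iff1] at this
      rw [(Place.res_eq_zero_iff hx).2 this.1, (Place.res_eq_zero_iff hy).2 this.2]; rfl
    · intro c
      obtain ⟨z, hz, rfl⟩ := w.res_surj c
      have h1 := hz
      rw [Q.eq z] at h1
      have := Q.le_coord hw h1
      refine ⟨(v.res (Q.re z), v.res (Q.im z)), ?_⟩
      change f _ + f _ * _ = _
      rw [hf _ (h.le_iff.1 this.1), hf _ (h.le_iff.1 this.2), ← Place.res_mul this.2 ls,
        ← Place.res_add this.1 (this.2.mul0 ls), ← Q.eq]
  rw [← Nat.card_eq_of_bijective g hg, Nat.card_prod, pow_two]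

lemma card_F_gt : 1 < Nat.card F := Finite.one_lt_card

lemma deg_of_ne {w : Place L} (hw : Q.act w ≠ w) {v : Place K} {e : ℤ} (h : Above w v e) :
    w.deg F = v.deg F := by
  have := Q.card_of_ne hw h
  rw [Place.card_κ (F := F), Place.card_κ (F := F)] at this
  exact Nat.pow_right_injective (Q.card_F_gt) this

lemma deg_of_eq {w : Place L} (hw : Q.act w = w) {v : Place K} {e : ℤ} (h : Above w v e) :
    w.deg F = 2 * v.deg F := by
  have := Q.card_of_eq hw h
  rw [Place.card_κ (F := F), Place.card_κ (F := F), ← pow_mul, mul_comm] at this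
  exact Nat.pow_right_injective (Q.card_F_gt) this

lemma act_eq_iff {w : Place L} {v : Place K} {e : ℤ} (h : Above w v e) (hu : ¬ IsSquare u) :
    Q.act w = w ↔ Odd (v.deg F) := by
  have ls : w.le 0 Q.s := Or.inr (Q.ord_s w).ge
  have lu := Place.le_const v u
  obtain ⟨f, hf⟩ := h.exists_map
  constructor
  · intro hw
    by_contra ho
    rw [Nat.not_odd_iff_even, ← isSquare_res_const F v hu] at ho
    obtain ⟨c, hc⟩ := ho
    obtain ⟨x, hx, rfl⟩ := v.res_surj c
    have lx := h.le_iff.2 hx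
    have h1 := congrArg f hc
    rw [map_mul, hf _ lu, hf _ hx, ← Q.hs, Place.res_pow ls, ← pow_two] at h1
    have h2 : (w.res Q.s - w.res (algebraMap K L x)) * (w.res Q.s + w.res (algebraMap K L x)) = 0 := by
      linear_combination h1
    have hone : ¬ w.le 1 (algebraMap K L 1) := by
      rw [map_one, Place.le_iff one_ne_zero, Place.ord_one]; norm_num
    rcases mul_eq_zero.1 h2 with h3 | h3
    · rw [← Place.res_sub ls lx, Place.res_eq_zero_iff (ls.sub lx)] at h3
      exact hone (Q.le_coord (x := -x) (y := 1) hw (by rw [map_neg, map_one]; ring_nf at h3 ⊢; exact h3)).2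
    · rw [← Place.res_add ls lx, Place.res_eq_zero_iff (ls.add lx)] at h3
      exact hone (Q.le_coord (x := x) (y := 1) hw (by rw [map_one]; ring_nf at h3 ⊢; exact h3)).2
  · intro ho
    by_contra hw
    rw [← Nat.not_even_iff_odd, ← isSquare_res_const F v hu] at ho
    apply ho
    obtain ⟨x, hx, hxs⟩ := Q.surj_of_ne hw h (w.res Q.s)
    refine ⟨v.res x, ?_⟩
    apply f.injective
    rw [map_mul, hf _ hx, hf _ lu, hxs, ← Q.hs, Place.res_pow ls, pow_two]

end
end QE
end TAD

namespace TAD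
open IntermediateField Polynomial

namespace QE
section
variable {F K L : Type*} [Field F] [Finite F] [NeZero (2 : F)] [Field K] [Field L] [Algebra K L]
  [Algebra F K] [Algebra F L] [IsScalarTower F K L] [GF F K] [GF F L] {u : F}
  (Q : QE K L (algebraMap F K u))

include Q

lemma exists_dn (w : Place L) : ∃ v : Place K, Above w v 1 := by
  have := Q.fd
  obtain ⟨v, e, h⟩ := exists_restrict (K := K) w
  have := Q.e_one h
  subst this; exact ⟨v, h⟩

lemma exists_up (v : Place K) : ∃ w : Place L, Above w v 1 := by
  have := Q.fd
  obtain ⟨w, e, h⟩ := exists_above (F := F) (L := L) v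
  have := Q.e_one h
  subst this; exact ⟨w, h⟩

/-- place below -/
noncomputable def dn (w : Place L) : Place K := (Q.exists_dn w).choose
/-- a place above -/
noncomputable def up (v : Place K) : Place L := (Q.exists_up v).choose
lemma above_dn (w : Place L) : Above w (Q.dn w) 1 := (Q.exists_dn w).choose_spec
lemma above_up (v : Place K) : Above (Q.up v) v 1 := (Q.exists_up v).choose_spec
@[simp] lemma dn_up (v : Place K) : Q.dn (Q.up v) = v := (Q.above_dn _).unique (Q.above_up v)
@[simp] lemma dn_act (w : Place L) : Q.dn (Q.act w) = Q.dn w :=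
  (Q.above_dn _).unique (Q.act_above (Q.above_dn w))
lemma up_dn (w : Place L) : Q.up (Q.dn w) = w ∨ Q.up (Q.dn w) = Q.act w :=
  Q.fiber (Q.above_dn w) (Q.above_up _)
lemma dn_eq {w w' : Place L} (h : Q.dn w = Q.dn w') : w' = w ∨ w' = Q.act w :=
  Q.fiber (Q.above_dn w) (by rw [h]; exact Q.above_dn w')

lemma deg_act (w : Place L) : (Q.act w).deg F = w.deg F := by
  by_cases h : Q.act w = w
  · rw [h]
  · rw [Q.deg_of_ne h (Q.above_dn w), Q.deg_of_ne (by rw [Q.act_act]; exact Ne.symm h) (Q.act_above (Q.above_dn w))]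

/-- pullback of divisors -/
noncomputable def j (D : Dv K) : Dv L := Finsupp.ofSupportFinite (fun w => D (Q.dn w)) (by
  refine ((D.support.finite_toSet.image Q.up).union (D.support.finite_toSet.image fun v => Q.act (Q.up v))).subset ?_
  intro w hw
  have hw' : Q.dn w ∈ (D.support : Set (Place K)) := by simpa using hw
  rcases Q.up_dn w with h | h
  · exact Or.inl ⟨_, hw', h⟩
  · exact Or.inr ⟨_, hw', by simp [h]⟩)
@[simp] lemma j_apply (D : Dv K) (w : Place L) : Q.j D w = D (Q.dn w) := rfl

/-- conjugation of divisors -/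
noncomputable def sg : Dv L →+ Dv L where
  toFun D := Finsupp.ofSupportFinite (fun w => D (Q.act w)) (by
    refine (D.support.finite_toSet.image Q.act).subset ?_
    intro w hw
    exact ⟨Q.act w, by simpa using hw, by simp⟩)
  map_zero' := by ext; rfl
  map_add' _ _ := by ext; rfl
@[simp] lemma sg_apply (D : Dv L) (w : Place L) : Q.sg D w = D (Q.act w) := rfl
@[simp] lemma sg_sg (D : Dv L) : Q.sg (Q.sg D) = D := by ext; simp

lemma j_add (D D' : Dv K) : Q.j (D + D') = Q.j D + Q.j D' := by ext; simp
lemma j_zero : Q.j 0 = 0 := by ext; simp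
lemma j_inj {D D' : Dv K} (h : Q.j D = Q.j D') : D = D' := by
  ext v
  have := DFunLike.congr_fun h (Q.up v)
  simpa using this

lemma divi_alg (x : K) : divi F (algebraMap K L x) = Q.j (divi F x) := by
  ext w; simp [(Q.above_dn w).2]
lemma divi_σ (z : L) : divi F (Q.σ z) = Q.sg (divi F z) := by
  ext w; simp
lemma divi_nrm {z : L} (hz : z ≠ 0) : Q.j (divi F (Q.nrm z)) = divi F z + Q.sg (divi F z) := by
  rw [← divi_alg, Q.alg_nrm, divi_mul F hz (by simpa using hz), divi_σ]

lemma exists_j {D : Dv L} (h : Q.sg D = D) : ∃ D0, D = Q.j D0 := by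
  refine ⟨Finsupp.ofSupportFinite (fun v => D (Q.up v)) ?_, ?_⟩
  · refine (D.support.finite_toSet.image Q.dn).subset ?_
    intro v hv
    exact ⟨Q.up v, by simpa using hv, by simp⟩
  · ext w
    rw [j_apply]
    change D w = D (Q.up (Q.dn w))
    rcases Q.up_dn w with h1 | h1 <;> rw [h1]
    rw [← Q.sg_apply, h]

lemma deg_sg (D : Dv L) : degD F (Q.sg D) = degD F D := by
  induction D using Finsupp.induction_linear with
  | zero => simp
  | add f g hf hg => rw [map_add, map_add, map_add, hf, hg]
  | single w n =>
    have : Q.sg (Finsupp.single w n) = Finsupp.single (Q.act w) n := by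
      classical
      ext w'
      rw [sg_apply, Finsupp.single_apply, Finsupp.single_apply]
      congr 1
      exact propext ⟨fun h => by rw [h, Q.act_act], fun h => by rw [← h, Q.act_act]⟩
    rw [this, degD_single, degD_single, Q.deg_act]

lemma deg_j (D : Dv K) : degD F (Q.j D) = 2 * degD F D := by
  classical
  induction D using Finsupp.induction_linear with
  | zero => rw [j_zero]; simp
  | add f g hf hg => rw [j_add, map_add, map_add, hf, hg]; ring
  | single v n =>
    have hdn : ∀ w, v = Q.dn w ↔ (w = Q.up v ∨ w = Q.act (Q.up v)) := by
      intro w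
      constructor
      · intro h; exact Q.dn_eq (by simpa using h)
      · rintro (rfl | rfl) <;> simp
    by_cases h : Q.act (Q.up v) = Q.up v
    · have : Q.j (Finsupp.single v n) = Finsupp.single (Q.up v) n := by
        ext w
        rw [j_apply, Finsupp.single_apply, Finsupp.single_apply]
        congr 1
        rw [hdn, h, or_self]; exact propext eq_comm
      rw [this, degD_single, degD_single, Q.deg_of_eq h (Q.above_up v)]
      push_cast; ring
    · have : Q.j (Finsupp.single v n) = Finsupp.single (Q.up v) n + Finsupp.single (Q.act (Q.up v)) n := by
        ext w
        rw [j_apply, Finsupp.add_apply, Finsupp.single_apply, Finsupp.single_apply, Finsupp.single_apply]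
        simp only [hdn]
        by_cases h1 : w = Q.up v
        · subst h1; simp [h]
        · by_cases h2 : w = Q.act (Q.up v)
          · subst h2; simp [Ne.symm h]
          · simp [h1, h2, Ne.symm h1, Ne.symm h2]
      rw [this, map_add, degD_single, degD_single, degD_single, Q.deg_act, Q.deg_of_ne h (Q.above_up v)]
      ring

lemma exists_half (hu : ¬ IsSquare u) {D : Dv K} (hD : D ∈ evenDiv F K) : ∃ E : Dv L, Q.j D = E + Q.sg E := by
  classical
  refine ⟨Finsupp.ofSupportFinite (fun w => if Q.act w = w then D (Q.dn w) / 2 else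
    if w = Q.up (Q.dn w) then D (Q.dn w) else 0) ?_, ?_⟩
  · refine (Q.j D).support.finite_toSet.subset ?_
    intro w hw
    rw [Finset.mem_coe, Finsupp.mem_support_iff, j_apply]
    intro h
    apply hw
    simp [h]
  · ext w
    rw [j_apply, Finsupp.add_apply, sg_apply]
    simp only [Finsupp.ofSupportFinite_coe, Q.act_act, Q.dn_act]
    by_cases h : Q.act w = w
    · rw [if_pos h, if_pos h.symm]
      have := hD (Q.dn w) ((Q.act_eq_iff (Q.above_dn w) hu).1 h)
      obtain ⟨m, hm⟩ := this
      omega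
    · rw [if_neg h, if_neg (Ne.symm h)]
      rcases Q.up_dn w with h1 | h1
      · rw [h1, if_pos rfl, if_neg h, add_zero]
      · rw [h1, if_neg (Ne.symm h), if_pos rfl, zero_add]

end
end QE
end TAD

namespace TAD
open IntermediateField Polynomial

lemma finite_group_lemma {G : Type*} [AddCommGroup G] [Finite G] (σ : G →+ G) (hσ : ∀ g, σ (σ g) = g)
    (hfix : ∀ g, σ g = g → ∃ e, g = e + σ e) (g : G) (hg : g + σ g = 0) : ∃ f, g = f - σ f := by
  let A : G →+ G := AddMonoidHom.id G - σ
  let B : G →+ G := AddMonoidHom.id G + σ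
  have hA : ∀ x, A x = x - σ x := fun x => rfl
  have hB : ∀ x, B x = x + σ x := fun x => rfl
  have h1 : A.range ≤ B.ker := by
    rintro _ ⟨x, rfl⟩
    rw [AddMonoidHom.mem_ker, hA, hB, map_sub, hσ]; abel
  have h2 : A.ker ≤ B.range := by
    intro x hx
    rw [AddMonoidHom.mem_ker, hA, sub_eq_zero] at hx
    obtain ⟨e, he⟩ := hfix x hx.symm
    exact ⟨e, by rw [hB, ← he]⟩
  have c1 : Nat.card A.ker * Nat.card A.range = Nat.card G := by
    rw [← AddSubgroup.index_ker]; exact A.ker.card_mul_index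
  have c2 : Nat.card B.ker * Nat.card B.range = Nat.card G := by
    rw [← AddSubgroup.index_ker]; exact B.ker.card_mul_index
  have c3 : Nat.card A.ker ≤ Nat.card B.range := Nat.card_mono (Set.toFinite _) h2
  have c4 : Nat.card A.range ≤ Nat.card B.ker := Nat.card_mono (Set.toFinite _) h1
  have c5 : Nat.card B.ker ≤ Nat.card A.range := by
    have p : 0 < Nat.card A.ker := Nat.card_pos
    have : Nat.card A.ker * Nat.card B.ker ≤ Nat.card A.ker * Nat.card A.range := by
      rw [c1, ← c2, mul_comm]; exact Nat.mul_le_mul_left _ c3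
    exact Nat.le_of_mul_le_mul_left this p
  have h3 : A.range = B.ker := by
    apply SetLike.coe_injective
    exact Set.eq_of_subset_of_ncard_le h1 c5 (Set.toFinite _)
  have : g ∈ A.range := by rw [h3, AddMonoidHom.mem_ker, hB, hg]
  obtain ⟨f, hf⟩ := this
  exact ⟨f, by rw [← hf, hA]⟩

namespace QE
section
variable {F K L : Type*} [Field F] [Finite F] [NeZero (2 : F)] [Field K] [Field L] [Algebra K L]
  [Algebra F K] [Algebra F L] [IsScalarTower F K L] [GF F K] [GF F L] {u : F}
  (Q : QE K L (algebraMap F K u))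

include Q

lemma sg_princ {D : Dv L} (h : D ∈ princ F L) : Q.sg D ∈ princ F L := by
  obtain ⟨x, hx, rfl⟩ := h
  exact ⟨Q.σ x, by simpa using hx, Q.divi_σ x⟩

lemma group_step (H : ∀ D : Dv L, degD F D = 0 → Q.sg D - D ∈ princ F L →
      ∃ E : Dv L, degD F E = 0 ∧ D - (E + Q.sg E) ∈ princ F L) (E : Dv L) (hE : degD F E = 0)
    (hE1 : E + Q.sg E ∈ princ F L) :
    ∃ A : Dv L, degD F A = 0 ∧ E - (A - Q.sg A) ∈ princ F L := by
  let P : AddSubgroup (Dv L) := (degD F (K := L)).ker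
  let R : AddSubgroup P := (princ F L).addSubgroupOf P
  have hmk : ∀ a b : P, (QuotientAddGroup.mk a : P ⧸ R) = QuotientAddGroup.mk b ↔ (b - a : Dv L) ∈ princ F L := by
    intro a b
    rw [QuotientAddGroup.eq, AddSubgroup.mem_addSubgroupOf]
    simp [sub_eq_neg_add]
  have : Finite (P ⧸ R) := by
    obtain ⟨S, hS, h⟩ := finite_pic0 (F := F) (K := L)
    have hf : ∀ g : P ⧸ R, ∃ E ∈ S, ∃ D : P, QuotientAddGroup.mk D = g ∧ (D - E : Dv L) ∈ princ F L := by
      intro g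
      obtain ⟨D, rfl⟩ := QuotientAddGroup.mk_surjective g
      obtain ⟨E, hE, hD⟩ := h D D.2
      exact ⟨E, hE, D, rfl, hD⟩
    choose f hf1 D hD1 hD2 using hf
    have := hS.to_subtype
    refine Finite.of_injective (β := S) (fun g => ⟨f g, hf1 g⟩) ?_
    intro g g' hgg
    have hgg' : f g = f g' := congrArg Subtype.val hgg
    rw [← hD1 g, ← hD1 g', hmk]
    have := (princ F L).sub_mem (hD2 g') (hD2 g)
    rw [hgg'] at this
    simpa using this
  let τ : P →+ P := (Q.sg.comp P.subtype).codRestrict P (fun D => by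
    show degD F (Q.sg D) = 0
    rw [Q.deg_sg]; exact D.2)
  have hτ : ∀ D : P, (τ D : Dv L) = Q.sg D := fun D => rfl
  let σ : P ⧸ R →+ P ⧸ R := QuotientAddGroup.map R R τ (by
    intro D hD
    exact Q.sg_princ (AddSubgroup.mem_addSubgroupOf.1 hD))
  have hσ : ∀ D : P, σ (QuotientAddGroup.mk D) = QuotientAddGroup.mk (τ D) := fun D => rfl
  obtain ⟨f, hf⟩ := finite_group_lemma σ (by
      intro g
      obtain ⟨D, rfl⟩ := QuotientAddGroup.mk_surjective g
      rw [hσ, hσ]; congr 1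
      apply Subtype.ext
      rw [hτ, hτ, Q.sg_sg]) (by
      intro g hg
      obtain ⟨D, rfl⟩ := QuotientAddGroup.mk_surjective g
      rw [hσ, eq_comm, hmk] at hg
      obtain ⟨E, hE, hDE⟩ := H D D.2 hg
      refine ⟨QuotientAddGroup.mk ⟨E, hE⟩, ?_⟩
      rw [hσ, ← QuotientAddGroup.mk_add, eq_comm, hmk]
      exact hDE) (QuotientAddGroup.mk ⟨E, hE⟩) (by
      rw [hσ, ← QuotientAddGroup.mk_add, eq_comm, ← QuotientAddGroup.mk_zero, hmk]
      simpa [hτ] using hE1)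
  obtain ⟨A, rfl⟩ := QuotientAddGroup.mk_surjective f
  rw [hσ, ← QuotientAddGroup.mk_sub, eq_comm, hmk] at hf
  exact ⟨A, A.2, hf⟩

variable (hex : ∀ x : K, IsAlgebraic F x → ∃ c : F, algebraMap F K c = x)
include hex

lemma const_nrm {x : K} (hx : x ≠ 0) (h : divi F x = 0) : ∃ z : L, z ≠ 0 ∧ Q.nrm z = x ∧ divi F z = 0 := by
  have h1 : IsAlgebraic F x := isAlgebraic_of_le fun v => Or.inr (by
    have := DFunLike.congr_fun h v
    simp at this; exact this.ge)
  obtain ⟨c, rfl⟩ := hex x h1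
  have hu0 : u ≠ 0 := fun h => Q.u0 (by rw [h, map_zero])
  have := Fintype.ofFinite F
  have : ∃ a b : F, a ^ 2 - u * b ^ 2 = c := by
    have hc : ringChar F ≠ 2 := by
      intro h'
      apply NeZero.ne (2 : F)
      have := ringChar.Nat.cast_ringChar (R := F)
      rw [h'] at this; exact_mod_cast this
    obtain ⟨a, b, hab⟩ := FiniteField.exists_root_sum_quadratic (f := X ^ 2 - C c) (g := C (-u) * X ^ 2)
      (by compute_degree!) (by
        rw [degree_C_mul (by simpa using hu0)]; exact degree_X_pow 2) (by
        have := card_odd F; rw [Nat.card_eq_fintype_card] at this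
        exact Nat.odd_iff.1 this)
    refine ⟨a, b, ?_⟩
    simp at hab
    linear_combination hab
  obtain ⟨a, b, hab⟩ := this
  have hn : Q.nrm (algebraMap F L a + algebraMap F L b * Q.s) = algebraMap F K c := by
    apply (algebraMap K L).injective
    rw [Q.alg_nrm, map_add, map_mul, Q.σs, IsScalarTower.algebraMap_apply F K L, AlgEquiv.commutes,
      IsScalarTower.algebraMap_apply F K L b, AlgEquiv.commutes, ← hab]
    have := Q.hs
    rw [map_sub, map_sub, map_mul, map_mul, map_pow, map_pow, map_pow, map_pow, ← this]; ring
  have hz : algebraMap F L a + algebraMap F L b * Q.s ≠ 0 := by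
    intro h0
    apply hx
    rw [← hn, h0]
    apply (algebraMap K L).injective
    rw [Q.alg_nrm]; simp
  refine ⟨_, hz, hn, ?_⟩
  have hle : ∀ w : Place L, w.le 0 (algebraMap F L a + algebraMap F L b * Q.s) := fun w =>
    (w.le_const a).add ((w.le_const b).mul0 (Or.inr (Q.ord_s w).ge))
  ext w
  have h2 := (Place.le_iff hz).1 (hle w)
  have h3 := (Place.le_iff hz).1 (hle (Q.act w))
  rw [Q.act_ord] at h3
  have h4 := congrArg w.ord (Q.alg_nrm (algebraMap F L a + algebraMap F L b * Q.s))
  rw [w.ord_mul _ _ hz ((_root_.map_ne_zero Q.σ).2 hz), hn, ← IsScalarTower.algebraMap_apply, w.ord_const] at h4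
  simp only [divi_apply, Finsupp.coe_zero, Pi.zero_apply]
  omega

lemma fixed_class {D : Dv L} (h : Q.sg D - D ∈ princ F L) : ∃ D0 : Dv K, D - Q.j D0 ∈ princ F L := by
  obtain ⟨f, hf, hfD⟩ := h
  have h0 : divi F (Q.nrm f) = 0 := by
    apply Q.j_inj
    rw [Q.divi_nrm hf, hfD, Q.j_zero, map_sub, Q.sg_sg]; abel
  obtain ⟨η, hη, hηn, hηd⟩ := Q.const_nrm hex (Q.nrm_ne hf) h0
  have hfη : f / η ≠ 0 := div_ne_zero hf hη
  have hN : (f / η) * Q.σ (f / η) = 1 := by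
    have h1 := Q.alg_nrm f
    have h2 := Q.alg_nrm η
    rw [hηn, h1] at h2
    have hσ : Q.σ η ≠ 0 := by simpa using hη
    rw [map_div₀, div_mul_div_comm, h2, div_self (mul_ne_zero hη hσ)]
  have : ∃ g : L, g ≠ 0 ∧ f / η * Q.σ g = g := by
    by_cases hm : f / η = -1
    · exact ⟨Q.s, Q.s0, by rw [hm, Q.σs]; ring⟩
    · refine ⟨1 + f / η, fun h => hm (by linear_combination h), ?_⟩
      rw [map_add, map_one, mul_add, hN]; ring
  obtain ⟨g, hg, hgf⟩ := this
  have hd : divi F f + Q.sg (divi F g) = divi F g := by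
    have := congrArg (divi F) hgf
    rw [divi_mul F hfη (by simpa using hg), Q.divi_σ, divi_div F hf hη, hηd, sub_zero] at this
    exact this
  obtain ⟨D0, hD0⟩ := Q.exists_j (D := D + divi F g) (by
    rw [map_add]
    rw [hfD] at hd
    rw [← sub_eq_zero] at hd ⊢
    rw [← hd]; abel)
  refine ⟨D0, g⁻¹, inv_ne_zero hg, ?_⟩
  rw [divi_inv, ← hD0]; abel

variable (hu : ¬ IsSquare u)
include hu

lemma fixed_class_zero (D : Dv L) (hD : degD F D = 0) (h : Q.sg D - D ∈ princ F L) :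
    ∃ E : Dv L, degD F E = 0 ∧ D - (E + Q.sg E) ∈ princ F L := by
  obtain ⟨D0, hD0⟩ := Q.fixed_class hex h
  have h1 := degD_princ hD0
  rw [map_sub, hD, Q.deg_j] at h1
  obtain ⟨D1, hD1, x, hx, rfl⟩ := lfunction_lemma (F := F) D0 (by omega)
  obtain ⟨E, hE⟩ := Q.exists_half hu hD1
  have h2 : degD F E = 0 := by
    have := congrArg (degD F) hE
    rw [Q.deg_j, map_add, Q.deg_sg] at this
    rw [map_add, degD_divi] at h1
    omega
  refine ⟨E, h2, ?_⟩
  rw [Q.j_add, hE] at hD0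
  have : Q.j (divi F x) ∈ princ F L := ⟨algebraMap K L x, by simpa using hx, Q.divi_alg x⟩
  have := (princ F L).add_mem hD0 this
  convert this using 1; abel

theorem HPconst {b : K} (hb : b ≠ 0) (h : ∀ v : Place K, v.th (algebraMap F K u) b = 1) :
    Nm (algebraMap F K u) b := by
  have h1 : divi F b ∈ evenDiv F K := by
    intro v hv
    have := h v
    rw [th_const F v hu] at this
    rw [divi_apply]
    by_contra hne
    rw [if_neg (by rw [not_or, Nat.not_even_iff_odd]; exact ⟨hne, hv⟩)] at this
    omega
  obtain ⟨E, hE⟩ := Q.exists_half hu h1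
  have h2 : degD F E = 0 := by
    have := congrArg (degD F) hE
    rw [Q.deg_j, map_add, Q.deg_sg, degD_divi] at this
    omega
  obtain ⟨A, hA, g, hg, hgA⟩ := Q.group_step (Q.fixed_class_zero hex hu) E h2
    ⟨algebraMap K L b, by simpa using hb, by rw [← hE, Q.divi_alg]⟩
  have h3 : divi F b = divi F (Q.nrm g) := by
    apply Q.j_inj
    rw [hE, Q.divi_nrm hg, hgA, map_sub, map_sub, Q.sg_sg]; abel
  have hng := Q.nrm_ne hg
  obtain ⟨z, hz, hzn, -⟩ := Q.const_nrm hex (x := b / Q.nrm g) (div_ne_zero hb hng) (by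
    rw [divi_div F hb hng, h3, sub_self])
  have : b = Q.nrm (z * g) := by rw [Q.nrm_mul, hzn, div_mul_cancel₀ _ hng]
  rw [this]; exact Q.Nm_nrm _

theorem T5 : ∃ v : Place K, Odd (v.deg F) := by
  by_contra hno
  push Not at hno
  have hall : ∀ D : Dv K, D ∈ evenDiv F K := fun D v hv => absurd hv (hno v)
  have key : ∀ E : Dv L, ∃ E' : Dv L, degD F E = 2 * degD F E' := by
    intro E
    obtain ⟨A, hA, hEA⟩ := Q.group_step (Q.fixed_class_zero hex hu) (E - Q.sg E)
      (by rw [map_sub, Q.deg_sg, sub_self]) (by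
        rw [map_sub, Q.sg_sg]
        have : E - Q.sg E + (Q.sg E - E) = 0 := by abel
        rw [this]; exact (princ F L).zero_mem)
    obtain ⟨D0, hD0⟩ := Q.fixed_class hex (D := E - A) (by
      have := (princ F L).neg_mem hEA
      convert this using 1
      rw [map_sub]; abel)
    obtain ⟨E', hE'⟩ := Q.exists_half hu (hall D0)
    refine ⟨E', ?_⟩
    have h1 := degD_princ hD0
    rw [hE', map_sub, map_sub, map_add, Q.deg_sg, hA] at h1
    omega
  have hdvd : ∀ n : ℕ, ∀ E : Dv L, (2 ^ n : ℤ) ∣ degD F E := by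
    intro n
    induction n with
    | zero => intro E; simp
    | succ n ih =>
      intro E
      obtain ⟨E', hE'⟩ := key E
      rw [hE', pow_succ, mul_comm]; exact mul_dvd_mul_left _ (ih E')
  obtain ⟨w⟩ := exists_place F (K := L)
  have h1 := hdvd (w.deg F) (Finsupp.single w 1)
  rw [degD_single, one_mul] at h1
  have h2 : 2 ^ (w.deg F) ∣ w.deg F := by exact_mod_cast h1
  exact absurd (Nat.le_of_dvd (Place.deg_pos (F := F) w) h2) (not_le.2 Nat.lt_two_pow_self)

end
end QE
end TAD

namespace TAD
open IntermediateField Polynomial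

section nm
variable {K : Type*} [Field K]

lemma Nm_of_sq (h2 : (2 : K) ≠ 0) {a : K} (ha : a ≠ 0) (hs : IsSquare a) (b : K) : Nm a b := by
  obtain ⟨c, rfl⟩ := hs
  have hc : c ≠ 0 := by rintro rfl; simp at ha
  refine ⟨(b + 1) / 2, (b - 1) / (2 * c), ?_⟩
  field_simp; ring

lemma Nm.mul {a b c : K} (hb : Nm a b) (hc : Nm a c) : Nm a (b * c) := by
  obtain ⟨x, y, rfl⟩ := hb
  obtain ⟨z, w, rfl⟩ := hc
  exact ⟨x * z + a * y * w, x * w + y * z, by ring⟩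

lemma Nm_sq (a c : K) : Nm a (c ^ 2) := ⟨c, 0, by ring⟩
lemma Nm_one (a : K) : Nm a 1 := ⟨1, 0, by ring⟩
lemma Nm_neg (a : K) : Nm a (-a) := ⟨0, 1, by ring⟩

lemma Nm.pow {a b : K} (hb : Nm a b) (n : ℕ) : Nm a (b ^ n) := by
  induction n with
  | zero => simpa using Nm_one a
  | succ n ih => rw [pow_succ]; exact ih.mul hb

lemma Nm.of_mul_sq {a b c : K} (hc : c ≠ 0) (h : Nm a (b * c ^ 2)) : Nm a b := by
  have := h.mul (Nm_sq a c⁻¹)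
  rwa [mul_assoc, ← mul_pow, mul_inv_cancel₀ hc, one_pow, mul_one] at this

lemma Nm.of_mul {a b c : K} (hc : c ≠ 0) (h : Nm a (b * c)) (h' : Nm a c) : Nm a b := by
  apply Nm.of_mul_sq hc
  have := h.mul h'
  rwa [mul_assoc, ← pow_two] at this

lemma Nm.symm (h2 : (2 : K) ≠ 0) {a b : K} (_ha : a ≠ 0) (hb : b ≠ 0) (h : Nm a b) : Nm b a := by
  obtain ⟨x, y, h⟩ := h
  by_cases hy : y = 0
  · exact Nm_of_sq h2 hb ⟨x, by rw [h, hy]; ring⟩ a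
  · refine ⟨x / y, 1 / y, ?_⟩
    field_simp
    linear_combination h

lemma Nm_left_mul_sq {a b c : K} (hc : c ≠ 0) : Nm (a * c ^ 2) b ↔ Nm a b := by
  constructor
  · rintro ⟨x, y, h⟩; exact ⟨x, c * y, by rw [h]; ring⟩
  · rintro ⟨x, y, h⟩; exact ⟨x, y / c, by rw [h]; field_simp⟩

lemma Nm.mul_left (h2 : (2 : K) ≠ 0) {a b c : K} (ha : a ≠ 0) (hb : b ≠ 0) (hc : c ≠ 0) (h : Nm a c) (h' : Nm b c) :
    Nm (a * b) c :=
  ((h.symm h2 ha hc).mul (h'.symm h2 hb hc)).symm h2 hc (mul_ne_zero ha hb)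

/-- the nontrivial isotropy condition gives a norm -/
lemma Nm_of_isotropic (h2 : (2 : K) ≠ 0) {a b x y z : K} (ha : a ≠ 0) (h : x ^ 2 = a * y ^ 2 + b * z ^ 2)
    (hne : x ≠ 0 ∨ y ≠ 0 ∨ z ≠ 0) : Nm a b := by
  by_cases hz : z = 0
  · subst hz
    have hy : y ≠ 0 := by
      rintro rfl
      have : x = 0 := by simpa using h
      simp_all
    exact Nm_of_sq h2 ha ⟨x / y, by field_simp; linear_combination -h⟩ b
  · exact ⟨x / z, y / z, by field_simp; linear_combination -h⟩

lemma norm_eq {R : Type*} [Field R] {a : R} (z : QuadraticAlgebra R a 0) :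
    Algebra.norm R z = z.re ^ 2 - a * z.im ^ 2 := by
  rw [Algebra.norm_apply, ← LinearMap.det_toMatrix (QuadraticAlgebra.basis a 0)]
  have h := QuadraticAlgebra.det_toLinearMap_eq_norm z
  rw [← LinearMap.det_toMatrix (QuadraticAlgebra.basis a 0)] at h
  have h3 : Algebra.lmul R _ z = DistribSMul.toLinearMap R (QuadraticAlgebra R a 0) z := by
    ext <;> simp
  rw [h3, h, QuadraticAlgebra.norm_def]; ring

lemma Nm_of_odd (h2 : (2 : K) ≠ 0) {E : Type*} [Field E] [Algebra K E] [FiniteDimensional K E] (hodd : Odd (Module.finrank K E))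
    {a b : K} (ha : a ≠ 0) (hb : b ≠ 0) (h : Nm (algebraMap K E a) (algebraMap K E b)) : Nm a b := by
  by_cases hsq : IsSquare a
  · exact Nm_of_sq h2 ha hsq b
  have := fact_of_nsq hsq
  obtain ⟨x, y, hxy⟩ := h
  set L := QuadraticAlgebra K a 0
  set A := QuadraticAlgebra E (algebraMap K E a) 0
  have haux : (⟨0, 1⟩ : A) * ⟨0, 1⟩ = a • 1 + (0 : K) • (⟨0, 1⟩ : A) := by
    have h1 : (1 : A) = ⟨1, 0⟩ := rfl
    rw [h1]; ext <;> simp [Algebra.smul_def] <;> rfl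
  let f : L →ₐ[K] A := QuadraticAlgebra.lift ⟨⟨0, 1⟩, haux⟩
  let _ : Algebra L A := f.toRingHom.toAlgebra
  have : IsScalarTower K L A := IsScalarTower.of_algebraMap_eq' f.comp_algebraMap.symm
  have : Module.Finite K A := Module.Finite.trans E A
  have : Module.Finite L A := Module.Finite.of_restrictScalars_finite K L A
  have h3 := Algebra.norm_norm (R := K) (S := E) (a := (⟨x, y⟩ : A))
  have h4 := Algebra.norm_norm (R := K) (S := L) (a := (⟨x, y⟩ : A))
  rw [norm_eq] at h3 h4
  change Algebra.norm K (x ^ 2 - _ * y ^ 2) = _ at h3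
  rw [← hxy, Algebra.norm_algebraMap, ← h4] at h3
  obtain ⟨k, hk⟩ := hodd
  have h5 : Nm a (b * (b ^ k) ^ 2) := by
    refine ⟨_, _, Eq.trans ?_ h3⟩
    rw [hk]; ring
  exact h5.of_mul_sq (pow_ne_zero _ hb)

end nm

section zero
open MvPolynomial

lemma height_van {k : Type*} [Field k] (N : ℕ) :
    (N : ℕ∞) ≤ (RingHom.ker (MvPolynomial.eval (0 : Fin N → k))).height := by
  let φ : ℕ → MvPolynomial (Fin N) k →ₐ[k] MvPolynomial (Fin N) k := fun i =>
    MvPolynomial.aeval (fun j : Fin N => if (j : ℕ) < i then 0 else X j)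
  let P : ℕ → Ideal (MvPolynomial (Fin N) k) := fun i => RingHom.ker (φ i)
  have hP : ∀ i, (P i).IsPrime := fun i => RingHom.ker_isPrime _
  have hlt : ∀ i < N, P i < P (i + 1) := by
    intro i hi
    have hcomp : ∀ p, φ (i + 1) p = φ (i + 1) (φ i p) := by
      intro p
      rw [← AlgHom.comp_apply]
      congr 1
      ext j
      simp only [φ, AlgHom.comp_apply, MvPolynomial.aeval_X]
      by_cases h : (j : ℕ) < i
      · simp [h, Nat.lt_succ_of_lt h]
      · simp [h]
    refine lt_of_le_not_ge ?_ ?_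
    · intro p hp
      rw [RingHom.mem_ker] at hp ⊢
      rw [hcomp, hp, map_zero]
    · intro hle
      have : X ⟨i, hi⟩ ∈ P (i + 1) := by
        rw [RingHom.mem_ker]; simp [φ]
      have := hle this
      rw [RingHom.mem_ker] at this
      simp [φ] at this
  have hle : ∀ i ≤ N, (i : ℕ∞) ≤ (P i).height := by
    intro i hi
    induction i with
    | zero => simp
    | succ i ih =>
      have := hP i
      have := hP (i+1)
      have h1 := Ideal.height_add_one_le_of_lt_of_isPrime (hlt i hi)
      refine le_trans ?_ h1
      push_cast
      gcongr
      exact ih (by omega)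
  have hN : P N ≤ RingHom.ker (MvPolynomial.eval (0 : Fin N → k)) := by
    intro p hp
    rw [RingHom.mem_ker] at hp ⊢
    have : MvPolynomial.eval (0 : Fin N → k) (φ N p) = MvPolynomial.eval 0 p := by
      have : (MvPolynomial.aeval (0 : Fin N → k)).comp (φ N) = MvPolynomial.aeval (0 : Fin N → k) := by
        ext j; simp [φ]
      have := DFunLike.congr_fun this p
      simpa [MvPolynomial.aeval_eq_eval] using this
    rw [← this, hp, map_zero]
  exact (hle N le_rfl).trans (Ideal.height_mono hN)

lemma exists_nontrivial_zero {k : Type*} [Field k] [IsAlgClosed k] {N : ℕ} {τ : Type*} [Fintype τ]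
    (Q : τ → MvPolynomial (Fin N) k) (h0 : ∀ j, MvPolynomial.eval 0 (Q j) = 0)
    (hc : Fintype.card τ < N) : ∃ x : Fin N → k, x ≠ 0 ∧ ∀ j, MvPolynomial.eval x (Q j) = 0 := by
  by_contra hno
  push Not at hno
  set I := Ideal.span (Set.range Q) with hI
  have hz : zeroLocus k I = {(0 : Fin N → k)} := by
    ext x
    rw [hI, zeroLocus_span]
    simp only [Set.mem_ofPred_eq, Set.mem_singleton_iff, Set.forall_mem_range, MvPolynomial.aeval_eq_eval]
    constructor
    · intro h
      by_contra hx
      obtain ⟨j, hj⟩ := hno x hx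
      exact hj (h j)
    · rintro rfl; exact h0
  have hr := vanishingIdeal_zeroLocus_eq_radical (K := k) I
  rw [hz] at hr
  have hv : vanishingIdeal k {(0 : Fin N → k)} = RingHom.ker (MvPolynomial.eval (0 : Fin N → k)) := by
    ext p
    rw [mem_vanishingIdeal_singleton_iff, RingHom.mem_ker, MvPolynomial.aeval_eq_eval]
  rw [hv] at hr
  have hp : (RingHom.ker (MvPolynomial.eval (0 : Fin N → k))).IsPrime := RingHom.ker_isPrime _
  have hm : RingHom.ker (MvPolynomial.eval (0 : Fin N → k)) ∈ I.minimalPrimes := by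
    refine ⟨⟨hp, ?_⟩, ?_⟩
    · rw [hr]; exact Ideal.le_radical
    · intro J hJ _
      rw [hr]
      exact hJ.1.radical_le_iff.2 hJ.2
  have h1 := Ideal.height_le_card_of_mem_minimalPrimes_span (Set.finite_range Q) hm
  have h2 := (height_van (k := k) N).trans h1
  have h3 : N ≤ (Set.range Q).ncard := by exact_mod_cast h2
  have h4 : (Set.range Q).ncard ≤ Fintype.card τ := by
    rw [← Set.image_univ]
    refine (Set.ncard_image_le Set.finite_univ).trans ?_
    rw [Set.ncard_univ, Nat.card_eq_fintype_card]
  omega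
end zero
end TAD

namespace TAD
open IntermediateField Polynomial

section exact
variable {F K : Type*} [Field F] [Finite F] [Field K] [Algebra F K]

instance finite_ac [GF F K] : Finite (algebraicClosure F K) := by
  let f : algebraicClosure F K → RR F (0 : Dv K) := fun x => ⟨x.1, mem_RR.2 fun v => by
    by_cases hx : x.1 = 0
    · rw [hx]; exact Place.le_zero _
    · rw [Place.le_iff hx, v.ord_of_isAlgebraic (F := F) (mem_algebraicClosure_iff.1 x.2)]; simp⟩
  have : Finite (RR F (0 : Dv K)) := Module.finite_of_finite F
  exact Finite.of_injective f fun x y h => Subtype.ext (congrArg (fun z : RR F (0 : Dv K) => z.1) h)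

instance gf_ac [GF F K] : GF (algebraicClosure F K) K := by
  obtain ⟨t, ht⟩ := GF.exT (F := F) (K := K)
  have ht' : Transcendental (algebraicClosure F K) t := fun h =>
    ht (h.restrictScalars F)
  have hfin := GF.fin (F := F) t ht
  refine GF.of_exists ht' ?_
  have hle : F⟮t⟯ ≤ ((algebraicClosure F K)⟮t⟯).restrictScalars F := by
    rw [adjoin_simple_le_iff]
    exact mem_adjoin_simple_self _ t
  let _ : Algebra F⟮t⟯ (algebraicClosure F K)⟮t⟯ := (inclusion hle).toRingHom.toAlgebra
  have : IsScalarTower F⟮t⟯ (algebraicClosure F K)⟮t⟯ K := IsScalarTower.of_algebraMap_eq fun x => rfl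
  exact Module.Finite.of_restrictScalars_finite F⟮t⟯ _ K

lemma exact_ac [GF F K] : ∀ x : K, IsAlgebraic (algebraicClosure F K) x →
    ∃ c : algebraicClosure F K, algebraMap (algebraicClosure F K) K c = x := fun x hx =>
  ⟨⟨x, mem_algebraicClosure_iff'.2 (hx.restrictScalars F).isIntegral⟩, rfl⟩

instance neZero_ac [NeZero (2 : F)] : NeZero (2 : algebraicClosure F K) :=
  ⟨by
    have := NeZero.ne (2 : F)
    rw [← map_ofNat (algebraMap F (algebraicClosure F K)) 2]
    simpa using this⟩

variable {Ω : Type*} [Field Ω] [Algebra F Ω] [Algebra K Ω] [IsScalarTower F K Ω]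
variable (hex : ∀ x : K, IsAlgebraic F x → ∃ c : F, algebraMap F K c = x)
include hex

lemma minpoly_eq {ζ : Ω} (hζ : IsAlgebraic F ζ) : minpoly K ζ = (minpoly F ζ).map (algebraMap F K) := by
  have hi := hζ.isIntegral
  have hiK : IsIntegral K ζ := hi.tower_top
  have hd : minpoly K ζ ∣ (minpoly F ζ).map (algebraMap F K) := minpoly.dvd_map_of_isScalarTower F K ζ
  have h1 := integralClosure.mem_lifts_of_monic_of_dvd_map K (minpoly.monic hi) (minpoly.monic hiK) hd
  have h2 : minpoly K ζ ∈ lifts (algebraMap F K) := by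
    rw [lifts_iff_coeff_lifts] at h1 ⊢
    intro n
    obtain ⟨c, hc⟩ := h1 n
    rw [← hc]
    exact hex _ (IsIntegral.isAlgebraic c.2)
  obtain ⟨g, hg, hdeg, hmon⟩ := lifts_and_natDegree_eq_and_monic h2 (minpoly.monic hiK)
  rw [← hg]
  congr 1
  have h3 : aeval ζ g = 0 := by
    rw [← aeval_map_algebraMap K, hg, minpoly.aeval]
  refine minpoly.unique F ζ hmon h3 fun q hq hq0 => ?_
  have h4 := minpoly.min K ζ (hq.map (algebraMap F K)) (by rw [aeval_map_algebraMap, hq0])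
  rw [← hg] at h4
  rwa [degree_map, degree_map] at h4

lemma linind_ext {ζ : Ω} (hζ : IsAlgebraic F ζ) {ι : Type*} [Fintype ι] {e : ι → K} (he : LinearIndependent F e)
    {y : ι → Ω} (hy : ∀ i, y i ∈ F⟮ζ⟯) (h : ∑ i, y i * algebraMap K Ω (e i) = 0) : ∀ i, y i = 0 := by
  have hi := hζ.isIntegral
  have h1 : ∀ i, ∃ p : F[X], p.degree < (minpoly F ζ).degree ∧ aeval ζ p = y i := by
    intro i
    have h2 : y i ∈ F⟮ζ⟯.toSubalgebra := hy i
    rw [adjoin_simple_toSubalgebra_of_isAlgebraic hζ, Algebra.adjoin_singleton_eq_range_aeval] at h2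
    obtain ⟨p, hp⟩ := h2
    change aeval ζ p = y i at hp
    refine ⟨p %ₘ minpoly F ζ, degree_modByMonic_lt _ (minpoly.monic hi), ?_⟩
    rw [← hp, aeval_modByMonic_eq_self_of_root (minpoly.aeval F ζ)]
  choose p hp hpy using h1
  let P : K[X] := ∑ i, C (e i) * (p i).map (algebraMap F K)
  have hP0 : aeval ζ P = 0 := by
    rw [map_sum, ← h]
    refine Finset.sum_congr rfl fun i _ => ?_
    rw [map_mul, aeval_C, aeval_map_algebraMap, hpy, mul_comm]
  have hPd : P.degree < (minpoly K ζ).degree := by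
    rw [minpoly_eq hex hζ, degree_map]
    have hb : (⊥ : WithBot ℕ) < (minpoly F ζ).degree := bot_lt_iff_ne_bot.2 (by
      rw [Ne, degree_eq_bot]; exact minpoly.ne_zero hi)
    refine (degree_sum_le _ _).trans_lt ((Finset.sup_lt_iff hb).2 fun i _ => ?_)
    refine lt_of_le_of_lt ?_ (hp i)
    refine (degree_mul_le _ _).trans ?_
    rw [degree_map]
    calc (C (e i)).degree + (p i).degree ≤ 0 + (p i).degree := by gcongr; exact degree_C_le
      _ = _ := zero_add _
  have hP : P = 0 := by
    by_contra hne
    exact absurd (minpoly.degree_le_of_ne_zero K ζ hne hP0) (not_le.2 hPd)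
  intro i
  rw [← hpy i]
  have : p i = 0 := by
    ext k
    have h2 := congrArg (fun q => q.coeff k) hP
    simp only [P, finsetSum_coeff, coeff_C_mul, coeff_map, coeff_zero] at h2
    rw [Fintype.linearIndependent_iff] at he
    refine he (fun i => (p i).coeff k) ?_ i
    rw [← h2]
    refine Finset.sum_congr rfl fun i _ => ?_
    rw [Algebra.smul_def, mul_comm]
  rw [this, map_zero]

end exact

lemma tsen_zero {l r : ℕ} {F Ω : Type*} [Field F] [Field Ω] [Algebra F Ω] [IsAlgClosed Ω]
    (cf : Fin 3 → Fin l → Fin l → Fin r → F) (hc : r < 3 * l) :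
    ∃ y : Fin 3 → Fin l → Ω, (∃ m i, y m i ≠ 0) ∧ (∀ m i, IsAlgebraic F (y m i)) ∧
      ∀ j, ∑ m, ∑ i, ∑ i', algebraMap F Ω (cf m i i' j) * (y m i * y m i') = 0 := by
  have : IsAlgClosed (algebraicClosure F Ω) := IsAlgClosure.isAlgClosed F
  let ix := fun m i => finProdFinEquiv (m, i) (m := 3) (n := l)
  let Q : Fin r → MvPolynomial (Fin (3 * l)) (algebraicClosure F Ω) :=
    fun j => ∑ m, ∑ i, ∑ i', MvPolynomial.C (algebraMap F (algebraicClosure F Ω) (cf m i i' j)) *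
      (MvPolynomial.X (ix m i) * MvPolynomial.X (ix m i'))
  obtain ⟨x, hx0, hx⟩ := exists_nontrivial_zero Q (by intro j; simp [Q]) (by simpa using hc)
  refine ⟨fun m i => (x (ix m i) : Ω), ?_, fun m i => mem_algebraicClosure_iff.1 (x (ix m i)).2, ?_⟩
  · by_contra hno
    push Not at hno
    apply hx0
    ext p
    obtain ⟨⟨m, i⟩, rfl⟩ := finProdFinEquiv.surjective p
    exact hno m i
  · intro j
    have h1 := congrArg (algebraMap (algebraicClosure F Ω) Ω) (hx j)
    simp only [Q, map_sum, map_mul, MvPolynomial.eval_C, MvPolynomial.eval_X, map_zero] at h1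
    exact h1

lemma tsen_prim {ι : Type*} [Finite ι] {F Ω : Type*} [Field F] [Finite F] [Field Ω] [Algebra F Ω] 
    (y : ι → Ω) (hy : ∀ i, IsAlgebraic F (y i)) : ∃ ζ : Ω, IsAlgebraic F ζ ∧ ∀ i, y i ∈ F⟮ζ⟯ := by
  let F1 := adjoin F (Set.range y)
  have hF1 : FiniteDimensional F F1 := finiteDimensional_adjoin (by
    rintro _ ⟨p, rfl⟩; exact (hy p).isIntegral)
  obtain ⟨ζ1, hζ1⟩ := Field.exists_primitive_element F F1
  have hζ : F⟮(ζ1 : Ω)⟯ = F1 := by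
    have := congrArg IntermediateField.lift hζ1
    rwa [lift_adjoin_simple, lift_top] at this
  exact ⟨ζ1, (IsIntegral.isAlgebraic (IsIntegral.of_finite F ζ1)).algebraMap, fun i => by
    rw [hζ]; exact subset_adjoin _ _ ⟨i, rfl⟩⟩

lemma tsen_sum {l r : ℕ} {F K Ω : Type*} [Field F] [Field K] [Field Ω] [Algebra F Ω] [Algebra F K] [Algebra K Ω]
    [IsScalarTower F K Ω] (cf : Fin 3 → Fin l → Fin l → Fin r → F) (α : Fin 3 → K) (e : Fin l → K) (g : Fin r → K)
    (hcf : ∀ m i i', α m * (e i * e i') = ∑ j, algebraMap F K (cf m i i' j) * g j)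
    (y : Fin 3 → Fin l → Ω)
    (hy : ∀ j, ∑ m, ∑ i, ∑ i', algebraMap F Ω (cf m i i' j) * (y m i * y m i') = 0) :
    ∑ m, algebraMap K Ω (α m) * (∑ i, y m i * algebraMap K Ω (e i)) ^ 2 = 0 := by
  have h1 : ∀ m, algebraMap K Ω (α m) * (∑ i, y m i * algebraMap K Ω (e i)) ^ 2 =
      ∑ j, (∑ i, ∑ i', algebraMap F Ω (cf m i i' j) * (y m i * y m i')) * algebraMap K Ω (g j) := by
    intro m
    rw [pow_two, Finset.sum_mul_sum, Finset.mul_sum]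
    simp_rw [Finset.mul_sum, Finset.sum_mul]
    rw [Finset.sum_comm (γ := Fin r) (α := Fin l)]
    refine Finset.sum_congr rfl fun i _ => ?_
    rw [Finset.sum_comm (γ := Fin r) (α := Fin l)]
    refine Finset.sum_congr rfl fun i' _ => ?_
    have h2 := congrArg (algebraMap K Ω) (hcf m i i')
    simp only [map_sum, map_mul, ← IsScalarTower.algebraMap_apply F K Ω] at h2
    calc _ = (algebraMap K Ω (α m) * (algebraMap K Ω (e i) * algebraMap K Ω (e i'))) * (y m i * y m i') := by ring
      _ = _ := by
        rw [h2, Finset.sum_mul]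
        refine Finset.sum_congr rfl fun j _ => ?_
        ring
  simp_rw [h1]
  rw [Finset.sum_comm]
  refine Finset.sum_eq_zero fun j _ => ?_
  rw [← Finset.sum_mul, hy j, zero_mul]

section tsen
variable {F K : Type*} [Field F] [Finite F] [Field K] [Algebra F K] [GF F K] [NeZero (2 : F)]
variable (hex : ∀ x : K, IsAlgebraic F x → ∃ c : F, algebraMap F K c = x)
include hex

lemma tsen_core {Ω : Type*} [Field Ω] [Algebra F Ω] [Algebra K Ω] [IsScalarTower F K Ω] [IsAlgClosed Ω]
    {l r : ℕ} (cf : Fin 3 → Fin l → Fin l → Fin r → F) (α : Fin 3 → K) (e : Fin l → K) (g : Fin r → K)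
    (hcf : ∀ m i i', α m * (e i * e i') = ∑ j, algebraMap F K (cf m i i' j) * g j)
    (he : LinearIndependent F e) (hc : r < 3 * l) :
    ∃ ζ : Ω, IsAlgebraic F ζ ∧ ∃ X : Fin 3 → K⟮ζ⟯, (∃ m, X m ≠ 0) ∧
      ∑ m, algebraMap K K⟮ζ⟯ (α m) * (X m) ^ 2 = 0 := by
  obtain ⟨y, ⟨m0, i0, hm0⟩, hyalg, hy⟩ := tsen_zero (Ω := Ω) cf hc
  obtain ⟨ζ, hζalg, hyζ⟩ := tsen_prim (fun p : Fin 3 × Fin l => y p.1 p.2) (fun p => hyalg p.1 p.2)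
  have hyζ : ∀ m i, y m i ∈ F⟮ζ⟯ := fun m i => hyζ (m, i)
  refine ⟨ζ, hζalg, ?_⟩
  have hle : F⟮ζ⟯ ≤ K⟮ζ⟯.restrictScalars F := by
    rw [adjoin_simple_le_iff, mem_restrictScalars]; exact mem_adjoin_simple_self K ζ
  let X : Fin 3 → K⟮ζ⟯ := fun m => ∑ i, (⟨y m i, hle (hyζ m i)⟩ : K⟮ζ⟯) * algebraMap K _ (e i : K)
  have hX : ∀ m, algebraMap K⟮ζ⟯ Ω (X m) = ∑ i, y m i * algebraMap K _ (e i : K) := by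
    intro m
    rw [map_sum]
    refine Finset.sum_congr rfl fun i _ => ?_
    rw [map_mul]; rfl
  refine ⟨X, ⟨m0, fun h0 => hm0 ?_⟩, ?_⟩
  · refine linind_ext hex hζalg he (hyζ m0) ?_ i0
    rw [← hX, h0, map_zero]
  · apply (algebraMap K⟮ζ⟯ Ω).injective
    rw [map_zero, ← tsen_sum cf α e g hcf y hy, map_sum]
    refine Finset.sum_congr rfl fun m _ => ?_
    rw [map_mul, map_pow, hX]; rfl

theorem tsen {a b : K} (ha : a ≠ 0) (hb : b ≠ 0) :
    ∃ ζ : AlgebraicClosure K, IsAlgebraic F ζ ∧ Nm (algebraMap K K⟮ζ⟯ a) (algebraMap K K⟮ζ⟯ b) := by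
  classical
  obtain ⟨c, n0, hRR⟩ := riemann_roch F K
  let Cd : Dv K := 0 ⊔ (-divi F a) ⊔ (-divi F b)
  obtain ⟨D, hD⟩ := exists_big F K (max (max n0 (n0 + |degD F Cd|)) (|degD F Cd| + 2 * |c| + 1))
  have habs1 := neg_abs_le (degD F Cd)
  have habs2 := le_abs_self (degD F Cd)
  have habs3 := neg_abs_le c
  have habs4 := abs_nonneg (degD F Cd)
  have habs5 := abs_nonneg c
  simp only [max_le_iff] at hD
  obtain ⟨⟨hD1, hD2⟩, hD3⟩ := hD
  have hl1 := hRR D hD1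
  have hd2 : degD F (D + D + Cd) = 2 * degD F D + degD F Cd := by rw [map_add, map_add]; ring
  have hl2 := hRR (D + D + Cd) (by rw [hd2]; omega)
  rw [hd2] at hl2
  have hcount : ell F (D + D + Cd) < 3 * ell F D := by zify; omega
  let α : Fin 3 → K := ![1, -a, -b]
  have hα : ∀ m (v : Place K), v.le (-(Cd v)) (α m) := by
    intro m v
    have h0 : (0 : Dv K) ≤ Cd := le_sup_left.trans le_sup_left
    have h1 : -divi F a ≤ Cd := le_sup_right.trans le_sup_left
    have h2 : -divi F b ≤ Cd := le_sup_right
    have h0 := h0 v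
    have h1 := h1 v
    have h2 := h2 v
    simp only [Finsupp.coe_neg, Pi.neg_apply, divi_apply, Finsupp.coe_zero, Pi.zero_apply] at h0 h1 h2
    fin_cases m
    · change v.le _ (1 : K)
      rw [Place.le_iff one_ne_zero, Place.ord_one]; omega
    · change v.le _ (-a)
      apply Place.le.neg
      rw [Place.le_iff ha]; omega
    · change v.le _ (-b)
      apply Place.le.neg
      rw [Place.le_iff hb]; omega
  let e := Module.finBasis F (RR F D)
  let g := Module.finBasis F (RR F (D + D + Cd))
  have hmem : ∀ m i i', α m * ((e i : K) * (e i' : K)) ∈ RR F (D + D + Cd) := by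
    intro m i i'
    rw [mem_RR]
    intro v
    have := (hα m v).mul ((mem_RR.1 (e i).2 v).mul (mem_RR.1 (e i').2 v))
    convert this using 1
    simp only [Finsupp.coe_add, Pi.add_apply]; ring
  let cf : Fin 3 → Fin (Module.finrank F (RR F D)) → Fin (Module.finrank F (RR F D)) →
      Fin (Module.finrank F (RR F (D + D + Cd))) → F := fun m i i' j => g.repr ⟨_, hmem m i i'⟩ j
  have hcf : ∀ m i i', α m * ((e i : K) * (e i' : K)) = ∑ j, algebraMap F K (cf m i i' j) * (g j : K) := by
    intro m i i'
    have := congrArg (fun z : RR F (D + D + Cd) => z.1) (g.sum_repr ⟨_, hmem m i i'⟩)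
    simp only [Submodule.coe_sum, Submodule.coe_smul, Algebra.smul_def] at this
    exact this.symm
  have he : LinearIndependent F (fun i => (e i : K)) :=
    e.linearIndependent.map' (RR F D).subtype (Submodule.ker_subtype _)
  obtain ⟨ζ1, hζalg, X, hX0, hsum⟩ := tsen_core (Ω := AlgebraicClosure K) hex cf α (fun i => (e i : K)) (fun j => (g j : K)) hcf he hcount
  refine ⟨ζ1, hζalg, ?_⟩
  have h2 : (2 : K⟮ζ1⟯) ≠ 0 := by
    have := two_ne F (K := K)
    rw [← map_ofNat (algebraMap K K⟮ζ1⟯) 2]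
    exact (_root_.map_ne_zero _).2 this
  refine Nm_of_isotropic h2 ((_root_.map_ne_zero _).2 ha) (x := X 0) (y := X 1) (z := X 2) ?_ ?_
  · rw [Fin.sum_univ_three] at hsum
    simp only [α, Matrix.cons_val_zero, Matrix.cons_val_one, Matrix.cons_val, map_one, map_neg] at hsum
    linear_combination hsum
  · obtain ⟨m, hm⟩ := hX0
    fin_cases m
    · exact Or.inl hm
    · exact Or.inr (Or.inl hm)
    · exact Or.inr (Or.inr hm)
end tsen
end TAD

namespace TAD
open IntermediateField Polynomial

/-- slot relation -/
def Slot {K : Type*} [Field K] (c r s : K) : Prop := ∃ x, x ≠ 0 ∧ Nm c (r * x) ∧ Nm x (c * s)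

lemma slot_of_Nm {K : Type*} [Field K] (h2 : (2 : K) ≠ 0) {c r s : K} (h : Nm c r) : Slot c r s :=
  ⟨1, one_ne_zero, by simpa using h, Nm_of_sq h2 one_ne_zero ⟨1, by simp⟩ _⟩

lemma slot_of_ext {K L : Type*} [Field K] [Field L] [Algebra K L] {c r s : K} (Q : QE K L s) (hc : c ≠ 0)
    (hr : r ≠ 0) (h : Nm (algebraMap K L c) (algebraMap K L r)) : Slot c r s := by
  obtain ⟨X, Y, h⟩ := h
  have hσ := congrArg Q.σ h
  simp only [AlgEquiv.commutes, map_sub, map_mul, map_pow] at hσ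
  have hX := Q.eq X
  have hY := Q.eq Y
  have hX' := Q.σ_eq X
  have hY' := Q.σ_eq Y
  set x1 := Q.re X
  set x2 := Q.im X
  set y1 := Q.re Y
  set y2 := Q.im Y
  rw [hX, hY] at h
  rw [hX', hY'] at hσ
  have e1 : x1 * x2 = c * (y1 * y2) := by
    apply (algebraMap K L).injective
    have h4 : (2 * 2 * Q.s : L) ≠ 0 := mul_ne_zero (mul_ne_zero Q.two' Q.two') Q.s0
    apply mul_left_cancel₀ h4
    simp only [map_mul]
    linear_combination hσ - h
  have e2 : r = x1 ^ 2 - c * y1 ^ 2 + s * (x2 ^ 2 - c * y2 ^ 2) := by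
    apply (algebraMap K L).injective
    apply mul_left_cancel₀ Q.two'
    simp only [map_mul, map_add, map_sub, map_pow]
    have hs := Q.hs
    linear_combination h + hσ + 2 * ((algebraMap K L) x2 ^ 2 - algebraMap K L c * (algebraMap K L) y2 ^ 2) * hs
  by_cases hB : x2 ^ 2 - c * y2 ^ 2 = 0
  · exact slot_of_Nm Q.two ⟨x1, y1, by rw [e2, hB]; ring⟩
  · set B := x2 ^ 2 - c * y2 ^ 2 with hBdef
    set k := y1 * x2 - x1 * y2 with hk
    have e3 : (x1 ^ 2 - c * y1 ^ 2) * B = - c * k ^ 2 := by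
      rw [hBdef, hk]
      linear_combination (x1 * x2 - c * (y1 * y2)) * e1
    refine ⟨-c * (r / B), mul_ne_zero (neg_ne_zero.2 hc) (div_ne_zero hr hB), ?_, ?_⟩
    · have : r * (-c * (r / B)) = -c * B * (r / B) ^ 2 := by field_simp
      rw [this]
      exact ((Nm_neg c).mul ⟨x2, y2, rfl⟩).mul (Nm_sq _ _)
    · refine ⟨c * k / B, 1, ?_⟩
      field_simp
      linear_combination (-B) * e2 - e3

section
variable {K : Type*} [Field K] {v : Place K} [Finite v.κ]

lemma nsq_of_slot {c r s : K} (hc : c ≠ 0) (hr : r ≠ 0) (hs : s ≠ 0) (h : Slot c r s) (hv : v.th c r = -1) :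
    v.nsq s := by
  obtain ⟨x, hx, h1, h2⟩ := h
  have h1 := th_of_Nm (v := v) hc (mul_ne_zero hr hx) h1
  have h2 := th_of_Nm (v := v) hx (mul_ne_zero hc hs) h2
  rw [Place.th_mul_right hc hr hx, hv] at h1
  rw [Place.th_mul_right hx hc hs, Place.th_symm hx hc] at h2
  refine ⟨x, hx, ?_⟩
  rw [Place.th_symm hs hx]
  rcases Place.th_cases (v := v) c x with h | h <;> rw [h] at h1 h2 <;> omega

end

section
variable {K L : Type*} [Field K] [Field L] [Algebra K L] {w : Place L} {v : Place K} {e : ℤ}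

lemma Above.tame (h : Above w v e) (a b : K) :
    w.tame (algebraMap K L a) (algebraMap K L b) = algebraMap K L (v.tame a b ^ e) := by
  unfold Place.tame
  rw [h.2, h.2, mul_zpow, mul_zpow, map_mul, map_mul, ← zpow_mul, ← zpow_mul, ← zpow_mul, map_zpow₀, map_zpow₀, map_zpow₀,
    map_neg, map_one]
  congr 1
  · congr 1
    · rcases Int.even_or_odd e with he | he
      · rw [Even.neg_one_zpow, Even.neg_one_zpow]
        · exact he.mul_left _
        · rw [mul_assoc]; exact he.mul_right _
      · have : e * v.ord a * (e * v.ord b) = e * e * (v.ord a * v.ord b) := by ring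
        rw [this, zpow_mul, Odd.neg_one_zpow (he.mul he), mul_comm (v.ord a * v.ord b) e, zpow_mul _ e, Odd.neg_one_zpow he]
    · rw [mul_comm]
  · congr 1; ring

variable [Finite v.κ] [Finite w.κ]

lemma Above.th (h : Above w v e) {a b : K} (ha : a ≠ 0) (hb : b ≠ 0) {f : v.κ →+* w.κ}
    (hf : ∀ x, v.le 0 x → f (v.res x) = w.res (algebraMap K L x)) :
    w.th (algebraMap K L a) (algebraMap K L b) = if Even e then 1 else chi (f (v.res (v.tame a b))) := by
  have h0 := Place.ord_tame (v := v) ha hb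
  have h1 := Place.tame_ne (v := v) ha hb
  rw [Place.th, h.tame, ← hf _ (Or.inr (by rw [Place.ord_zpow, h0]; simp)), Place.res_zpow h1 h0, map_zpow₀, chi_zpow]
  rw [_root_.map_ne_zero]
  exact Place.res_tame_ne ha hb

lemma Above.th_one (h : Above w v e) {a b : K} (ha : a ≠ 0) (hb : b ≠ 0) (hv : v.th a b = 1) :
    w.th (algebraMap K L a) (algebraMap K L b) = 1 := by
  obtain ⟨f, hf⟩ := h.exists_map
  rw [h.th ha hb hf]
  split_ifs
  · rfl
  · rw [Place.th, chi_eq_one_iff] at hv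
    exact chi_eq_one_iff.2 (hv.map f)

lemma Above.th_one_of_nsq (h : Above w v e) {s : K} (hs0 : s ≠ 0) (hs : IsSquare (algebraMap K L s)) (hn : v.nsq s)
    {a b : K} (ha : a ≠ 0) (hb : b ≠ 0) :
    w.th (algebraMap K L a) (algebraMap K L b) = 1 := by
  obtain ⟨f, hf⟩ := h.exists_map
  rw [h.th ha hb hf]
  split_ifs with he
  · rfl
  obtain ⟨t, ht⟩ := hs
  have ht0 : t ≠ 0 := by
    rintro rfl
    simp at ht; exact hs0 ht
  have hord := congrArg w.ord ht
  rw [h.2, w.ord_mul _ _ ht0 ht0] at hord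
  have hev : Even (v.ord s) := by
    have : Even (e * v.ord s) := ⟨_, hord⟩
    rw [Int.even_mul] at this
    exact this.resolve_left he
  obtain ⟨m, hm⟩ := hev
  obtain ⟨q, hq, hqm⟩ := v.exists_ord m
  have hq2 : q ^ 2 ≠ 0 := pow_ne_zero _ hq
  have hs' : s / q ^ 2 ≠ 0 := div_ne_zero hs0 hq2
  have hs'o : v.ord (s / q ^ 2) = 0 := by rw [Place.ord_div v hs0 hq2, Place.ord_pow, hqm, hm]; push_cast; ring
  have hle : v.le 0 (s / q ^ 2) := Or.inr hs'o.ge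
  have hns : ¬ IsSquare (v.res (s / q ^ 2)) := by
    intro hsq
    obtain ⟨g, hg, hsg⟩ := hn
    have : s = (s / q ^ 2) * q ^ 2 := by field_simp
    rw [this, Place.th_mul_left hs' hq2 hg, Place.th_sq_left hq hg, Place.th_unit hs' hs'o, chi_eq_one_iff.2 hsq] at hsg
    simp at hsg
  have hfs : IsSquare (f (v.res (s / q ^ 2))) := by
    refine ⟨w.res (t / algebraMap K L q), ?_⟩
    have hl : w.le 0 (t / algebraMap K L q) := by
      right
      rw [Place.ord_div w ht0 (by simpa using hq), h.2, hqm]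
      rw [hm] at hord
      have : 2 * (w.ord t - e * m) = 0 := by linarith
      omega
    rw [hf _ hle, ← Place.res_mul hl hl]
    congr 1
    rw [map_div₀, ht, map_pow]
    field_simp
  set r := v.res (v.tame a b)
  have hr : r ≠ 0 := Place.res_tame_ne ha hb
  have hss := Place.res_ne_zero hs' hs'o
  rcases chi_cases r with h1 | h1
  · rw [chi_eq_one_iff] at h1 ⊢; exact h1.map f
  · have h3 : chi (r * v.res (s / q ^ 2)) = 1 := by
      rw [chi_mul hr hss, h1, chi_eq_neg_one_iff.2 hns]; norm_num
    rw [chi_eq_one_iff] at h3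
    have h4 := h3.map f
    rw [chi_eq_one_iff]
    rw [map_mul] at h4
    have := h4.div hfs
    rwa [mul_div_cancel_right₀] at this
    rwa [_root_.map_ne_zero]
end
end TAD

namespace TAD
open IntermediateField Polynomial

section
variable {F K L : Type*} [Field F] [Finite F] [NeZero (2 : F)] [Field K] [Field L] [Algebra K L]
  [Algebra F K] [Algebra F L] [IsScalarTower F K L] [GF F K] [GF F L] {u : F}

lemma Nm_of_slot_const (Q : QE K L (algebraMap F K u))
    (hex : ∀ x : K, IsAlgebraic F x → ∃ c : F, algebraMap F K c = x) (hu : ¬ IsSquare u) {a b : K} (ha : a ≠ 0)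
    (hb : b ≠ 0) (h : ∀ v : Place K, v.th a b = 1) (hs : Slot a b (algebraMap F K u)) : Nm a b := by
  obtain ⟨x, hx, h1, h2⟩ := hs
  have hu0 := Q.u0
  have hux : Nm (algebraMap F K u) x := by
    refine Q.HPconst hex hu hx fun v => ?_
    have := finite_κ (F := F) v
    have e1 := th_of_Nm (v := v) ha (mul_ne_zero hb hx) h1
    have e2 := th_of_Nm (v := v) hx (mul_ne_zero ha hu0) h2
    rw [Place.th_mul_right ha hb hx, h v, one_mul] at e1
    rw [Place.th_mul_right hx ha hu0, Place.th_symm hx ha, e1, one_mul, Place.th_symm hx hu0] at e2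
    exact e2
  have h3 : Nm x (algebraMap F K u) := Nm.symm Q.two hu0 hx hux
  have h4 : Nm x a := Nm.of_mul hu0 h2 h3
  exact Nm.of_mul hx h1 (Nm.symm Q.two hx ha h4)

lemma isSquare_of_even {E : Type*} [Field E] [Algebra F E] [Algebra K E] [IsScalarTower F K E]
    (hex : ∀ x : K, IsAlgebraic F x → ∃ c : F, algebraMap F K c = x) (hu : ¬ IsSquare u) {ζ : E} (hζ : IsAlgebraic F ζ)
    (htop : K⟮ζ⟯ = ⊤) (hev : Even (Module.finrank K E)) : IsSquare (algebraMap F E u) := by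
  have hi := hζ.isIntegral
  have e1 : Module.finrank F F⟮ζ⟯ = Module.finrank K E := by
    rw [IntermediateField.adjoin.finrank hi, ← IntermediateField.finrank_top' (F := K) (E := E), ← htop,
      IntermediateField.adjoin.finrank hi.tower_top, minpoly_eq hex hζ, natDegree_map]
  have : FiniteDimensional F F⟮ζ⟯ := IntermediateField.adjoin.finiteDimensional hi
  have : Finite F⟮ζ⟯ := Module.finite_of_finite F
  have h := (isSquare_ext F (k := F⟮ζ⟯) hu).2 (by rwa [e1])
  exact h.map (algebraMap F⟮ζ⟯ E)

lemma exists_nonsq (F : Type*) [Field F] [Finite F] [NeZero (2 : F)] : ∃ u : F, ¬ IsSquare u :=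
  FiniteField.exists_nonsquare (by
    intro h
    have : CharP F 2 := by rw [← h]; infer_instance
    exact NeZero.ne (2 : F) (by exact_mod_cast CharP.cast_eq_zero F 2))

lemma nsq_const (hex : ∀ x : K, IsAlgebraic F x → ∃ c : F, algebraMap F K c = x) (hu : ¬ IsSquare u) :
    ¬ IsSquare (algebraMap F K u) := by
  rintro ⟨r, hr⟩
  have : IsAlgebraic F r := by
    have : IsAlgebraic F (r ^ 2) := by rw [pow_two, ← hr]; exact isAlgebraic_algebraMap u
    exact this.of_pow two_pos
  obtain ⟨c, rfl⟩ := hex r this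
  exact hu ⟨c, (algebraMap F K).injective (by rw [hr, map_mul])⟩

end

section
universe u
variable {F : Type*} {E : Type*} [Field F] [Finite F] [NeZero (2 : F)] [Field E] [Algebra F E]

theorem hp_aux {ζ : E} (hζ : IsAlgebraic F ζ) : ∀ n : ℕ, ∀ (K : Type u) [Field K] [Algebra F K] [GF F K]
    [Algebra K E] [IsScalarTower F K E] (_ : FiniteDimensional K E) (_ : K⟮ζ⟯ = ⊤) (_ : Module.finrank K E = n)
    (a b : K) (_ : a ≠ 0) (_ : b ≠ 0) (_ : ∀ v : Place K, v.th a b = 1)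
    (_ : Nm (algebraMap K E a) (algebraMap K E b)), Nm a b := by
  intro n
  induction n using Nat.strong_induction_on with
  | _ n ih =>
  intro K _ _ _ _ _ hfd htop hn a b ha hb hv hE
  have h2 := two_ne F (K := K)
  rcases Nat.even_or_odd n with hev | hodd
  swap
  · exact Nm_of_odd h2 (E := E) (hn ▸ hodd) ha hb hE
  obtain ⟨u, hu⟩ := exists_nonsq (algebraicClosure F K)
  have hsq : IsSquare (algebraMap (algebraicClosure F K) E u) :=
    isSquare_of_even (K := K) exact_ac hu (hζ.tower_top _) htop (hn ▸ hev)
  obtain ⟨t, ht⟩ := hsq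
  set u' := algebraMap (algebraicClosure F K) K u with hu'
  have hu2 : ¬ IsSquare u' := nsq_const exact_ac hu
  have := fact_of_nsq hu2
  let Q := QE.mk' h2 hu2
  let K1 := QuadraticAlgebra K u' 0
  let f : K1 →ₐ[K] E := QuadraticAlgebra.lift ⟨t, by
    rw [← ht, IsScalarTower.algebraMap_apply _ K E]; simp [Algebra.smul_def, hu']⟩
  letI : Algebra K1 E := f.toRingHom.toAlgebra
  haveI : IsScalarTower K K1 E := IsScalarTower.of_algebraMap_eq fun x => (f.commutes x).symm
  haveI : IsScalarTower F K K1 := inferInstance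
  haveI : IsScalarTower F K1 E := IsScalarTower.of_algebraMap_eq fun x => by
    rw [IsScalarTower.algebraMap_apply F K K1, ← IsScalarTower.algebraMap_apply K K1 E, ← IsScalarTower.algebraMap_apply F K E]
  haveI : FiniteDimensional K K1 := Q.fd
  haveI : GF F K1 := GF.ext (K := K) K1
  haveI : GF (algebraicClosure F K) K1 := GF.ext (K := K) K1
  haveI : FiniteDimensional K1 E := FiniteDimensional.right K K1 E
  have hmul := Module.finrank_mul_finrank K K1 E
  have hd : Module.finrank K K1 = 2 := QuadraticAlgebra.finrank_eq_two _ _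
  have hpos : 0 < n := hn ▸ Module.finrank_pos
  have htop1 : K1⟮ζ⟯ = ⊤ := by
    rw [eq_top_iff]
    intro z _
    have : z ∈ K⟮ζ⟯ := htop ▸ mem_top
    have hle : K⟮ζ⟯ ≤ (K1⟮ζ⟯).restrictScalars K := by
      rw [adjoin_simple_le_iff]
      exact mem_adjoin_simple_self K1 ζ
    exact hle this
  have hN : Nm (algebraMap K K1 a) (algebraMap K K1 b) := by
    refine ih (Module.finrank K1 E) (by rw [hd] at hmul; omega) K1 inferInstance htop1 rfl _ _ ?_ ?_ ?_ ?_
    · exact (_root_.map_ne_zero _).2 ha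
    · exact (_root_.map_ne_zero _).2 hb
    · intro w
      obtain ⟨v, e, h⟩ := exists_restrict (K := K) w
      have := finite_κ (F := F) v
      have := finite_κ (F := F) w
      exact h.th_one ha hb (hv v)
    · rwa [← IsScalarTower.algebraMap_apply, ← IsScalarTower.algebraMap_apply]
  exact Nm_of_slot_const Q exact_ac hu ha hb hv (slot_of_ext Q ha hb hN)

end

section
variable (F : Type*) {K : Type*} [Field F] [Finite F] [NeZero (2 : F)] [Field K] [Algebra F K] [GF F K]
include F

omit [NeZero (2 : F)] [Finite F] [GF F K] in
lemma adjoin_gen_top {Ω : Type*} [Field Ω] [Algebra K Ω] (ζ : Ω) : K⟮AdjoinSimple.gen K ζ⟯ = ⊤ := by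
  apply IntermediateField.map_injective (K⟮ζ⟯).val
  rw [IntermediateField.adjoin_map, ← AlgHom.fieldRange_eq_map]
  simp

theorem HP_gen {Ω : Type*} [Field Ω] [Algebra K Ω] [Algebra F Ω] [IsScalarTower F K Ω] {ζ : Ω} (hζ : IsAlgebraic F ζ)
    {a b : K} (ha : a ≠ 0) (hb : b ≠ 0) (hv : ∀ v : Place K, v.th a b = 1)
    (hN : Nm (algebraMap K K⟮ζ⟯ a) (algebraMap K K⟮ζ⟯ b)) : Nm a b := by
  have hζF : IsAlgebraic F (AdjoinSimple.gen K ζ) := by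
    have : IsScalarTower F K⟮ζ⟯ Ω := IsScalarTower.of_algebraMap_eq fun x => by
      rw [IsScalarTower.algebraMap_apply F K K⟮ζ⟯, ← IsScalarTower.algebraMap_apply K K⟮ζ⟯ Ω,
        ← IsScalarTower.algebraMap_apply F K Ω]
    exact (isAlgebraic_algebraMap_iff (algebraMap K⟮ζ⟯ Ω).injective).1 hζ
  have : FiniteDimensional K K⟮ζ⟯ := adjoin.finiteDimensional hζ.isIntegral.tower_top
  exact hp_aux (F := F) (E := K⟮ζ⟯) hζF _ K this (adjoin_gen_top F ζ) rfl a b ha hb hv hN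

theorem HP_exact (hex : ∀ x : K, IsAlgebraic F x → ∃ c : F, algebraMap F K c = x)
    {a b : K} (ha : a ≠ 0) (hb : b ≠ 0) (hv : ∀ v : Place K, v.th a b = 1) : Nm a b := by
  obtain ⟨ζ, hζ, hN⟩ := tsen hex ha hb
  exact HP_gen F hζ ha hb hv hN

/-- Hasse principle -/
theorem HP {a b : K} (ha : a ≠ 0) (hb : b ≠ 0) (hv : ∀ v : Place K, v.th a b = 1) : Nm a b :=
  HP_exact (algebraicClosure F K) exact_ac ha hb hv

theorem HP2 {c r s : K} (hc : c ≠ 0) (hr : r ≠ 0) (hs : s ≠ 0) (h : ∀ v : Place K, v.th c r = -1 → v.nsq s) :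
    Slot c r s := by
  have h2 := two_ne F (K := K)
  by_cases hsq : IsSquare s
  · refine slot_of_Nm h2 (HP F hc hr fun v => ?_)
    have := finite_κ (F := F) v
    rcases Place.th_cases (v := v) c r with h1 | h1
    · exact h1
    · obtain ⟨g, hg, h3⟩ := h v h1
      obtain ⟨q, rfl⟩ := hsq
      rw [← pow_two, Place.th_sq_left (by rintro rfl; simp at hs) hg] at h3
      omega
  · have := fact_of_nsq hsq
    let Q := QE.mk' h2 hsq
    haveI := Q.fd
    haveI : GF F (QuadraticAlgebra K s 0) := GF.ext (K := K) _
    refine slot_of_ext Q hc hr (HP F ((_root_.map_ne_zero _).2 hc) ((_root_.map_ne_zero _).2 hr) fun w => ?_)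
    obtain ⟨v, e, hab⟩ := exists_restrict (K := K) w
    have := finite_κ (F := F) v
    have := finite_κ (F := F) w
    rcases Place.th_cases (v := v) c r with h1 | h1
    · exact hab.th_one hc hr h1
    · exact hab.th_one_of_nsq hs ⟨Q.s, by rw [← Q.hs, pow_two]⟩ (h v h1) hc hr

end
end TAD

namespace TAD
open IntermediateField Polynomial

section
variable {K : Type*} [Field K] {v : Place K} [Finite v.κ]

lemma slot_th {c r s x : K} (hc : c ≠ 0) (hr : r ≠ 0) (hs : s ≠ 0) (hx : x ≠ 0) (h1 : Nm c (r * x))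
    (h2 : Nm x (c * s)) : v.th s x = v.th c r := by
  have h1 := th_of_Nm (v := v) hc (mul_ne_zero hr hx) h1
  have h2 := th_of_Nm (v := v) hx (mul_ne_zero hc hs) h2
  rw [Place.th_mul_right hc hr hx] at h1
  rw [Place.th_mul_right hx hc hs, Place.th_symm hx hc, Place.th_symm hx hs] at h2
  rcases Place.th_cases (v := v) c x with h | h <;> rw [h] at h1 h2 <;> linarith

lemma chi_res_eq_one_iff {t : K} (ht : v.le 0 t) :
    chi (v.res t) = 1 ↔ ∃ r, v.le 0 r ∧ v.le 1 (t - r ^ 2) := by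
  rw [chi_eq_one_iff]
  constructor
  · rintro ⟨c, hc⟩
    obtain ⟨r, hr, rfl⟩ := v.res_surj c
    refine ⟨r, hr, ?_⟩
    rw [← Place.res_eq_iff ht (hr.pow0 2), hc, Place.res_pow hr, pow_two]
  · rintro ⟨r, hr, h⟩
    rw [← Place.res_eq_iff ht (hr.pow0 2)] at h
    exact ⟨v.res r, by rw [h, Place.res_pow hr, pow_two]⟩

end

section
variable {F K : Type*} [Field F] [Finite F] [NeZero (2 : F)] [Field K] [Algebra F K] [GF F K] {u : F}

lemma even_degD {D : Dv K} (hD : D ∈ evenDiv F K) : Even (degD F D) := by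
  rw [degD_apply]
  refine Finset.even_sum _ fun v _ => ?_
  rcases Nat.even_or_odd (v.deg F) with h | h
  · exact Even.mul_left (by exact_mod_cast h) _
  · exact (hD v h).mul_right _

theorem REC (hu : ¬ IsSquare u) {o : Place K} (ho : Odd (o.deg F)) {c r : K} (hc : c ≠ 0) (hr : r ≠ 0)
    (h : o.th c r = -1) : ∃ v, v ≠ o ∧ v.th c r = -1 := by
  classical
  by_contra hno
  push Not at hno
  have hu0 : algebraMap F K u ≠ 0 := by
    rw [_root_.map_ne_zero]; rintro rfl; exact hu ⟨0, by simp⟩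
  obtain ⟨x, hx, h1, h2⟩ := HP2 F hc hr hu0 (fun v hv => by
    have hvo : v = o := by
      by_contra hne
      exact hno v hne hv
    subst hvo
    exact nsq_of_unit F hu0 (Place.ord_const v u) (by rw [isSquare_res_const F v hu]; simpa using ho))
  have hth : ∀ v : Place K, (if Even (v.ord x) ∨ Even (v.deg F) then (1 : ℤ) else -1) = v.th c r := fun v => by
    have := finite_κ (F := F) v
    rw [← th_const F v hu, slot_th hc hr hu0 hx h1 h2]
  have hox : Odd (o.ord x) := by
    have := hth o
    rw [h] at this
    split_ifs at this with h'
    push Not at h'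
    simpa using h'.1
  have hD : divi F x - Finsupp.single o (o.ord x) ∈ evenDiv F K := by
    intro v hv
    by_cases hvo : v = o
    · subst hvo; simp
    · have := hth v
      have hne := hno v hvo
      rw [← this] at hne
      split_ifs at hne with h'
      · rcases h' with h' | h'
        · simpa [Finsupp.single_apply, Ne.symm hvo] using h'
        · exact absurd hv (by simpa using h')
      · exact absurd rfl hne
  have := even_degD hD
  rw [map_sub, degD_divi, degD_single, zero_sub, even_neg, Int.even_mul] at this
  rcases this with h' | h'
  · exact absurd hox (by simpa using h')
  · have : Even (o.deg F) := by exact_mod_cast h'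
    exact absurd ho (by simpa using this)

lemma EX_odd (hu : ¬ IsSquare u) {o v : Place K} (ho : Odd (o.deg F)) (hv : Odd (v.deg F)) (hne : v ≠ o) :
    ∃ y z : K, y ≠ 0 ∧ z ≠ 0 ∧ ∀ v', v'.th y z = -1 ↔ v' = v ∨ v' = o := by
  classical
  obtain ⟨D, hD, x, hx, hDx⟩ := lfunction_lemma (F := F)
    (Finsupp.single v (o.deg F : ℤ) - Finsupp.single o (v.deg F : ℤ)) (by
      rw [map_sub, degD_single, degD_single]; ring)
  have hu0 : algebraMap F K u ≠ 0 := by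
    rw [_root_.map_ne_zero]; rintro rfl; exact hu ⟨0, by simp⟩
  refine ⟨algebraMap F K u, x, hu0, hx, fun v' => ?_⟩
  rw [th_const F v' hu]
  have hap := DFunLike.congr_fun hDx v'
  simp only [Finsupp.coe_sub, Finsupp.coe_add, Pi.sub_apply, Pi.add_apply, Finsupp.single_apply, divi_apply] at hap
  have key : Odd (v'.deg F) → (Even (v'.ord x) ↔ ¬ (v' = v ∨ v' = o)) := by
    intro hd
    obtain ⟨k, hk⟩ := hD v' hd
    by_cases h1 : v = v'
    · subst h1
      simp only [hne.symm, if_true, if_false] at hap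
      obtain ⟨m, hm⟩ := ho
      have : Odd (v.ord x) := ⟨m - k, by rw [hm] at hap; push_cast at hap; omega⟩
      simpa using this
    · by_cases h2 : o = v'
      · subst h2
        simp only [h1, if_true, if_false] at hap
        obtain ⟨m, hm⟩ := hv
        have : Odd (o.ord x) := ⟨-m - 1 - k, by rw [hm] at hap; push_cast at hap; omega⟩
        simpa using this
      · simp only [h1, h2, if_false] at hap
        simp only [Ne.symm h1, Ne.symm h2, or_self, not_false_eq_true, iff_true]
        exact ⟨-k, by omega⟩
  by_cases hd : Odd (v'.deg F)
  · have hd' : ¬ Even (v'.deg F) := by simpa using hd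
    by_cases hx' : Even (v'.ord x)
    · simp [hx', (key hd).1 hx']
    · have := mt (key hd).2 hx'
      rw [not_not] at this
      simp [hx', hd', this]
  · have hd' : Even (v'.deg F) := by simpa using hd
    have h1 : v' ≠ v := by rintro rfl; exact hd hv
    have h2 : v' ≠ o := by rintro rfl; exact hd ho
    simp [hd', h1, h2]

end

section
variable {F K L : Type*} [Field F] [Finite F] [NeZero (2 : F)] [Field K] [Field L] [Algebra K L]
  [Algebra F K] [Algebra F L] [IsScalarTower F K L] [GF F K] [GF F L] {u : F}
  (Q : QE K L (algebraMap F K u))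

include Q

lemma QE.act_tame (w : Place L) (a b : L) : w.tame (Q.σ a) (Q.σ b) = Q.σ ((Q.act w).tame a b) := by
  simp [Place.tame]

lemma QE.act_th {w : Place L} {a b : L} (ha : a ≠ 0) (hb : b ≠ 0) : (Q.act w).th a b = w.th (Q.σ a) (Q.σ b) := by
  have := finite_κ (F := F) w
  have := finite_κ (F := F) (Q.act w)
  have ha' : Q.σ a ≠ 0 := by simpa using ha
  have hb' : Q.σ b ≠ 0 := by simpa using hb
  have key : (Q.act w).th a b = 1 ↔ w.th (Q.σ a) (Q.σ b) = 1 := by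
    unfold Place.th
    rw [chi_res_eq_one_iff (Place.le_tame ha hb), chi_res_eq_one_iff (Place.le_tame ha' hb'), Q.act_tame]
    constructor
    · rintro ⟨r, h1, h2⟩
      refine ⟨Q.σ r, Q.act_le.1 h1, ?_⟩
      have := Q.act_le.1 h2
      simpa using this
    · rintro ⟨r, h1, h2⟩
      refine ⟨Q.σ r, Q.act_le.2 (by rwa [Q.σσ]), Q.act_le.2 ?_⟩
      simpa [Q.σσ] using h2
  rcases Place.th_cases (v := Q.act w) a b with h | h <;> rcases Place.th_cases (v := w) (Q.σ a) (Q.σ b) with h' | h' <;>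
    rw [h, h'] at key ⊢ <;> simp at key

lemma QE.th_split {w : Place L} {v : Place K} (h : Above w v 1) (hw : Q.act w ≠ w) {x : K} {y : L} (hx : x ≠ 0) (hy : y ≠ 0) :
    v.th x (Q.nrm y) = w.th (algebraMap K L x) y * (Q.act w).th (algebraMap K L x) y := by
  have := finite_κ (F := F) w
  have := finite_κ (F := F) v
  have hx' : algebraMap K L x ≠ 0 := by simpa using hx
  have hy' : Q.σ y ≠ 0 := by simpa using hy
  have hN := Q.nrm_ne hy
  obtain ⟨f, hf⟩ := h.exists_map
  rw [Q.act_th hx' hy, AlgEquiv.commutes, ← Place.th_mul_right hx' hy hy', ← Q.alg_nrm, h.th hx hN hf]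
  simp only [Int.not_even_one, if_false]
  rw [Place.th]
  set t := v.res (v.tame x (Q.nrm y))
  have key : chi (f t) = 1 ↔ chi t = 1 := by
    rw [chi_eq_one_iff, chi_eq_one_iff]
    refine ⟨fun ⟨c, hc⟩ => ?_, fun h => h.map f⟩
    obtain ⟨z, hz, rfl⟩ := Q.surj_of_ne hw h c
    refine ⟨v.res z, f.injective ?_⟩
    rw [hc, map_mul, hf z hz]
  rcases chi_cases (f t) with h | h <;> rcases chi_cases t with h' | h' <;>
    rw [h, h'] at key ⊢ <;> simp at key

lemma QE.chi_inert1 {w : Place L} {v : Place K} (h : Above w v 1) (hw : Q.act w = w) {t : L} (ht : w.le 0 t)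
    (h1 : chi (w.res t) = 1) : chi (v.res (Q.nrm t)) = 1 := by
  have := finite_κ (F := F) w
  have := finite_κ (F := F) v
  have hact : ∀ {n z}, w.le n z → w.le n (Q.σ z) := fun {n z} hz => Q.act_le.1 (by rwa [hw])
  have hnrm : ∀ {z}, w.le 0 z → v.le 0 (Q.nrm z) := fun {z} hz => by
    have := hz.mul0 (hact hz)
    rw [← Q.alg_nrm] at this
    exact h.le_iff.1 this
  obtain ⟨r, hr, hr1⟩ := (chi_res_eq_one_iff ht).1 h1
  refine (chi_res_eq_one_iff (hnrm ht)).2 ⟨Q.nrm r, hnrm hr, ?_⟩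
  rw [← h.le_iff1, map_sub, map_pow, Q.alg_nrm, Q.alg_nrm]
  have e : t * Q.σ t - (r * Q.σ r) ^ 2 = (t - r ^ 2) * Q.σ t + r ^ 2 * Q.σ (t - r ^ 2) := by
    simp only [map_sub, map_pow]; ring
  rw [e]
  have a1 := hr1.mul (hact ht)
  have a2 := (hr.pow0 2).mul (hact hr1)
  rw [add_zero] at a1; rw [zero_add] at a2
  exact a1.add a2

lemma QE.ord_nrm {w : Place L} {v : Place K} (h : Above w v 1) (hw : Q.act w = w) {y : L} (hy : y ≠ 0) :
    v.ord (Q.nrm y) = 2 * w.ord y := by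
  have := h.2 (Q.nrm y)
  have e : w.ord (Q.σ y) = w.ord y := by rw [← Q.act_ord, hw]
  rw [Q.alg_nrm, w.ord_mul _ _ hy (by simpa using hy), e] at this
  linarith

lemma QE.chi_inert {w : Place L} {v : Place K} (h : Above w v 1) (hw : Q.act w = w) {t : L} (ht : t ≠ 0)
    (ht0 : w.ord t = 0) : chi (v.res (Q.nrm t)) = chi (w.res t) := by
  have := finite_κ (F := F) w
  have := finite_κ (F := F) v
  obtain ⟨Z, hZ, hZ0, hZn⟩ : ∃ Z : L, Z ≠ 0 ∧ w.ord Z = 0 ∧ chi (v.res (Q.nrm Z)) = -1 := by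
    obtain ⟨ε, hε, hε0, hεs⟩ := exists_eps F v
    have hFin := Fintype.ofFinite v.κ
    have hu0 : v.res (algebraMap F K u) ≠ 0 := Place.res_ne_zero Q.u0 (Place.ord_const v u)
    obtain ⟨a, b, hab⟩ := FiniteField.exists_root_sum_quadratic (R := v.κ)
      (f := X ^ 2 - C (v.res ε)) (g := C (- v.res (algebraMap F K u)) * X ^ 2)
      (degree_X_pow_sub_C two_pos _) (degree_C_mul_X_pow 2 (neg_ne_zero.2 hu0)) (by
        rw [Fintype.card_eq_nat_card, Place.card_κ (F := F)]; exact Nat.odd_iff.1 ((card_odd F).pow))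
    obtain ⟨A, hA, rfl⟩ := v.res_surj a
    obtain ⟨B, hB, rfl⟩ := v.res_surj b
    simp only [eval_sub, eval_pow, eval_X, eval_C, eval_mul] at hab
    have hnr : Q.nrm (algebraMap K L A + algebraMap K L B * Q.s) = A ^ 2 - algebraMap F K u * B ^ 2 := by
      apply (algebraMap K L).injective
      rw [Q.alg_nrm]
      have := Q.hs
      simp only [map_add, map_mul, AlgEquiv.commutes, Q.σs, map_sub, map_pow]
      linear_combination (-(algebraMap K L) B ^ 2) * this
    set Z := algebraMap K L A + algebraMap K L B * Q.s
    have hres : v.res (Q.nrm Z) = v.res ε := by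
      rw [hnr, Place.res_sub (hA.pow0 2) ((Place.le_const v u).mul0 (hB.pow0 2)), Place.res_mul (Place.le_const v u) (hB.pow0 2),
        Place.res_pow hA, Place.res_pow hB]
      linear_combination hab
    have hne : v.res ε ≠ 0 := Place.res_ne_zero hε hε0
    have hle : v.le 0 (Q.nrm Z) := by
      rw [hnr]; exact (hA.pow0 2).sub ((Place.le_const v u).mul0 (hB.pow0 2))
    have hZ : Z ≠ 0 := by
      intro h0
      rw [← hres, h0] at hne
      apply hne
      have : Q.nrm (0 : L) = 0 := (algebraMap K L).injective (by rw [Q.alg_nrm]; simp)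
      rw [this, Place.res_zero]
    refine ⟨Z, hZ, ?_, by rw [hres, chi_eq_neg_one_iff]; exact hεs⟩
    have h3 := Q.ord_nrm h hw hZ
    have h4 : v.ord (Q.nrm Z) = 0 := by
      by_contra h0
      have h5 : 0 < v.ord (Q.nrm Z) := lt_of_le_of_ne ((Place.le_iff (Q.nrm_ne hZ)).1 hle) (Ne.symm h0)
      apply hne
      rw [← hres, Place.res_eq_zero_iff hle]
      exact Or.inr h5
    omega
  have hlt : w.le 0 t := Or.inr ht0.ge
  have hlZ : w.le 0 Z := Or.inr hZ0.ge
  have hrZ := Place.res_ne_zero hZ hZ0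
  have hrt := Place.res_ne_zero ht ht0
  have on : ∀ {z : L}, z ≠ 0 → w.ord z = 0 → v.ord (Q.nrm z) = 0 := fun {z} hz h0 => by
    rw [Q.ord_nrm h hw hz, h0]; rfl
  rcases chi_cases (w.res t) with h1 | h1
  · rw [h1, Q.chi_inert1 h hw hlt h1]
  · have hZ1 : chi (w.res Z) = -1 := by
      rcases chi_cases (w.res Z) with h2 | h2
      · rw [Q.chi_inert1 h hw hlZ h2] at hZn; omega
      · exact h2
    have h3 : chi (w.res (t * Z)) = 1 := by
      rw [Place.res_mul hlt hlZ, chi_mul hrt hrZ, h1, hZ1]; norm_num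
    have h4 := Q.chi_inert1 h hw (hlt.mul0 hlZ) h3
    rw [Q.nrm_mul, Place.res_mul (Or.inr (on ht ht0).ge) (Or.inr (on hZ hZ0).ge),
      chi_mul (Place.res_ne_zero (Q.nrm_ne ht) (on ht ht0)) (Place.res_ne_zero (Q.nrm_ne hZ) (on hZ hZ0)), hZn] at h4
    rw [h1]; linarith

lemma QE.th_inert {w : Place L} {v : Place K} (h : Above w v 1) (hw : Q.act w = w) {x : K} {y : L} (hx : x ≠ 0) (hy : y ≠ 0) :
    v.th x (Q.nrm y) = w.th (algebraMap K L x) y := by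
  have hx' : algebraMap K L x ≠ 0 := by simpa using hx
  rw [Place.th, Place.th, ← Q.chi_inert h hw (Place.tame_ne hx' hy) (Place.ord_tame hx' hy)]
  congr 2
  apply (algebraMap K L).injective
  rw [Q.alg_nrm]
  unfold Place.tame
  have hxo : w.ord (algebraMap K L x) = v.ord x := by rw [h.2]; ring
  rw [Q.ord_nrm h hw hy, hxo]
  simp only [map_mul, map_zpow₀, map_neg, map_one, Q.alg_nrm, AlgEquiv.commutes]
  have e1 : ((-1 : L)) ^ (v.ord x * (2 * w.ord y)) = 1 := Even.neg_one_zpow ⟨v.ord x * w.ord y, by ring⟩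
  have e2 : ((-1 : L)) ^ (v.ord x * w.ord y) * (-1 : L) ^ (v.ord x * w.ord y) = 1 := by
    rw [← mul_zpow]; simp
  rw [e1, two_mul, zpow_add₀ hx', mul_zpow]
  linear_combination (-((algebraMap K L) x ^ w.ord y * (algebraMap K L) x ^ w.ord y * (y ^ (-v.ord x) * Q.σ y ^ (-v.ord x)))) * e2

end

lemma finrank_tower_aux (F F' k : Type*) [Field F] [Field F'] [Field k] [Algebra F F'] [Algebra F' k] [Algebra F k]
    [IsScalarTower F F' k] : Module.finrank F k = Module.finrank F F' * Module.finrank F' k :=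
  (Module.finrank_mul_finrank F F' k).symm

lemma deg_tower (F : Type*) {K F' : Type*} [Field F] [Finite F] [Field K] [Field F'] [Finite F'] [Algebra F K] [Algebra F F'] [Algebra F' K]
    [IsScalarTower F F' K] (v : Place K) : v.deg F = Module.finrank F F' * v.deg F' := by
  have : IsScalarTower F F' v.κ := IsScalarTower.of_algebraMap_eq fun x => by
    rw [Place.algebraMap_κ, Place.algebraMap_κ, IsScalarTower.algebraMap_apply F F' K]
  unfold Place.deg
  exact finrank_tower_aux F F' v.κ

lemma even_ac {F K L : Type*} [Field F] [Finite F] [NeZero (2 : F)] [Field K] [Field L] [Algebra K L]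
    [Algebra F K] [Algebra F L] [IsScalarTower F K L] [GF F K] [GF F L] {u : F}
    (Q : QE K L (algebraMap F K u)) (hu : ¬ IsSquare u) : Even (Module.finrank F (algebraicClosure F L)) := by
  rw [← isSquare_ext F (k := algebraicClosure F L) hu]
  have hs : Q.s ^ 2 = algebraMap F L u := by rw [Q.hs, ← IsScalarTower.algebraMap_apply]
  have halg : IsAlgebraic F Q.s := by
    have : IsAlgebraic F (Q.s ^ 2) := by rw [hs]; exact isAlgebraic_algebraMap u
    exact this.of_pow two_pos
  refine ⟨⟨Q.s, mem_algebraicClosure_iff'.2 halg.isIntegral⟩, ?_⟩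
  apply Subtype.ext
  rw [IntermediateField.coe_mul, ← pow_two]
  exact hs.symm

universe u
theorem EX_aux : ∀ n : ℕ, ∀ (F K : Type u) [Field F] [Finite F] [NeZero (2 : F)] [Field K] [Algebra F K] [GF F K]
    (_ : ∀ x : K, IsAlgebraic F x → ∃ c : F, algebraMap F K c = x)
    (o v : Place K) (_ : Odd (o.deg F)) (_ : v ≠ o) (_ : v.deg F = n),
    ∃ y z : K, y ≠ 0 ∧ z ≠ 0 ∧ ∀ v', v'.th y z = -1 ↔ v' = v ∨ v' = o := by
  intro n
  induction n using Nat.strong_induction_on with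
  | _ n ih =>
  intro F K _ _ _ _ _ _ hex o v ho hne hn
  classical
  obtain ⟨u, hu⟩ := exists_nonsq F
  rcases Nat.even_or_odd n with hev | hodd
  swap
  · exact EX_odd hu ho (hn ▸ hodd) hne
  have h2 := two_ne F (K := K)
  have hu2 : ¬ IsSquare (algebraMap F K u) := nsq_const hex hu
  have := fact_of_nsq hu2
  let Q := QE.mk' h2 hu2
  let M := QuadraticAlgebra K (algebraMap F K u) 0
  haveI := Q.fd
  haveI : GF F M := GF.ext (K := K) M
  have hpos : 0 < v.deg F := Place.deg_pos (F := F) v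
  have hw : Q.act (Q.up v) ≠ Q.up v := by
    rw [Ne, Q.act_eq_iff (Q.above_up v) hu, hn]; simpa using hev
  have hwo : Q.act (Q.up o) = Q.up o := (Q.act_eq_iff (Q.above_up o) hu).2 ho
  obtain ⟨m, hm⟩ := even_ac Q hu
  have d1 := deg_tower F (F' := algebraicClosure F M) (Q.up v)
  have d2 := deg_tower F (F' := algebraicClosure F M) (Q.up o)
  rw [Q.deg_of_ne hw (Q.above_up v), hm] at d1
  rw [Q.deg_of_eq hwo (Q.above_up o), hm] at d2
  have hodd : Odd ((Q.up o).deg (algebraicClosure F M)) := by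
    have : o.deg F = m * (Q.up o).deg (algebraicClosure F M) := by
      have : 2 * o.deg F = 2 * (m * (Q.up o).deg (algebraicClosure F M)) := by rw [d2]; ring
      omega
    rw [this] at ho
    exact (Nat.odd_mul.1 ho).2
  have hmpos : 0 < m := by
    rcases Nat.eq_zero_or_pos m with rfl | h
    · simp at d1; omega
    · exact h
  have hlt : (Q.up v).deg (algebraicClosure F M) < n := by
    rw [← hn, d1]
    have : 0 < (Q.up v).deg (algebraicClosure F M) := Place.deg_pos (F := algebraicClosure F M) _
    nlinarith
  have hne' : Q.up v ≠ Q.up o := fun h => hne (by rw [← Q.dn_up v, h, Q.dn_up])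
  obtain ⟨Y, Z, hY, hZ, hYZ⟩ := ih _ hlt (algebraicClosure F M) M exact_ac (Q.up o) (Q.up v) hodd hne' rfl
  obtain ⟨x, hx, hxv, hxo⟩ : ∃ x : K, x ≠ 0 ∧ v.ord x = 1 ∧ o.ord x = 1 := by
    choose p hp hp1 using fun w : Place K => w.exists_ord 1
    obtain ⟨x, hx⟩ := Place.weak_approx {v, o} p 2
    have a1 := Place.ord_eq_of_sub (hp v) (by rw [hp1]; exact hx v (by simp))
    have a2 := Place.ord_eq_of_sub (hp o) (by rw [hp1]; exact hx o (by simp))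
    exact ⟨x, a1.1, by rw [a1.2, hp1], by rw [a2.2, hp1]⟩
  have hx' : algebraMap K M x ≠ 0 := by simpa using hx
  obtain ⟨y, hy, s1, s2⟩ := HP2 F hY hZ hx' (fun w hw => by
    apply nsq_of_odd F
    rcases (hYZ w).1 hw with rfl | rfl
    · rw [(Q.above_up v).2, hxv]; simp
    · rw [(Q.above_up o).2, hxo]; simp)
  have key : ∀ w : Place M, w.th (algebraMap K M x) y = -1 ↔ w = Q.up v ∨ w = Q.up o := fun w => by
    have := finite_κ (F := F) w
    rw [slot_th hY hZ hx' hy s1 s2, hYZ]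
  refine ⟨x, Q.nrm y, hx, Q.nrm_ne hy, fun v' => ?_⟩
  have hab := Q.above_up v'
  have up_inj : ∀ {a b : Place K}, Q.up a = Q.up b ↔ a = b := fun {a b} =>
    ⟨fun h => by rw [← Q.dn_up a, h, Q.dn_up], fun h => by rw [h]⟩
  by_cases hsp : Q.act (Q.up v') = Q.up v'
  · rw [Q.th_inert hab hsp hx hy, key, up_inj, up_inj]
  · have := finite_κ (F := F) (Q.up v')
    have := finite_κ (F := F) (Q.act (Q.up v'))
    rw [Q.th_split hab hsp hx hy]
    have hvo : v' ≠ o := by rintro rfl; exact hsp hwo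
    have k1 := key (Q.up v')
    have k2 := key (Q.act (Q.up v'))
    rw [up_inj, up_inj] at k1
    have e2 : Q.act (Q.up v') ≠ Q.up o := fun h => hvo (by
      rw [← Q.dn_up v', ← Q.dn_act, h, Q.dn_up])
    have e3 : Q.act (Q.up v') ≠ Q.up v := fun h => by
      have : v' = v := by rw [← Q.dn_up v', ← Q.dn_act, h, Q.dn_up]
      subst this; exact hsp h
    have k2' : (Q.act (Q.up v')).th (algebraMap K M x) y = 1 := by
      rcases Place.th_cases (v := Q.act (Q.up v')) (algebraMap K M x) y with h | h
      · exact h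
      · rcases k2.1 h with h | h
        · exact absurd h e3
        · exact absurd h e2
    rw [k2', mul_one, k1]

section
variable {F K : Type u} [Field F] [Finite F] [NeZero (2 : F)] [Field K] [Algebra F K] [GF F K]

theorem EX (hex : ∀ x : K, IsAlgebraic F x → ∃ c : F, algebraMap F K c = x)
    {o v : Place K} (ho : Odd (o.deg F)) (hne : v ≠ o) :
    ∃ y z : K, y ≠ 0 ∧ z ≠ 0 ∧ ∀ v', v'.th y z = -1 ↔ v' = v ∨ v' = o :=
  EX_aux _ F K hex o v ho hne rfl

theorem exists_odd (hex : ∀ x : K, IsAlgebraic F x → ∃ c : F, algebraMap F K c = x) :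
    ∃ v : Place K, Odd (v.deg F) := by
  obtain ⟨u, hu⟩ := exists_nonsq F
  have h2 := two_ne F (K := K)
  have hu2 : ¬ IsSquare (algebraMap F K u) := nsq_const hex hu
  have := fact_of_nsq hu2
  let Q := QE.mk' h2 hu2
  haveI := Q.fd
  haveI : GF F (QuadraticAlgebra K (algebraMap F K u) 0) := GF.ext (K := K) _
  exact Q.T5 hex hu
end
end TAD

namespace TAD

section
variable {K : Type*} [Field K] {v : Place K} [Finite v.κ]

lemma nsq_iff_of_not {e a : K} (he : e ≠ 0) (ha : a ≠ 0) (h : ¬ v.nsq (e * a)) {g : K} (hg : g ≠ 0) :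
    v.th e g = v.th a g := by
  have h1 : v.th (e * a) g = 1 := by
    rcases Place.th_cases (v := v) (e * a) g with h' | h'
    · exact h'
    · exact absurd ⟨g, hg, h'⟩ h
  rw [Place.th_mul_left he ha hg] at h1
  rcases Place.th_cases (v := v) e g with h2 | h2 <;> rcases Place.th_cases (v := v) a g with h3 | h3 <;>
    rw [h2, h3] at h1 ⊢ <;> omega

lemma nsq_congr {e a : K} (he : e ≠ 0) (ha : a ≠ 0) (h : ¬ v.nsq (e * a)) : v.nsq e ↔ v.nsq a := by
  constructor
  · rintro ⟨g, hg, hg1⟩; exact ⟨g, hg, by rw [← nsq_iff_of_not he ha h hg]; exact hg1⟩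
  · rintro ⟨g, hg, hg1⟩; exact ⟨g, hg, by rw [nsq_iff_of_not he ha h hg]; exact hg1⟩

lemma nsq_mul_of_not {e g : K} (he : e ≠ 0) (hg : g ≠ 0) (h : ¬ v.nsq g) : v.nsq (e * g) ↔ v.nsq e := by
  have key : ∀ k : K, k ≠ 0 → v.th (e * g) k = v.th e k := by
    intro k hk
    rw [Place.th_mul_left he hg hk]
    rcases Place.th_cases (v := v) g k with h' | h'
    · rw [h', mul_one]
    · exact absurd ⟨k, hk, h'⟩ h
  constructor
  · rintro ⟨k, hk, hk1⟩; exact ⟨k, hk, by rw [← key k hk]; exact hk1⟩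
  · rintro ⟨k, hk, hk1⟩; exact ⟨k, hk, by rw [key k hk]; exact hk1⟩

end

section
variable {F K : Type*} [Field F] [Finite F] [NeZero (2 : F)] [Field K] [Algebra F K] [GF F K]

/-- signature of an element at a place -/
noncomputable def sig (v : Place K) (e p g : K) : Bool × Bool := (decide (v.th g e = 1), decide (v.th g p = 1))

include F in
lemma not_nsq_of_sig {v : Place K} {e p : K} (he : e ≠ 0) (h : v.ord e = 0) (hs : ¬ IsSquare (v.res e)) (hp : p ≠ 0)
    (hp1 : v.ord p = 1) {g g' : K} (hg : g ≠ 0) (hg' : g' ≠ 0) (hgg : sig v e p g = sig v e p g') : ¬ v.nsq (g * g') := by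
  have := finite_κ (F := F) v
  rw [sig, sig, Prod.mk.injEq, decide_eq_decide, decide_eq_decide] at hgg
  have key : ∀ k, k ≠ 0 → (v.th g k = 1 ↔ v.th g' k = 1) → v.th (g * g') k = 1 := by
    intro k hk h
    rw [Place.th_mul_left hg hg' hk]
    rcases Place.th_cases (v := v) g k with h2 | h2 <;> rcases Place.th_cases (v := v) g' k with h3 | h3 <;>
      rw [h2, h3] at h ⊢ <;> simp at h ⊢
  have hm := mul_ne_zero hg hg'
  have k1 := key e he hgg.1
  have k2 := key p hp hgg.2
  rintro ⟨k, hk, hk1⟩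
  set m := g * g'
  have hev : Even (v.ord m) := by
    rw [Place.th_symm hm he, th_eps (F := F) he h hs] at k1
    by_contra h'
    rw [if_neg h'] at k1; omega
  -- write k = p^n * unit
  set n := v.ord k
  have hpn : p ^ n ≠ 0 := zpow_ne_zero _ hp
  have hu : k / p ^ n ≠ 0 := div_ne_zero hk hpn
  have hu0 : v.ord (k / p ^ n) = 0 := by rw [Place.ord_div v hk hpn, Place.ord_zpow, hp1]; ring
  have e1 : v.th m (k / p ^ n) = 1 := by
    rw [Place.th_symm hm hu, Place.th_unit hu hu0, if_pos hev]
  have e2 : ∀ n : ℕ, v.th m (p ^ n) = 1 := by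
    intro n
    induction n with
    | zero => rw [pow_zero, Place.th_symm hm one_ne_zero, Place.th_one_left]
    | succ n ih => rw [pow_succ, Place.th_mul_right hm (pow_ne_zero _ hp) hp, ih, k2]; rfl
  have e3 : v.th m (p ^ n) = 1 := by
    rcases Int.eq_nat_or_neg n with ⟨j, hj | hj⟩
    · rw [hj, zpow_natCast, e2]
    · have hj' : p ^ j ≠ 0 := pow_ne_zero _ hp
      have h0 : p ^ n * p ^ j = 1 := by rw [hj, zpow_neg, zpow_natCast, inv_mul_cancel₀ hj']
      have := Place.th_mul_right (v := v) hm hpn hj'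
      rw [h0, e2, mul_one, Place.th_symm hm one_ne_zero, Place.th_one_left] at this
      exact this.symm
  have : k = p ^ n * (k / p ^ n) := by field_simp
  rw [this, Place.th_mul_right hm hpn hu, e1, e3] at hk1
  omega

variable (F) in
include F in
lemma exists_approx {o w : Place K} (how : w ≠ o) {g h : K} (hg : g ≠ 0) (hh : h ≠ 0) :
    ∃ k : K, k ≠ 0 ∧ ¬ o.nsq (k * g) ∧ ¬ w.nsq (k * h) := by
  classical
  have := finite_κ (F := F) o
  have := finite_κ (F := F) w
  obtain ⟨x, hx⟩ := Place.weak_approx {o, w} (fun v => if v = o then g else h) (max (o.ord g + 1) (w.ord h + 1))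
  have h1 := hx o (by simp)
  have h2 := hx w (by simp)
  simp only [if_true] at h1
  simp only [how, if_false] at h2
  have a1 := Place.ord_eq_of_sub hg (h1.mono (le_max_left _ _))
  refine ⟨x, a1.1, ?_, ?_⟩
  · rintro ⟨k, hk, hk1⟩
    rw [Place.th_mul_left a1.1 hg hk, Place.th_near hg hk (h1.mono (le_max_left _ _)), Place.th_mul_self] at hk1
    omega
  · rintro ⟨k, hk, hk1⟩
    rw [Place.th_mul_left a1.1 hh hk, Place.th_near hh hk (h2.mono (le_max_right _ _)), Place.th_mul_self] at hk1
    omega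


variable (F) in
include F in
lemma exists_reps {o w : Place K} (how : w ≠ o) :
    ∃ R : Finset K, (∀ e ∈ R, e ≠ 0) ∧ ∀ g h : K, g ≠ 0 → h ≠ 0 → ∃ e ∈ R, ¬ o.nsq (e * g) ∧ ¬ w.nsq (e * h) := by
  classical
  obtain ⟨e1, a1, a2, a3⟩ := exists_eps F o
  obtain ⟨e2, b1, b2, b3⟩ := exists_eps F w
  obtain ⟨p1, c1, c2⟩ := o.exists_ord 1
  obtain ⟨p2, d1, d2⟩ := w.exists_ord 1
  have hch : ∀ b : (Bool × Bool) × (Bool × Bool), ∃ k : K, k ≠ 0 ∧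
      ((∃ x, x ≠ 0 ∧ sig o e1 p1 x = b.1 ∧ sig w e2 p2 x = b.2) → sig o e1 p1 k = b.1 ∧ sig w e2 p2 k = b.2) := by
    intro b
    by_cases hb : ∃ x, x ≠ 0 ∧ sig o e1 p1 x = b.1 ∧ sig w e2 p2 x = b.2
    · obtain ⟨x, hx, h⟩ := hb
      exact ⟨x, hx, fun _ => h⟩
    · exact ⟨1, one_ne_zero, fun h => absurd h hb⟩
  choose k hk0 hk using hch
  refine ⟨Finset.univ.image k, ?_, ?_⟩
  · intro e he
    obtain ⟨b, _, rfl⟩ := Finset.mem_image.1 he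
    exact hk0 b
  · intro g h hg hh
    have := finite_κ (F := F) o
    have := finite_κ (F := F) w
    obtain ⟨x, hx, x1, x2⟩ := exists_approx F how hg hh
    set b := (sig o e1 p1 x, sig w e2 p2 x) with hb
    have hkb := hk b ⟨x, hx, rfl, rfl⟩
    refine ⟨k b, Finset.mem_image_of_mem _ (Finset.mem_univ _), ?_, ?_⟩
    · have h1 := not_nsq_of_sig (F := F) a1 a2 a3 c1 c2 (hk0 b) hx hkb.1
      rintro ⟨q, hq, hq1⟩
      rw [Place.th_mul_left (hk0 b) hg hq, nsq_iff_of_not (hk0 b) hx h1 hq, nsq_iff_of_not hx hg x1 hq,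
        Place.th_mul_self] at hq1
      omega
    · have h1 := not_nsq_of_sig (F := F) b1 b2 b3 d1 d2 (hk0 b) hx hkb.2
      rintro ⟨q, hq, hq1⟩
      rw [Place.th_mul_left (hk0 b) hh hq, nsq_iff_of_not (hk0 b) hx h1 hq, nsq_iff_of_not hx hh x2 hq,
        Place.th_mul_self] at hq1
      omega

variable (F) in
include F in
lemma exists_nsq (v : Place K) : ∃ e : K, e ≠ 0 ∧ v.nsq e := by
  obtain ⟨p, hp, hp1⟩ := v.exists_ord 1
  exact ⟨p, hp, nsq_of_odd F (by rw [hp1]; simp)⟩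

/-- elements that are squares at both places -/
def G0 (o w : Place K) (g : K) : Prop := g ≠ 0 ∧ ¬ o.nsq g ∧ ¬ w.nsq g
/-- elements that are nonsquares at both places -/
def N0 (o w : Place K) (g : K) : Prop := g ≠ 0 ∧ o.nsq g ∧ w.nsq g

include F in
lemma G0_iff {o w : Place K} {R : Finset K} (hR0 : ∀ e ∈ R, e ≠ 0)
    (hR : ∀ g h : K, g ≠ 0 → h ≠ 0 → ∃ e ∈ R, ¬ o.nsq (e * g) ∧ ¬ w.nsq (e * h)) (g : K) :
    G0 o w g ↔ g ≠ 0 ∧ ∀ e ∈ R, N0 o w e → N0 o w (e * g) := by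
  have := finite_κ (F := F) o
  have := finite_κ (F := F) w
  constructor
  · rintro ⟨h0, h1, h2⟩
    refine ⟨h0, fun e he hN => ⟨mul_ne_zero hN.1 h0, ?_, ?_⟩⟩
    · rw [nsq_mul_of_not hN.1 h0 h1]; exact hN.2.1
    · rw [nsq_mul_of_not hN.1 h0 h2]; exact hN.2.2
  · rintro ⟨h0, h⟩
    refine ⟨h0, fun hn => ?_, fun hn => ?_⟩
    · obtain ⟨t, ht, htn⟩ := exists_nsq F w
      obtain ⟨e, he, h1, h2⟩ := hR g t h0 ht
      exact h1 (h e he ⟨hR0 e he, (nsq_congr (hR0 e he) h0 h1).2 hn, (nsq_congr (hR0 e he) ht h2).2 htn⟩).2.1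
    · obtain ⟨t, ht, htn⟩ := exists_nsq F o
      obtain ⟨e, he, h1, h2⟩ := hR t g ht h0
      exact h2 (h e he ⟨hR0 e he, (nsq_congr (hR0 e he) ht h1).2 htn, (nsq_congr (hR0 e he) h0 h2).2 hn⟩).2.2

include F in
lemma th_iff {o w : Place K} {R : Finset K} (hR0 : ∀ e ∈ R, e ≠ 0)
    (hR : ∀ g h : K, g ≠ 0 → h ≠ 0 → ∃ e ∈ R, ¬ o.nsq (e * g) ∧ ¬ w.nsq (e * h)) {a b : K} (ha : a ≠ 0) (hb : b ≠ 0)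
    (v : Place K) (hv : v = o ∨ v = w) (τ : ℤ) :
    v.th a b = τ ↔ ∃ e ∈ R, ∃ e' ∈ R, G0 o w (e * a) ∧ G0 o w (e' * b) ∧ v.th e e' = τ := by
  have := finite_κ (F := F) v
  have key : ∀ e ∈ R, ∀ e' ∈ R, G0 o w (e * a) → G0 o w (e' * b) → v.th a b = v.th e e' := by
    intro e he e' he' h1 h2
    have n1 : ¬ v.nsq (e * a) := by rcases hv with rfl | rfl; exacts [h1.2.1, h1.2.2]
    have n2 : ¬ v.nsq (e' * b) := by rcases hv with rfl | rfl; exacts [h2.2.1, h2.2.2]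
    rw [nsq_iff_of_not (hR0 e he) ha n1 (hR0 e' he'), Place.th_symm ha (hR0 e' he'),
      nsq_iff_of_not (hR0 e' he') hb n2 ha, Place.th_symm hb ha]
  constructor
  · rintro rfl
    obtain ⟨e, he, h1, h2⟩ := hR a a ha ha
    obtain ⟨e', he', h1', h2'⟩ := hR b b hb hb
    have g1 : G0 o w (e * a) := ⟨mul_ne_zero (hR0 e he) ha, h1, h2⟩
    have g2 : G0 o w (e' * b) := ⟨mul_ne_zero (hR0 e' he') hb, h1', h2'⟩
    exact ⟨e, he, e', he', g1, g2, (key e he e' he' g1 g2).symm⟩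
  · rintro ⟨e, he, e', he', g1, g2, rfl⟩
    exact key e he e' he' g1 g2

include F in
lemma N0_iff {o w : Place K} {a0 b0 : K} (ha0 : a0 ≠ 0) (hb0 : b0 ≠ 0)
    (h0 : ∀ v' : Place K, v'.th a0 b0 = -1 ↔ v' = w ∨ v' = o) (s : K) :
    N0 o w s ↔ s ≠ 0 ∧ Slot a0 b0 s := by
  have := finite_κ (F := F) o
  have := finite_κ (F := F) w
  constructor
  · rintro ⟨hs, h1, h2⟩
    refine ⟨hs, HP2 F ha0 hb0 hs fun v hv => ?_⟩
    rcases (h0 v).1 hv with rfl | rfl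
    · exact h2
    · exact h1
  · rintro ⟨hs, h⟩
    exact ⟨hs, nsq_of_slot ha0 hb0 hs h ((h0 o).2 (Or.inr rfl)), nsq_of_slot ha0 hb0 hs h ((h0 w).2 (Or.inl rfl))⟩

variable (F) in
include F in
lemma exists_other (o : Place K) : ∃ w : Place K, w ≠ o := by
  classical
  by_contra h
  push Not at h
  obtain ⟨p, hp, hp1⟩ := o.exists_ord 1
  have hd := degD_divi (F := F) p
  have : divi F p = Finsupp.single o 1 := by
    ext v
    rw [h v]; simp [hp1]
  rw [this, degD_single] at hd
  have := Place.deg_pos (F := F) o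
  omega

/-- the certificate -/
def Cert (o w : Place K) (a0 b0 a b : K) : Prop :=
  o.th a b = -1 ∨ w.th a b = -1 ∨ ∃ s, s ≠ 0 ∧ ∃ x, x ≠ 0 ∧ ∃ x0, x0 ≠ 0 ∧ ∃ y, y ≠ 0 ∧ ∃ z, z ≠ 0 ∧
    Nm a (b * x) ∧ Nm x (a * s) ∧ Nm a0 (b0 * x0) ∧ Nm x0 (a0 * s) ∧ o.th y z = -1 ∧ w.th y z = 1 ∧
    Slot y z s ∧ Slot y z (x * x0) ∧ Slot y z (s * (x * x0)) ∧ Slot y z (-(s * (x * x0)))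

end

universe u
section
variable {F K : Type u} [Field F] [Finite F] [NeZero (2 : F)] [Field K] [Algebra F K] [GF F K]

theorem cert_iff (hex : ∀ x : K, IsAlgebraic F x → ∃ c : F, algebraMap F K c = x) {o w : Place K}
    (ho : Odd (o.deg F)) (how : w ≠ o) {a0 b0 : K} (ha0 : a0 ≠ 0) (hb0 : b0 ≠ 0)
    (h0 : ∀ v' : Place K, v'.th a0 b0 = -1 ↔ v' = w ∨ v' = o) {a b : K} (ha : a ≠ 0) (hb : b ≠ 0) :
    ¬ Nm a b ↔ Cert o w a0 b0 a b := by
  classical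
  have hfin : ∀ v : Place K, Finite v.κ := fun v => finite_κ (F := F) v
  have one_of : ∀ (v : Place K) (c r : K), v.th c r ≠ -1 → v.th c r = 1 := fun v c r h =>
    (Place.th_cases (v := v) c r).resolve_right h
  have sound : ∀ v : Place K, v.th a b = -1 → ¬ Nm a b := fun v hv hN => by
    rw [th_of_Nm ha hb hN] at hv; omega
  constructor
  · intro hN
    by_cases h1 : o.th a b = -1
    · exact Or.inl h1
    by_cases h2 : w.th a b = -1
    · exact Or.inr (Or.inl h2)
    refine Or.inr (Or.inr ?_)
    obtain ⟨v, hv⟩ : ∃ v : Place K, v.th a b = -1 := by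
      by_contra hno
      push Not at hno
      exact hN (HP F ha hb fun v => one_of _ _ _ (hno v))
    have hvo : v ≠ o := by rintro rfl; exact h1 hv
    have hvw : v ≠ w := by rintro rfl; exact h2 hv
    obtain ⟨y, z, hy, hz, hyz⟩ := EX hex ho hvo
    choose p hp hp1 using fun w : Place K => w.exists_ord 1
    choose ε hε hε0 hεs using fun w : Place K => exists_eps F w
    obtain ⟨s, hs⟩ := Place.weak_approx ((finite_Delta F ha hb).toFinset ∪ {w, o})
      (fun v' => if v' = v ∨ v' = o then ε v' else p v') 2
    have su : ∀ v', v' = v ∨ v' = o → s ≠ 0 ∧ v'.ord s = 0 ∧ ¬ IsSquare (v'.res s) := by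
      intro v' hv'
      have h1 := hs v' (by
        rcases hv' with rfl | rfl
        · simp [hv]
        · simp)
      rw [if_pos hv'] at h1
      have h2 := Place.ord_eq_of_sub (hε v') (by rw [hε0]; exact h1.mono (by norm_num))
      have h3 : v'.ord s = 0 := by rw [h2.2, hε0]
      refine ⟨h2.1, h3, ?_⟩
      have : v'.res s = v'.res (ε v') := (Place.res_eq_iff (Or.inr h3.ge) (Or.inr (hε0 v').ge)).2 (h1.mono (by norm_num))
      rw [this]; exact hεs v'
    have so : ∀ v', v'.th a b = -1 ∨ v' = w → v' ≠ v → v' ≠ o → Odd (v'.ord s) := by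
      intro v' hv' hn1 hn2
      have h1 := hs v' (by
        rcases hv' with h | rfl
        · simp [h]
        · simp)
      rw [if_neg (by tauto)] at h1
      have h2 := Place.ord_eq_of_sub (hp v') (by rw [hp1]; exact h1)
      rw [h2.2, hp1]; simp
    have hs0 : s ≠ 0 := (su v (Or.inl rfl)).1
    obtain ⟨x, hx, x1, x2⟩ := HP2 F ha hb hs0 (fun v' hv' => by
      by_cases hvv : v' = v
      · have := su v' (Or.inl hvv)
        exact nsq_of_unit F hs0 this.2.1 this.2.2
      · exact nsq_of_odd F (so v' (Or.inl hv') hvv (by rintro rfl; exact h1 hv')))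
    obtain ⟨x0, hx0, y1, y2⟩ := HP2 F ha0 hb0 hs0 (fun v' hv' => by
      rcases (h0 v').1 hv' with rfl | rfl
      · exact nsq_of_odd F (so v' (Or.inr rfl) (Ne.symm hvw) how)
      · have := su v' (Or.inr rfl)
        exact nsq_of_unit F hs0 this.2.1 this.2.2)
    have ex : ∀ v' : Place K, v'.th s x = v'.th a b := fun v' => slot_th ha hb hs0 hx x1 x2
    have ex0 : ∀ v' : Place K, v'.th s x0 = v'.th a0 b0 := fun v' => slot_th ha0 hb0 hs0 hx0 y1 y2
    have par : ∀ v', v' = v ∨ v' = o → ∀ c, (v'.th s c = -1 ↔ Odd (v'.ord c)) := by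
      intro v' hv' c
      have := su v' hv'
      rw [th_eps (F := F) hs0 this.2.1 this.2.2, ← Int.not_even_iff_odd]
      split_ifs with h
      · simp [h]
      · simp [h]
    have hxx : ∀ v', v' = v ∨ v' = o → Odd (v'.ord (x * x0)) := by
      intro v' hv'
      rw [v'.ord_mul _ _ hx hx0]
      have q1 := par v' hv' x
      have q2 := par v' hv' x0
      rw [ex] at q1; rw [ex0, h0] at q2
      rcases hv' with rfl | rfl
      · exact (q1.1 hv).add_even (Int.not_odd_iff_even.1 fun h => by
          rcases q2.2 h with h | h
          · exact hvw h
          · exact hvo h)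
      · exact (Int.not_odd_iff_even.1 fun h => h1 (q1.2 h)).add_odd (q2.1 (Or.inr rfl))
    have hxx0 := mul_ne_zero hx hx0
    have hsxx := mul_ne_zero hs0 hxx0
    have hsx : ∀ v', v' = v ∨ v' = o → Odd (v'.ord (s * (x * x0))) := by
      intro v' hv'
      rw [v'.ord_mul _ _ hs0 hxx0, (su v' hv').2.1, zero_add]
      exact hxx v' hv'
    refine ⟨s, hs0, x, hx, x0, hx0, y, hy, z, hz, x1, x2, y1, y2, (hyz o).2 (Or.inr rfl), ?_, ?_, ?_, ?_, ?_⟩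
    · apply one_of
      rw [Ne, hyz]
      rintro (h | h)
      · exact hvw h.symm
      · exact how h
    · exact HP2 F hy hz hs0 fun v' hv' =>
        nsq_of_unit F hs0 (su v' ((hyz v').1 hv')).2.1 (su v' ((hyz v').1 hv')).2.2
    · exact HP2 F hy hz hxx0 fun v' hv' => nsq_of_odd F (hxx v' ((hyz v').1 hv'))
    · exact HP2 F hy hz hsxx fun v' hv' => nsq_of_odd F (hsx v' ((hyz v').1 hv'))
    · exact HP2 F hy hz (neg_ne_zero.2 hsxx) fun v' hv' => nsq_of_odd F (by
        rw [Place.ord_neg]; exact hsx v' ((hyz v').1 hv'))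
  · rintro (h | h | ⟨s, hs, x, hx, x0, hx0, y, hy, z, hz, x1, x2, y1, y2, t1, t2, s1, s2, s3, s4⟩)
    · exact sound o h
    · exact sound w h
    · obtain ⟨u, hu⟩ := exists_nonsq F
      obtain ⟨v, hvo, hv⟩ := REC hu ho hy hz t1
      have hvw : v ≠ w := by rintro rfl; rw [hv] at t2; omega
      have hxx0 := mul_ne_zero hx hx0
      have hsxx := mul_ne_zero hs hxx0
      have key := Place.th_of_nsq (v := v) hxx0 hs (nsq_of_slot hy hz hxx0 s2 hv) (nsq_of_slot hy hz hs s1 hv)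
        (nsq_of_slot hy hz hsxx s3 hv) (nsq_of_slot hy hz (neg_ne_zero.2 hsxx) s4 hv)
      have k0 : v.th a0 b0 = 1 := one_of _ _ _ (by rw [Ne, h0]; tauto)
      rw [Place.th_mul_right hs hx hx0, slot_th ha hb hs hx x1 x2, slot_th ha0 hb0 hs hx0 y1 y2, k0, mul_one] at key
      exact sound v key
end
end TAD

namespace TAD

section
variable {K : Type*} [Field K] {ι : Type}

/-- polynomial functions -/
def PF (g : (ι → K) → K) : Prop := ∃ p : MvPolynomial ι K, ∀ a, g a = MvPolynomial.eval a p

lemma PF.const (c : K) : PF (fun _ : ι → K => c) := ⟨MvPolynomial.C c, fun a => by simp⟩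
lemma PF.coord (i : ι) : PF (fun a : ι → K => a i) := ⟨MvPolynomial.X i, fun a => by simp⟩
lemma PF.add {g h : (ι → K) → K} (hg : PF g) (hh : PF h) : PF (fun a => g a + h a) := by
  obtain ⟨p, hp⟩ := hg
  obtain ⟨q, hq⟩ := hh
  exact ⟨p + q, fun a => by simp [hp, hq]⟩
lemma PF.mul {g h : (ι → K) → K} (hg : PF g) (hh : PF h) : PF (fun a => g a * h a) := by
  obtain ⟨p, hp⟩ := hg
  obtain ⟨q, hq⟩ := hh
  exact ⟨p * q, fun a => by simp [hp, hq]⟩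
lemma PF.neg {g : (ι → K) → K} (hg : PF g) : PF (fun a => - g a) := by
  obtain ⟨p, hp⟩ := hg
  exact ⟨-p, fun a => by simp [hp]⟩
lemma PF.sub {g h : (ι → K) → K} (hg : PF g) (hh : PF h) : PF (fun a => g a - h a) := by
  obtain ⟨p, hp⟩ := hg
  obtain ⟨q, hq⟩ := hh
  exact ⟨p - q, fun a => by simp [hp, hq]⟩
lemma PF.sq {g : (ι → K) → K} (hg : PF g) : PF (fun a => g a ^ 2) := by
  obtain ⟨p, hp⟩ := hg
  exact ⟨p ^ 2, fun a => by simp [hp]⟩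
lemma PF.comap {ι' : Type} {g : (ι → K) → K} (hg : PF g) (r : ι → ι') : PF (fun p : ι' → K => g (p ∘ r)) := by
  obtain ⟨p, hp⟩ := hg
  exact ⟨MvPolynomial.rename r p, fun a => by rw [MvPolynomial.eval_rename]; exact hp _⟩
lemma PF.l {g : (ι → K) → K} (hg : PF g) : PF (fun p : ι ⊕ Unit → K => g (p ∘ Sum.inl)) := hg.comap _
lemma PF.last : PF (fun p : ι ⊕ Unit → K => p (Sum.inr ())) := PF.coord _

/-- diophantine predicates -/
def Dio (P : (ι → K) → Prop) : Prop :=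
  ∃ (κ : Type) (_ : Finite κ) (g : (ι ⊕ κ → K) → K), PF g ∧ ∀ a, P a ↔ ∃ x, g (Sum.elim a x) = 0

lemma Dio.congr {P Q : (ι → K) → Prop} (hP : Dio P) (h : ∀ a, Q a ↔ P a) : Dio Q := by
  obtain ⟨κ, hκ, g, hg, H⟩ := hP
  exact ⟨κ, hκ, g, hg, fun a => (h a).trans (H a)⟩

lemma Dio.eqz {g : (ι → K) → K} (hg : PF g) : Dio (fun a => g a = 0) :=
  ⟨Empty, inferInstance, fun p => g (p ∘ Sum.inl), hg.comap _, fun a => by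
    simp only [Sum.elim_comp_inl, exists_const_iff]
    exact ⟨fun h => ⟨⟨fun x => x.elim⟩, h⟩, fun h => h.2⟩⟩

lemma Dio.eq {g h : (ι → K) → K} (hg : PF g) (hh : PF h) : Dio (fun a => g a = h a) :=
  (Dio.eqz (hg.sub hh)).congr fun _ => sub_eq_zero.symm

lemma Dio.triv (c : Prop) : Dio (fun _ : ι → K => c) := by
  by_cases hc : c
  · exact (Dio.eqz (PF.const 0)).congr fun a => by simp [hc]
  · exact (Dio.eqz (PF.const 1)).congr fun a => by simp [hc]

lemma Dio.ex {P : (ι → K) → K → Prop} (h : Dio (fun p : ι ⊕ Unit → K => P (p ∘ Sum.inl) (p (Sum.inr ())))) :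
    Dio (fun a => ∃ t, P a t) := by
  obtain ⟨κ, hκ, g, hg, H⟩ := h
  let r : (ι ⊕ Unit) ⊕ κ → ι ⊕ (Unit ⊕ κ) :=
    Sum.elim (Sum.elim Sum.inl (fun _ => Sum.inr (Sum.inl ()))) (fun k => Sum.inr (Sum.inr k))
  refine ⟨Unit ⊕ κ, inferInstance, fun p => g (p ∘ r), hg.comap _, fun a => ?_⟩
  constructor
  · rintro ⟨t, ht⟩
    obtain ⟨x, hx⟩ := (H (Sum.elim a (fun _ => t))).1 ht
    refine ⟨Sum.elim (fun _ => t) x, ?_⟩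
    rw [← hx]
    refine congrArg g ?_
    funext i
    rcases i with (i | i) | i <;> rfl
  · rintro ⟨x, hx⟩
    refine ⟨x (Sum.inl ()), ?_⟩
    refine (H (Sum.elim a (fun _ => x (Sum.inl ())))).2 ⟨x ∘ Sum.inr, ?_⟩
    rw [← hx]
    congr 1
    funext i
    rcases i with (i | i) | i <;> rfl

lemma Dio.comb {P Q : (ι → K) → Prop} (hP : Dio P) (hQ : Dio Q) {m : K → K → K}
    (hm : ∀ {ι : Type} {g h : (ι → K) → K}, PF g → PF h → PF (fun a => m (g a) (h a))) :
    ∃ (κ κ' : Type) (_ : Finite κ) (_ : Finite κ') (g : (ι ⊕ κ → K) → K) (g' : (ι ⊕ κ' → K) → K),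
      (∀ a, P a ↔ ∃ x, g (Sum.elim a x) = 0) ∧ (∀ a, Q a ↔ ∃ x, g' (Sum.elim a x) = 0) ∧
      Dio (fun a => ∃ x y, m (g (Sum.elim a x)) (g' (Sum.elim a y)) = 0) := by
  obtain ⟨κ, hκ, g, hg, H⟩ := hP
  obtain ⟨κ', hκ', g', hg', H'⟩ := hQ
  refine ⟨κ, κ', hκ, hκ', g, g', H, H', κ ⊕ κ', inferInstance, _,
    hm (hg.comap (Sum.elim Sum.inl (fun k => Sum.inr (Sum.inl k)) : ι ⊕ κ → ι ⊕ (κ ⊕ κ')))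
      (hg'.comap (Sum.elim Sum.inl (fun k => Sum.inr (Sum.inr k)) : ι ⊕ κ' → ι ⊕ (κ ⊕ κ'))), fun a => ?_⟩
  have e1 : ∀ z : κ ⊕ κ' → K, Sum.elim a z ∘ (Sum.elim Sum.inl (fun k => Sum.inr (Sum.inl k)) : ι ⊕ κ → ι ⊕ (κ ⊕ κ'))
      = Sum.elim a (z ∘ Sum.inl) := by
    intro z; funext i; rcases i with i | i <;> rfl
  have e2 : ∀ z : κ ⊕ κ' → K, Sum.elim a z ∘ (Sum.elim Sum.inl (fun k => Sum.inr (Sum.inr k)) : ι ⊕ κ' → ι ⊕ (κ ⊕ κ'))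
      = Sum.elim a (z ∘ Sum.inr) := by
    intro z; funext i; rcases i with i | i <;> rfl
  simp only [e1, e2]
  constructor
  · rintro ⟨x, y, h⟩; exact ⟨Sum.elim x y, by simpa using h⟩
  · rintro ⟨z, h⟩; exact ⟨_, _, h⟩

lemma Dio.or {P Q : (ι → K) → Prop} (hP : Dio P) (hQ : Dio Q) : Dio (fun a => P a ∨ Q a) := by
  obtain ⟨κ, κ', hκ, hκ', g, g', H, H', h⟩ := Dio.comb hP hQ (m := fun x y => x * y) PF.mul
  by_cases hdeg : ∀ a, P a ∨ Q a ↔ ∃ x y, g (Sum.elim a x) * g' (Sum.elim a y) = 0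
  · exact h.congr hdeg
  · exfalso
    apply hdeg
    intro a
    rw [H, H']
    simp only [mul_eq_zero]
    constructor
    · rintro (⟨x, hx⟩ | ⟨x, hx⟩)
      · exact ⟨x, 0, Or.inl hx⟩
      · exact ⟨0, x, Or.inr hx⟩
    · rintro ⟨x, y, h | h⟩
      · exact Or.inl ⟨x, h⟩
      · exact Or.inr ⟨y, h⟩

lemma Dio.and {u : K} (hu : ¬ IsSquare u) {P Q : (ι → K) → Prop} (hP : Dio P) (hQ : Dio Q) :
    Dio (fun a => P a ∧ Q a) := by
  obtain ⟨κ, κ', hκ, hκ', g, g', H, H', h⟩ := Dio.comb hP hQ (m := fun x y => x ^ 2 - u * y ^ 2)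
    (fun hg hh => hg.sq.sub ((PF.const u).mul hh.sq))
  refine h.congr fun a => ?_
  rw [H, H']
  constructor
  · rintro ⟨⟨x, hx⟩, ⟨y, hy⟩⟩; exact ⟨x, y, by simp [hx, hy]⟩
  · rintro ⟨x, y, h⟩
    have hy : g' (Sum.elim a y) = 0 := by
      by_contra hy
      exact hu ⟨g (Sum.elim a x) / g' (Sum.elim a y), by field_simp; linear_combination -h⟩
    have hx : g (Sum.elim a x) = 0 := by simpa [hy] using h
    exact ⟨⟨x, hx⟩, y, hy⟩

lemma Dio.nez {g : (ι → K) → K} (hg : PF g) : Dio (fun a => g a ≠ 0) := by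
  refine Dio.congr (P := fun a => ∃ t, g a * t = 1) (Dio.ex (Dio.eq (hg.l.mul PF.last) (PF.const 1))) fun a => ?_
  constructor
  · intro h; exact ⟨(g a)⁻¹, mul_inv_cancel₀ h⟩
  · rintro ⟨t, ht⟩ h; simp [h] at ht

lemma Dio.exFin {α : Type*} (R : Finset α) {P : α → (ι → K) → Prop} (h : ∀ e ∈ R, Dio (P e)) :
    Dio (fun a => ∃ e ∈ R, P e a) := by
  classical
  induction R using Finset.induction_on with
  | empty => exact (Dio.triv False).congr fun a => by simp
  | insert e R he ih =>
    refine ((h e (by simp)).or (ih fun e' he' => h e' (by simp [he']))).congr fun a => by simp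

lemma Dio.allFin {u : K} (hu : ¬ IsSquare u) {α : Type*} (R : Finset α) {P : α → (ι → K) → Prop}
    (h : ∀ e ∈ R, Dio (P e)) : Dio (fun a => ∀ e ∈ R, P e a) := by
  classical
  induction R using Finset.induction_on with
  | empty => exact (Dio.triv True).congr fun a => by simp
  | insert e R he ih =>
    refine (Dio.and hu (h e (by simp)) (ih fun e' he' => h e' (by simp [he']))).congr fun a => by simp

lemma Dio.imp {c : Prop} {P : (ι → K) → Prop} (h : Dio P) : Dio (fun a => c → P a) := by
  by_cases hc : c
  · exact h.congr fun a => by simp [hc]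
  · exact (Dio.triv True).congr fun a => by simp [hc]

lemma Dio.nm {g h : (ι → K) → K} (hg : PF g) (hh : PF h) : Dio (fun a => Nm (g a) (h a)) :=
  Dio.ex (P := fun a x => ∃ y, h a = x ^ 2 - g a * y ^ 2)
    (Dio.ex (P := fun p y => h (p ∘ Sum.inl) = p (Sum.inr ()) ^ 2 - g (p ∘ Sum.inl) * y ^ 2)
      (Dio.eq hh.l.l (PF.last.l.sq.sub (hg.l.l.mul PF.last.sq))))

lemma Dio.slot {u : K} (hu : ¬ IsSquare u) {c r s : (ι → K) → K} (hc : PF c) (hr : PF r) (hs : PF s) :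
    Dio (fun a => Slot (c a) (r a) (s a)) :=
  Dio.ex (P := fun a x => x ≠ 0 ∧ Nm (c a) (r a * x) ∧ Nm x (c a * s a))
    (Dio.and hu (Dio.nez PF.last) (Dio.and hu (Dio.nm hc.l (hr.l.mul PF.last)) (Dio.nm PF.last (hc.l.mul hs.l))))

end

/-- auxiliary certificate -/
def Core {K : Type*} [Field K] (o w : Place K) (a0 b0 a b s x x0 y z : K) : Prop :=
  ((y ≠ 0 ∧ z ≠ 0 ∧ o.th y z = -1) ∧ (y ≠ 0 ∧ z ≠ 0 ∧ w.th y z = 1)) ∧ s ≠ 0 ∧ x ≠ 0 ∧ x0 ≠ 0 ∧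
    Nm a (b * x) ∧ Nm x (a * s) ∧ Nm a0 (b0 * x0) ∧ Nm x0 (a0 * s) ∧
    Slot y z s ∧ Slot y z (x * x0) ∧ Slot y z (s * (x * x0)) ∧ Slot y z (-(s * (x * x0)))

universe u
section
variable {F K : Type u} [Field F] [Finite F] [NeZero (2 : F)] [Field K] [Algebra F K] [GF F K]

theorem dio_main (hex : ∀ x : K, IsAlgebraic F x → ∃ c : F, algebraMap F K c = x) {ι : Type}
    {A B : (ι → K) → K} (hA : PF A) (hB : PF B) :
    Dio (fun a => A a ≠ 0 ∧ B a ≠ 0 ∧ ¬ Nm (A a) (B a)) := by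
  obtain ⟨u', hu'⟩ := exists_nonsq F
  obtain ⟨u, hu⟩ : ∃ u : K, ¬ IsSquare u := ⟨_, nsq_const hex hu'⟩
  obtain ⟨o, ho⟩ := exists_odd hex
  obtain ⟨w, how⟩ := exists_other F o
  obtain ⟨R, hR0, hR⟩ := exists_reps F how
  obtain ⟨a0, b0, ha0, hb0, h0⟩ := EX hex ho how
  have dN0 : ∀ {ι : Type} {g : (ι → K) → K}, PF g → Dio (fun a => N0 o w (g a)) := fun hg =>
    (Dio.and hu (Dio.nez hg) (Dio.slot hu (PF.const a0) (PF.const b0) hg)).congr fun a =>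
      N0_iff (F := F) ha0 hb0 h0 _
  have dG0 : ∀ {ι : Type} {g : (ι → K) → K}, PF g → Dio (fun a => G0 o w (g a)) := fun hg =>
    (Dio.and hu (Dio.nez hg) (Dio.allFin hu R fun e _ => Dio.imp (dN0 ((PF.const e).mul hg)))).congr fun a =>
      G0_iff (F := F) hR0 hR _
  have dth : ∀ {ι : Type} {g h : (ι → K) → K}, PF g → PF h → ∀ (v : Place K), (v = o ∨ v = w) → ∀ τ : ℤ,
      Dio (fun a => g a ≠ 0 ∧ h a ≠ 0 ∧ v.th (g a) (h a) = τ) := by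
    intro ι g h hg hh v hv τ
    refine (Dio.and hu (Dio.nez hg) (Dio.and hu (Dio.nez hh) (Dio.exFin R fun e _ => Dio.exFin R fun e' _ =>
      Dio.and hu (dG0 ((PF.const e).mul hg)) (Dio.and hu (dG0 ((PF.const e').mul hh))
        (Dio.triv (v.th e e' = τ)))))).congr fun a => ?_
    constructor
    · rintro ⟨h1, h2, h3⟩; exact ⟨h1, h2, (th_iff (F := F) hR0 hR h1 h2 v hv τ).1 h3⟩
    · rintro ⟨h1, h2, h3⟩; exact ⟨h1, h2, (th_iff (F := F) hR0 hR h1 h2 v hv τ).2 h3⟩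
  have c0 : ∀ {ι : Type} {a b s x x0 y z : (ι → K) → K}, PF a → PF b → PF s → PF x → PF x0 → PF y → PF z →
      Dio (fun p => Core o w a0 b0 (a p) (b p) (s p) (x p) (x0 p) (y p) (z p)) := by
    intro ι a b s x x0 y z ha hb hs hx hx0 hy hz
    have hm := hx.mul hx0
    exact Dio.and hu (Dio.and hu (dth hy hz o (Or.inl rfl) _) (dth hy hz w (Or.inr rfl) _)) <|
      Dio.and hu (Dio.nez hs) <| Dio.and hu (Dio.nez hx) <| Dio.and hu (Dio.nez hx0) <|
      Dio.and hu (Dio.nm ha (hb.mul hx)) <| Dio.and hu (Dio.nm hx (ha.mul hs)) <|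
      Dio.and hu (Dio.nm (PF.const _) ((PF.const _).mul hx0)) <| Dio.and hu (Dio.nm hx0 ((PF.const _).mul hs)) <|
      Dio.and hu (Dio.slot hu hy hz hs) <| Dio.and hu (Dio.slot hu hy hz hm) <|
      Dio.and hu (Dio.slot hu hy hz (hs.mul hm)) (Dio.slot hu hy hz (hs.mul hm).neg)
  have c1 : ∀ {ι : Type} {a b s x x0 y : (ι → K) → K}, PF a → PF b → PF s → PF x → PF x0 → PF y →
      Dio (fun p => ∃ z, Core o w a0 b0 (a p) (b p) (s p) (x p) (x0 p) (y p) z) :=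
    fun {ι a b s x x0 y} ha hb hs hx hx0 hy =>
      Dio.ex (P := fun p z => Core o w a0 b0 (a p) (b p) (s p) (x p) (x0 p) (y p) z)
        (c0 ha.l hb.l hs.l hx.l hx0.l hy.l PF.last)
  have c2 : ∀ {ι : Type} {a b s x x0 : (ι → K) → K}, PF a → PF b → PF s → PF x → PF x0 →
      Dio (fun p => ∃ y z, Core o w a0 b0 (a p) (b p) (s p) (x p) (x0 p) y z) :=
    fun {ι a b s x x0} ha hb hs hx hx0 =>
      Dio.ex (P := fun p y => ∃ z, Core o w a0 b0 (a p) (b p) (s p) (x p) (x0 p) y z)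
        (c1 ha.l hb.l hs.l hx.l hx0.l PF.last)
  have c3 : ∀ {ι : Type} {a b s x : (ι → K) → K}, PF a → PF b → PF s → PF x →
      Dio (fun p => ∃ x0 y z, Core o w a0 b0 (a p) (b p) (s p) (x p) x0 y z) :=
    fun {ι a b s x} ha hb hs hx =>
      Dio.ex (P := fun p x0 => ∃ y z, Core o w a0 b0 (a p) (b p) (s p) (x p) x0 y z)
        (c2 ha.l hb.l hs.l hx.l PF.last)
  have c4 : ∀ {ι : Type} {a b s : (ι → K) → K}, PF a → PF b → PF s →
      Dio (fun p => ∃ x x0 y z, Core o w a0 b0 (a p) (b p) (s p) x x0 y z) :=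
    fun {ι a b s} ha hb hs =>
      Dio.ex (P := fun p x => ∃ x0 y z, Core o w a0 b0 (a p) (b p) (s p) x x0 y z)
        (c3 ha.l hb.l hs.l PF.last)
  have c5 : Dio (fun p => ∃ s x x0 y z, Core o w a0 b0 (A p) (B p) s x x0 y z) :=
      Dio.ex (P := fun p s => ∃ x x0 y z, Core o w a0 b0 (A p) (B p) s x x0 y z)
        (c4 hA.l hB.l PF.last)
  refine (Dio.or (dth hA hB o (Or.inl rfl) (-1)) (Dio.or (dth hA hB w (Or.inr rfl) (-1))
    (Dio.and hu (Dio.nez hA) (Dio.and hu (Dio.nez hB) c5)))).congr fun p => ?_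
  constructor
  · rintro ⟨h1, h2, h3⟩
    rw [cert_iff hex ho how ha0 hb0 h0 h1 h2] at h3
    rcases h3 with h | h | ⟨s, hs, x, hx, x0, hx0, y, hy, z, hz, x1, x2, y1, y2, t1, t2, s1, s2, s3, s4⟩
    · exact Or.inl ⟨h1, h2, h⟩
    · exact Or.inr (Or.inl ⟨h1, h2, h⟩)
    · exact Or.inr (Or.inr ⟨h1, h2, s, x, x0, y, z, ⟨⟨hy, hz, t1⟩, hy, hz, t2⟩, hs, hx, hx0, x1, x2, y1, y2,
        s1, s2, s3, s4⟩)
  · rintro (⟨h1, h2, h⟩ | ⟨h1, h2, h⟩ | ⟨h1, h2, s, x, x0, y, z, ⟨⟨hy, hz, t1⟩, -, -, t2⟩, hs, hx, hx0,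
      x1, x2, y1, y2, s1, s2, s3, s4⟩)
    · exact ⟨h1, h2, (cert_iff hex ho how ha0 hb0 h0 h1 h2).2 (Or.inl h)⟩
    · exact ⟨h1, h2, (cert_iff hex ho how ha0 hb0 h0 h1 h2).2 (Or.inr (Or.inl h))⟩
    · exact ⟨h1, h2, (cert_iff hex ho how ha0 hb0 h0 h1 h2).2 (Or.inr (Or.inr
        ⟨s, hs, x, hx, x0, hx0, y, hy, z, hz, x1, x2, y1, y2, t1, t2, s1, s2, s3, s4⟩))⟩

end

open IntermediateField in
lemma gf_of_functionField (Fq K : Type*) [Field Fq] [Field K] [Algebra (RatFunc Fq) K]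
    [FunctionField Fq K] [Algebra Fq K] [IsScalarTower Fq (RatFunc Fq) K] : GF Fq K := by
  set t : K := algebraMap (RatFunc Fq) K RatFunc.X with ht
  have htr : Transcendental Fq t := by
    rw [ht, transcendental_algebraMap_iff (algebraMap (RatFunc Fq) K).injective]
    exact RatFunc.transcendental_X
  refine GF.of_exists htr ?_
  have hmem : ∀ f : RatFunc Fq, algebraMap (RatFunc Fq) K f ∈ Fq⟮t⟯ := by
    intro f
    have h1 : f ∈ Fq⟮(RatFunc.X : RatFunc Fq)⟯ := by rw [RatFunc.adjoin_X]; trivial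
    have h2 := (IntermediateField.mem_map (f := IsScalarTower.toAlgHom Fq (RatFunc Fq) K)
      (S := Fq⟮(RatFunc.X : RatFunc Fq)⟯) (y := algebraMap _ _ f)).2 ⟨f, h1, rfl⟩
    rw [IntermediateField.adjoin_map, Set.image_singleton] at h2
    exact h2
  let φ : RatFunc Fq →+* Fq⟮t⟯ := (algebraMap (RatFunc Fq) K).codRestrict Fq⟮t⟯.toSubfield hmem
  let _ : Algebra (RatFunc Fq) Fq⟮t⟯ := φ.toAlgebra
  have : IsScalarTower (RatFunc Fq) Fq⟮t⟯ K := IsScalarTower.of_algebraMap_eq fun x => rfl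
  have : Module.Finite (RatFunc Fq) K := ‹FunctionField Fq K›
  exact Module.Finite.of_restrictScalars_finite (RatFunc Fq) Fq⟮t⟯ K

lemma isotropic_iff {K : Type*} [Field K] (h2 : (2 : K) ≠ 0) {a : Fin 3 → K} (h : ∀ i, a i ≠ 0) :
    (∀ x : Fin 3 → K, a 0 * x 0 ^ 2 + a 1 * x 1 ^ 2 + a 2 * x 2 ^ 2 = 0 → x = 0) ↔
      ¬ Nm (-(a 0 * a 1)) (-(a 0 * a 2)) := by
  constructor
  · rintro H ⟨x, y, hxy⟩
    have := H ![x / a 0, y, 1] (by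
      have h0 := h 0
      simp only [Matrix.cons_val]
      field_simp
      linear_combination -hxy)
    have := congr_fun this 2
    simp at this
  · intro H x hx
    by_contra hne
    refine H (Nm_of_isotropic h2 (x := a 0 * x 0) (y := x 1) (z := x 2)
      (neg_ne_zero.2 (mul_ne_zero (h 0) (h 1))) (by linear_combination a 0 * hx) ?_)
    by_contra hc
    push Not at hc
    apply hne
    funext i
    fin_cases i
    · simpa [h 0] using hc.1
    · exact hc.2.1
    · exact hc.2.2

lemma two_ne_zero_of_odd {F : Type*} [Field F] [Fintype F] (h : Odd (Fintype.card F)) : (2 : F) ≠ 0 := by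
  intro h2
  have h3 : (Fintype.card F : F) = 0 := FiniteField.cast_card_eq_zero F
  obtain ⟨k, hk⟩ := h
  rw [hk] at h3
  push_cast at h3
  rw [h2] at h3
  simp at h3

end TAD

theorem TAD.isDiophantine_of_dio {K : Type*} [Field K] {ι : Type} [Fintype ι] {P : (ι → K) → Prop}
    (h : TAD.Dio P) : IsDiophantine {a | P a} := by
  obtain ⟨κ, hκ, g, ⟨p, hp⟩, H⟩ := h
  obtain ⟨m, ⟨e⟩⟩ := Finite.exists_equiv_fin κ
  refine ⟨m, MvPolynomial.rename (Sum.map id e) p, fun a => ?_⟩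
  rw [Set.mem_ofPred_eq, H]
  simp only [MvPolynomial.eval_rename, Sum.elim_comp_map, hp, Function.comp_id]
  constructor
  · rintro ⟨x, hx⟩
    refine ⟨x ∘ e.symm, ?_⟩
    rwa [Function.comp_assoc, Equiv.symm_comp_self, Function.comp_id]
  · rintro ⟨x, hx⟩; exact ⟨_, hx⟩

/-- Over a global function field `K` of odd characteristic, the set of triples
`(a₁, a₂, a₃) ∈ (Kˣ)³` such that the ternary form `a₁x² + a₂y² + a₃z²` is anisotropic over
`K` is diophantine over `K`. -/
theorem ternary_anisotropic_diophantine_functionField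
    (Fq K : Type*) [Field Fq] [Fintype Fq] [Field K] [Algebra (RatFunc Fq) K]
    [FunctionField Fq K] (hq : Odd (Fintype.card Fq)) :
    IsDiophantine {a : Fin 3 → K |
      (∀ i, a i ≠ 0) ∧
      ∀ x : Fin 3 → K, a 0 * x 0 ^ 2 + a 1 * x 1 ^ 2 + a 2 * x 2 ^ 2 = 0 → x = 0} := by
  letI : Algebra Fq K := ((algebraMap (RatFunc Fq) K).comp (algebraMap Fq (RatFunc Fq))).toAlgebra
  haveI : IsScalarTower Fq (RatFunc Fq) K := IsScalarTower.of_algebraMap_eq fun x => rfl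
  haveI := TAD.gf_of_functionField Fq K
  haveI : NeZero (2 : Fq) := ⟨TAD.two_ne_zero_of_odd hq⟩
  have h2 : (2 : K) ≠ 0 := TAD.two_ne Fq
  refine TAD.isDiophantine_of_dio ?_
  refine (TAD.dio_main (F := algebraicClosure Fq K) (K := K) TAD.exact_ac (ι := Fin 3)
    (A := fun a => -(a 0 * a 1)) (B := fun a => -(a 0 * a 2)) ((TAD.PF.coord 0).mul (TAD.PF.coord 1)).neg
    ((TAD.PF.coord 0).mul (TAD.PF.coord 2)).neg).congr fun a => ?_
  constructor
  · rintro ⟨h, hx⟩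
    exact ⟨neg_ne_zero.2 (mul_ne_zero (h 0) (h 1)), neg_ne_zero.2 (mul_ne_zero (h 0) (h 2)),
      (TAD.isotropic_iff h2 h).1 hx⟩
  · rintro ⟨h1, h3, hN⟩
    have h : ∀ i, a i ≠ 0 := by
      intro i hi
      fin_cases i <;> simp_all
    exact ⟨h, (TAD.isotropic_iff h2 h).2 hN⟩
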